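/- Let N ⊆ M be hyperfinite II₁ factors with N' ∩ M = ℂ1 and finite Jones index, and let ω be a free ultrafilter on ℕ such that M' ∩ M^ω ⊆ N^ω. Then the three algebras M' ∩ M^ω ⊆ N' ∩ N^ω ⊆ N' ∩ M^ω are II₁ factors, and the Jones indices satisfy [N' ∩ M^ω : M' ∩ M^ω] = [M : N] = [N' ∩ M^ω : N' ∩ N^ω]. -/

import Mathlib

open scoped ComplexOrder
open Filter

namespace PopaQ

variable {H : Type u} [NormedAddCommGroup H] [InnerProductSpace ℂ H] [CompleteSpace H]

/-- Bounded operators on `H`. -/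
abbrev Op (H : Type u) [NormedAddCommGroup H] [InnerProductSpace ℂ H] [CompleteSpace H] :=
  H →L[ℂ] H

/-- The relative commutant `N' ∩ M` (as sets of operators). -/
def relComm (N M : Set (Op H)) : Set (Op H) :=
  {x | x ∈ M ∧ ∀ y ∈ N, y * x = x * y}

/-- The scalar operators `ℂ 1`. -/
def scalars (H : Type u) [NormedAddCommGroup H] [InnerProductSpace ℂ H] [CompleteSpace H] :
    Set (Op H) :=
  {x | ∃ c : ℂ, x = c • (1 : Op H)}

/-- A (self-adjoint) projection. -/
def IsProjection (p : Op H) : Prop :=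
  IsSelfAdjoint p ∧ IsIdempotentElem p

/-- `τ` is a faithful tracial state on `M`. -/
structure IsTracialState (M : Set (Op H)) (τ : Op H →ₗ[ℂ] ℂ) : Prop where
  map_one : τ 1 = 1
  tracial : ∀ x ∈ M, ∀ y ∈ M, τ (x * y) = τ (y * x)
  pos : ∀ x ∈ M, 0 ≤ τ (star x * x)
  faithful : ∀ x ∈ M, τ (star x * x) = 0 → x = 0

/-- A set of operators is finite dimensional as a complex vector space. -/
def FinDim (S : Set (Op H)) : Prop :=
  ∃ s : Finset (Op H), S ⊆ (Submodule.span ℂ (s : Set (Op H)) : Set (Op H))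

/-- `M` is a II₁ factor with faithful normal trace `τ`:
a factor (trivial center) carrying a faithful tracial state, which is
infinite dimensional. -/
structure IsII1Factor (M : VonNeumannAlgebra H) (τ : Op H →ₗ[ℂ] ℂ) : Prop where
  factor : relComm (M : Set (Op H)) (M : Set (Op H)) = scalars H
  trace : IsTracialState (M : Set (Op H)) τ
  infdim : ¬ FinDim (M : Set (Op H))

/-- `M` is hyperfinite: it is the (weak closure = double commutant) of an increasing
union of finite-dimensional *-subalgebras. -/
def IsHyperfinite (M : VonNeumannAlgebra H) : Prop :=
  ∃ A : ℕ → StarSubalgebra ℂ (Op H),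
    Monotone A ∧ (∀ n, (A n : Set (Op H)) ⊆ M) ∧ (∀ n, FinDim (A n : Set (Op H))) ∧
    Set.centralizer (Set.centralizer (⋃ n, (A n : Set (Op H)))) = (M : Set (Op H))

/-- A bounded sequence of operators. -/
def Bdd (x : ℕ → Op H) : Prop :=
  ∃ C : ℝ, ∀ n, ‖x n‖ ≤ C

/-- A sequence taking values in `S`. -/
def SeqIn (S : Set (Op H)) (x : ℕ → Op H) : Prop :=
  ∀ n, x n ∈ S

/-- A free ultrafilter on ℕ. -/
def IsFreeUltrafilter (ω : Ultrafilter ℕ) : Prop :=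
  ∀ s : Set ℕ, s.Finite → s ∉ ω

/-- `Mω` is the tracial ultrapower of `M` along `ω`, with trace `τ`;
`limω` assigns to each bounded sequence in `M` its class in `Mω` (the diagonal
embedding of `M` into `Mω` being the identity on `M`). -/
structure IsTracialUltrapower (ω : Ultrafilter ℕ) (M Mω : VonNeumannAlgebra H)
    (τ : Op H →ₗ[ℂ] ℂ) (limω : (ℕ → Op H) → Op H) : Prop where
  subset : (M : Set (Op H)) ⊆ (Mω : Set (Op H))
  mem : ∀ x, SeqIn (M : Set (Op H)) x → Bdd x → limω x ∈ Mω
  diag : ∀ m ∈ M, limω (fun _ => m) = m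
  map_add : ∀ x y, SeqIn (M : Set (Op H)) x → Bdd x → SeqIn (M : Set (Op H)) y → Bdd y →
    limω (fun n => x n + y n) = limω x + limω y
  map_mul : ∀ x y, SeqIn (M : Set (Op H)) x → Bdd x → SeqIn (M : Set (Op H)) y → Bdd y →
    limω (fun n => x n * y n) = limω x * limω y
  map_smul : ∀ (c : ℂ) x, SeqIn (M : Set (Op H)) x → Bdd x →
    limω (fun n => c • x n) = c • limω x
  map_star : ∀ x, SeqIn (M : Set (Op H)) x → Bdd x →
    limω (fun n => star (x n)) = star (limω x)
  surj : ∀ z ∈ Mω, ∃ x, SeqIn (M : Set (Op H)) x ∧ Bdd x ∧ limω x = z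
  tr : ∀ x, SeqIn (M : Set (Op H)) x → Bdd x →
    Tendsto (fun n => τ (x n)) (ω : Filter ℕ) (nhds (τ (limω x)))
  eq_zero : ∀ x, SeqIn (M : Set (Op H)) x → Bdd x →
    (limω x = 0 ↔ Tendsto (fun n => ‖τ (star (x n) * x n)‖) (ω : Filter ℕ) (nhds 0))
  traceState : IsTracialState (Mω : Set (Op H)) τ

/-- The ultrapower `N^ω ⊆ M^ω` of a subalgebra `N ⊆ M`: classes of bounded
sequences with entries in `N`. -/
def ultrapowerSet (limω : (ℕ → Op H) → Op H) (N : Set (Op H)) : Set (Op H) :=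
  {z | ∃ x, SeqIn N x ∧ Bdd x ∧ limω x = z}

/-- `θ` is a *-homomorphism from `S` to `T` (as sets of operators). -/
def IsStarHomOn (θ : Op H → Op H) (S T : Set (Op H)) : Prop :=
  (∀ x ∈ S, θ x ∈ T) ∧
  (∀ x ∈ S, ∀ y ∈ S, θ (x + y) = θ x + θ y) ∧
  (∀ x ∈ S, ∀ y ∈ S, θ (x * y) = θ x * θ y) ∧
  (∀ (c : ℂ), ∀ x ∈ S, θ (c • x) = c • θ x) ∧
  (∀ x ∈ S, θ (star x) = star (θ x))

/-- The corner `p S p` of a set of operators. -/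
def corner (p : Op H) (S : Set (Op H)) : Set (Op H) :=
  {x | x ∈ S ∧ p * x * p = x}

/-- Popa's intertwining relation: a corner of `P` embeds into `Q` inside `M`,
written `P ≺_M Q`: there are nonzero projections `p ∈ P`, `q ∈ Q`, a
*-homomorphism `θ : pPp → qQq` and a nonzero partial isometry `v ∈ qMp` with
`θ(x) v = v x` for all `x ∈ pPp`. -/
def CornerEmbeds (P Q M : Set (Op H)) : Prop :=
  ∃ (p q v : Op H) (θ : Op H → Op H),
    p ∈ P ∧ IsProjection p ∧ p ≠ 0 ∧
    q ∈ Q ∧ IsProjection q ∧ q ≠ 0 ∧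
    IsStarHomOn θ (corner p P) (corner q Q) ∧
    v ∈ M ∧ v ≠ 0 ∧ IsProjection (star v * v) ∧ q * v * p = v ∧
    ∀ x ∈ corner p P, θ x * v = v * x

/-- `E` is the (`τ`-preserving) conditional expectation from `M` onto `Q`. -/
structure IsCondExp (τ : Op H →ₗ[ℂ] ℂ) (M Q : Set (Op H)) (E : Op H → Op H) : Prop where
  mem : ∀ x ∈ M, E x ∈ Q
  fix : ∀ q ∈ Q, E q = q
  map_add : ∀ x ∈ M, ∀ y ∈ M, E (x + y) = E x + E y
  map_smul : ∀ (c : ℂ), ∀ x ∈ M, E (c • x) = c • E x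
  bimod : ∀ a ∈ Q, ∀ x ∈ M, ∀ b ∈ Q, E (a * x * b) = a * E x * b
  tr : ∀ x ∈ M, τ (E x) = τ x

/-- `c` is a Pimsner–Popa bound for the inclusion `Q ⊆ M` with conditional
expectation `E`: every positive `x ∈ M` satisfies `x ≤ c E(x)`. -/
def IndexBound (M : Set (Op H)) (E : Op H → Op H) (c : ℝ) : Prop :=
  ∀ x ∈ M, x.IsPositive → (c • E x - x).IsPositive

/-- The inclusion `Q ⊆ M` (with conditional expectation `E`) has finite Jones index. -/
def HasFiniteIndex (M : Set (Op H)) (E : Op H → Op H) : Prop :=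
  ∃ c : ℝ, 0 < c ∧ IndexBound M E c

/-- The Jones index `[M : Q]` of an inclusion `Q ⊆ M` with conditional expectation `E`,
via the Pimsner–Popa characterization as the optimal constant `c` with
`x ≤ c E(x)` for all positive `x ∈ M`. -/
noncomputable def jonesIndex (M : Set (Op H)) (E : Op H → Op H) : ℝ :=
  sInf {c : ℝ | 0 < c ∧ IndexBound M E c}

/-- A set of operators is a II₁ factor (with trace `τ`): trivial center, a faithful
tracial state, and infinite dimensional. -/
def IsII1FactorSet (S : Set (Op H)) (τ : Op H →ₗ[ℂ] ℂ) : Prop :=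
  relComm S S = scalars H ∧ IsTracialState S τ ∧ ¬ FinDim S

end PopaQ

open scoped ComplexOrder
open Filter Topology
namespace PopaQ

section TraceLayer
variable {R : Type*} [CStarAlgebra R]

/-- Faithful tracial state on a C*-algebra. -/
structure TrSt (τ : R →ₗ[ℂ] ℂ) : Prop where
  one : τ 1 = 1
  comm : ∀ x y, τ (x * y) = τ (y * x)
  pos : ∀ x, 0 ≤ τ (star x * x)
  faithful : ∀ x, τ (star x * x) = 0 → x = 0

/-- The 2-norm. -/
noncomputable def n2 (τ : R →ₗ[ℂ] ℂ) (x : R) : ℝ := √(τ (star x * x)).re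

variable {τ : R →ₗ[ℂ] ℂ}

lemma TrSt.tau_star (h : TrSt τ) (x : R) : τ (star x) = star (τ x) := by
  have key : ∀ y : R, (τ (star y * y)).im = 0 := fun y => by
    have := h.pos y
    rw [Complex.le_def] at this
    simpa using this.2.symm
  have h1 := key (1 + x)
  have h2 := key (1 + Complex.I • x)
  have hx := key x
  have e1 : star (1 + x) * (1 + x) = 1 + x + star x + star x * x := by
    simp only [star_add, star_one]; noncomm_ring
  have e2 : star (1 + Complex.I • x) * (1 + Complex.I • x)
      = 1 + Complex.I • x - Complex.I • star x + star x * x := by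
    simp only [star_add, star_one, star_smul, Complex.star_def, Complex.conj_I, mul_add, add_mul,
      mul_one, one_mul, smul_mul_assoc, mul_smul_comm, neg_smul, neg_mul]
    rw [smul_add, smul_neg, smul_smul, Complex.I_mul_I, neg_smul, one_smul, neg_neg]
    abel
  rw [e1] at h1; rw [e2] at h2
  simp only [map_add, map_sub, map_smul, h.one, Complex.add_im, Complex.sub_im, smul_eq_mul,
    Complex.mul_im, Complex.I_re, Complex.I_im, Complex.one_im, hx] at h1 h2
  apply Complex.ext
  · simp; linarith
  · simp; linarith

lemma TrSt.im_star_mul_self (h : TrSt τ) (y : R) : (τ (star y * y)).im = 0 := by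
  have := h.pos y
  rw [Complex.le_def] at this
  simpa using this.2.symm

lemma TrSt.re_nonneg (h : TrSt τ) (y : R) : 0 ≤ (τ (star y * y)).re := by
  have := h.pos y
  rw [Complex.le_def] at this
  simpa using this.1

/-- The associated core. -/
noncomputable abbrev TrSt.core (h : TrSt τ) : InnerProductSpace.Core ℂ R where
  inner x y := τ (star x * y)
  conj_inner_symm x y := by
    change star (τ (star y * x)) = τ (star x * y)
    rw [← h.tau_star]; simp
  re_inner_nonneg x := h.re_nonneg x
  add_left x y z := by simp [add_mul]
  smul_left x y r := by simp
  definite x := h.faithful x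

lemma n2_nonneg (x : R) : 0 ≤ n2 τ x := Real.sqrt_nonneg _

lemma TrSt.n2_sq (h : TrSt τ) (x : R) : n2 τ x ^ 2 = (τ (star x * x)).re :=
  Real.sq_sqrt (h.re_nonneg x)

lemma TrSt.tau_sq (h : TrSt τ) (x : R) : τ (star x * x) = ((n2 τ x ^ 2 : ℝ) : ℂ) := by
  apply Complex.ext
  · rw [h.n2_sq]; simp
  · rw [h.im_star_mul_self, Complex.ofReal_im]

lemma TrSt.cs (h : TrSt τ) (x y : R) : ‖τ (star x * y)‖ ≤ n2 τ x * n2 τ y := by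
  let _ := h.core
  exact InnerProductSpace.Core.norm_inner_le_norm (𝕜 := ℂ) x y

lemma TrSt.n2_add (h : TrSt τ) (x y : R) : n2 τ (x + y) ≤ n2 τ x + n2 τ y := by
  have h0 := add_nonneg (n2_nonneg (τ := τ) x) (n2_nonneg (τ := τ) y)
  refine abs_le_of_sq_le_sq' ?_ h0 |>.2
  have h1 := (Complex.re_le_norm _).trans (h.cs x y)
  have h2 := (Complex.re_le_norm _).trans (h.cs y x)
  rw [h.n2_sq, star_add, add_mul, mul_add, mul_add, map_add, map_add, map_add, Complex.add_re,
    Complex.add_re, Complex.add_re, ← h.n2_sq, ← h.n2_sq]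
  nlinarith

lemma TrSt.n2_star (h : TrSt τ) (x : R) : n2 τ (star x) = n2 τ x := by
  unfold n2; rw [star_star, h.comm]

lemma TrSt.cs' (h : TrSt τ) (x y : R) : ‖τ (x * y)‖ ≤ n2 τ x * n2 τ y := by
  have := h.cs (star x) y
  rwa [star_star, h.n2_star] at this

lemma TrSt.n2_smul (h : TrSt τ) (c : ℂ) (x : R) : n2 τ (c • x) = ‖c‖ * n2 τ x := by
  unfold n2
  have : τ (star (c • x) * (c • x)) = ((‖c‖ ^ 2 : ℝ) : ℂ) * τ (star x * x) := by
    simp only [star_smul, smul_mul_assoc, mul_smul_comm, map_smul, smul_eq_mul, ← mul_assoc]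
    congr 1
    rw [Complex.star_def, ← Complex.normSq_eq_norm_sq, Complex.normSq_eq_conj_mul_self, mul_comm]
  rw [this, Complex.re_ofReal_mul, Real.sqrt_mul (by positivity), Real.sqrt_sq (norm_nonneg _)]

lemma TrSt.n2_neg (h : TrSt τ) (x : R) : n2 τ (-x) = n2 τ x := by
  unfold n2; simp

lemma TrSt.n2_zero (h : TrSt τ) : n2 τ (0 : R) = 0 := by
  unfold n2; simp

lemma TrSt.n2_one (h : TrSt τ) : n2 τ (1 : R) = 1 := by
  unfold n2; simp [h.one]

lemma TrSt.n2_sub (h : TrSt τ) (x y : R) : n2 τ (x - y) ≤ n2 τ x + n2 τ y := by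
  rw [sub_eq_add_neg, ← h.n2_neg y]; exact h.n2_add _ _

lemma TrSt.n2_sub_comm (h : TrSt τ) (x y : R) : n2 τ (x - y) = n2 τ (y - x) := by
  rw [← h.n2_neg, neg_sub]

lemma TrSt.n2_tri (h : TrSt τ) (x y z : R) : n2 τ (x - z) ≤ n2 τ (x - y) + n2 τ (y - z) := by
  have := h.n2_add (x - y) (y - z)
  rwa [sub_add_sub_cancel] at this

lemma TrSt.n2_le_add (h : TrSt τ) (x y : R) : n2 τ x ≤ n2 τ (x - y) + n2 τ y := by
  have := h.n2_add (x - y) y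
  rwa [sub_add_cancel] at this

lemma TrSt.n2_eq_zero (h : TrSt τ) {x : R} (hx : n2 τ x = 0) : x = 0 := by
  apply h.faithful
  rw [h.tau_sq, hx]; simp

lemma TrSt.n2_sum (h : TrSt τ) {ι : Type*} (s : Finset ι) (f : ι → R) :
    n2 τ (∑ i ∈ s, f i) ≤ ∑ i ∈ s, n2 τ (f i) := by
  classical
  induction s using Finset.induction_on with
  | empty => simp [h.n2_zero]
  | insert a s ha ih =>
    rw [Finset.sum_insert ha, Finset.sum_insert ha]
    exact (h.n2_add _ _).trans (by linarith)

lemma TrSt.norm_tau_le (h : TrSt τ) (x : R) : ‖τ x‖ ≤ n2 τ x := by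
  have := h.cs' 1 x
  rwa [one_mul, h.n2_one, one_mul] at this

section order
variable [PartialOrder R] [StarOrderedRing R]

lemma TrSt.re_nonneg' (h : TrSt τ) {x : R} (hx : 0 ≤ x) : 0 ≤ (τ x).re := by
  obtain ⟨b, rfl⟩ := CStarAlgebra.nonneg_iff_eq_star_mul_self.1 hx
  exact h.re_nonneg b

lemma TrSt.re_mono (h : TrSt τ) {x y : R} (hx : x ≤ y) : (τ x).re ≤ (τ y).re := by
  have := h.re_nonneg' (sub_nonneg.2 hx)
  rw [map_sub, Complex.sub_re] at this; linarith

lemma TrSt.im_zero (h : TrSt τ) {x : R} (hx : 0 ≤ x) : (τ x).im = 0 := by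
  obtain ⟨b, rfl⟩ := CStarAlgebra.nonneg_iff_eq_star_mul_self.1 hx
  exact h.im_star_mul_self b

lemma TrSt.eq_zero_of_nonneg (h : TrSt τ) {x : R} (hx : 0 ≤ x) (h0 : (τ x).re ≤ 0) : x = 0 := by
  obtain ⟨b, rfl⟩ := CStarAlgebra.nonneg_iff_eq_star_mul_self.1 hx
  have : b = 0 := by
    apply h.faithful
    apply Complex.ext
    · exact le_antisymm h0 (h.re_nonneg b)
    · exact h.im_star_mul_self b
  simp [this]

lemma star_mul_self_le (x : R) : star x * x ≤ algebraMap ℝ R (‖x‖ ^ 2) := by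
  have := IsSelfAdjoint.le_algebraMap_norm_self (a := star x * x) (IsSelfAdjoint.star_mul_self x)
  rwa [CStarRing.norm_star_mul_self, ← pow_two] at this

end order

lemma TrSt.n2_mul_le (h : TrSt τ) (x y : R) : n2 τ (x * y) ≤ ‖x‖ * n2 τ y := by
  let _ := CStarAlgebra.spectralOrder R
  let _ := CStarAlgebra.spectralOrderedRing R
  refine Real.sqrt_le_iff.2 ⟨mul_nonneg (norm_nonneg _) (n2_nonneg _), ?_⟩
  have h1 : star y * (star x * x) * y ≤ star y * (algebraMap ℝ R (‖x‖ ^ 2)) * y :=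
    star_left_conjugate_le_conjugate (star_mul_self_le x) y
  have h2 := h.re_mono h1
  have e : star y * (algebraMap ℝ R (‖x‖ ^ 2)) * y = ((‖x‖ ^ 2 : ℝ) : ℂ) • (star y * y) := by
    rw [Algebra.algebraMap_eq_smul_one, mul_smul_comm, mul_one, smul_mul_assoc]
    exact (Complex.coe_smul _ _).symm
  rw [e, map_smul, smul_eq_mul, Complex.re_ofReal_mul, ← h.n2_sq] at h2
  rw [star_mul, mul_pow]
  convert h2 using 3
  noncomm_ring

lemma TrSt.n2_mul_le' (h : TrSt τ) (x y : R) : n2 τ (x * y) ≤ n2 τ x * ‖y‖ := by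
  have := h.n2_mul_le (star y) (star x)
  rw [← star_mul, h.n2_star, h.n2_star, norm_star] at this
  linarith

lemma TrSt.n2_le_norm (h : TrSt τ) (x : R) : n2 τ x ≤ ‖x‖ := by
  have := h.n2_mul_le x 1
  rwa [mul_one, h.n2_one, mul_one] at this

end TraceLayer
end PopaQ

open scoped ComplexOrder
open Filter Topology
namespace PopaQ

section Resolv
variable {R : Type*} [CStarAlgebra R] [PartialOrder R] [StarOrderedRing R]

/-- `1 - (1+a)⁻¹`. -/
noncomputable def tt (a : R) : R := cfc (fun x : ℝ => 1 - (1 + x)⁻¹) a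

lemma spec_nn {a : R} (ha : 0 ≤ a) {x : ℝ} (hx : x ∈ spectrum ℝ a) : 0 ≤ x :=
  spectrum_nonneg_of_nonneg ha hx

lemma tt_cont {a : R} (ha : 0 ≤ a) : ContinuousOn (fun x : ℝ => 1 - (1 + x)⁻¹) (spectrum ℝ a) := by
  refine continuousOn_const.sub ((continuousOn_const.add continuousOn_id).inv₀ ?_)
  intro x hx
  have := spec_nn ha hx
  exact ne_of_gt (show (0:ℝ) < 1 + x by linarith)

lemma rv_cont {a : R} (ha : 0 ≤ a) : ContinuousOn (fun x : ℝ => (1 + x)⁻¹) (spectrum ℝ a) := by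
  refine ((continuousOn_const.add continuousOn_id).inv₀ ?_)
  intro x hx
  have := spec_nn ha hx
  exact ne_of_gt (show (0:ℝ) < 1 + x by linarith)

lemma one_sub_tt {a : R} (ha : 0 ≤ a) : 1 - tt a = cfc (fun x : ℝ => (1 + x)⁻¹) a := by
  have hsa := IsSelfAdjoint.of_nonneg ha
  unfold tt
  rw [cfc_sub (a := a) (fun _ : ℝ => (1 : ℝ)) (fun x : ℝ => (1 + x)⁻¹) continuousOn_const (rv_cont ha)]
  rw [cfc_const_one ℝ a]; simp

lemma tt_mul {a : R} (ha : 0 ≤ a) : (1 - tt a) * (1 + a) = 1 := by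
  have hsa := IsSelfAdjoint.of_nonneg ha
  rw [one_sub_tt ha]
  have e : (1 + a : R) = cfc (fun x : ℝ => 1 + x) a := by
    rw [cfc_add (a := a) (fun _ : ℝ => (1 : ℝ)) (fun x : ℝ => x), cfc_const_one ℝ a, cfc_id' ℝ a]
  conv_lhs => rw [e]
  rw [← cfc_mul (a := a) _ _ (rv_cont ha) (by fun_prop), ← cfc_const_one ℝ a]
  apply cfc_congr
  intro x hx
  have := spec_nn ha hx
  simp only []
  field_simp

lemma mul_tt {a : R} (ha : 0 ≤ a) : (1 + a) * (1 - tt a) = 1 := by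
  have hsa := IsSelfAdjoint.of_nonneg ha
  have h1 := congrArg star (tt_mul ha)
  have h2 : star (tt a) = tt a := (cfc_predicate (fun x : ℝ => 1 - (1 + x)⁻¹) a : IsSelfAdjoint _)
  rw [star_mul, star_one, star_sub, star_one, h2, star_add, hsa.star_eq, star_one] at h1
  exact h1

lemma tt_eq {a r : R} (ha : 0 ≤ a) (hr : r * (1 + a) = 1) : tt a = 1 - r := by
  have : r = 1 - tt a := by
    calc r = r * ((1 + a) * (1 - tt a)) := by rw [mul_tt ha, mul_one]
      _ = 1 - tt a := by rw [← mul_assoc, hr, one_mul]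
  rw [this]; simp

lemma tt_nonneg {a : R} (ha : 0 ≤ a) : 0 ≤ tt a := by
  refine cfc_nonneg fun x hx => ?_
  have := spec_nn ha hx
  have : (1 + x)⁻¹ ≤ 1 := inv_le_one_of_one_le₀ (by linarith)
  linarith

lemma tt_le_one {a : R} (ha : 0 ≤ a) : tt a ≤ 1 := by
  rw [← sub_nonneg, one_sub_tt ha]
  refine cfc_nonneg fun x hx => ?_
  have := spec_nn ha hx
  positivity

lemma norm_tt_le {a : R} (ha : 0 ≤ a) : ‖tt a‖ ≤ 1 :=
  (CStarAlgebra.norm_le_one_iff_of_nonneg _ (tt_nonneg ha)).2 (tt_le_one ha)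

lemma tt_le_self {a : R} (ha : 0 ≤ a) : tt a ≤ a := by
  have hsa := IsSelfAdjoint.of_nonneg ha
  conv_rhs => rw [← cfc_id' ℝ a]
  refine cfc_mono (fun x hx => ?_) (tt_cont ha) continuousOn_id
  have := spec_nn ha hx
  have h1 : (0 : ℝ) < 1 + x := by positivity
  have h2 : 1 - (1 + x)⁻¹ = x / (1 + x) := by field_simp; ring
  rw [h2, div_le_iff₀ h1]; nlinarith

lemma le_tt {a : R} (ha : 0 ≤ a) {C : ℝ} (hC : ‖a‖ ≤ C) : a ≤ (1 + C) • tt a := by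
  have hsa := IsSelfAdjoint.of_nonneg ha
  conv_lhs => rw [← cfc_id' ℝ a]
  unfold tt
  rw [← cfc_smul (1 + C) (fun x : ℝ => 1 - (1 + x)⁻¹) a (tt_cont ha)]
  refine cfc_mono (fun x hx => ?_) continuousOn_id (continuousOn_const.mul (tt_cont ha))
  have h0 := spec_nn ha hx
  have h1 : (0 : ℝ) < 1 + x := by positivity
  have h2 : 1 - (1 + x)⁻¹ = x / (1 + x) := by field_simp; ring
  have h3 : x ≤ C := by
    cases subsingleton_or_nontrivial R
    · rw [spectrum.of_subsingleton] at hx; exact hx.elim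
    exact (le_abs_self x).trans ((spectrum.norm_le_norm_of_mem hx).trans hC)
  rw [h2, smul_eq_mul, ← mul_div_assoc, le_div_iff₀ h1]; nlinarith

lemma tt_mono {a b : R} (ha : 0 ≤ a) (hab : a ≤ b) : tt a ≤ tt b := by
  have hb := ha.trans hab
  have inv : ∀ {c : R}, 0 ≤ c → Ring.inverse (1 + c) = 1 - tt c := fun {c} hc => by
    let u : Rˣ := ⟨1 + c, 1 - tt c, mul_tt hc, tt_mul hc⟩
    exact Ring.inverse_unit u
  have hs : IsStrictlyPositive (1 + a) := by
    refine ⟨add_nonneg zero_le_one ha, ?_⟩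
    exact ⟨⟨1 + a, 1 - tt a, mul_tt ha, tt_mul ha⟩, rfl⟩
  have := CStarAlgebra.ringInverse_le_ringInverse (a := 1 + a) (b := 1 + b) (by gcongr) hs
  rw [inv ha, inv hb] at this
  exact (sub_le_sub_iff_left 1).1 this

lemma tt_mem {a : R} {M : StarSubalgebra ℂ R} (hM : IsClosed (M : Set R)) (ha : a ∈ M) :
    tt a ∈ M := by
  exact cfc_mem (𝕜 := ℝ) (𝕜' := ℂ) (s := M) _ ha

/-- positive elements of a closed star subalgebra are squares. -/
lemma sq_mem {a : R} {M : StarSubalgebra ℂ R} (hM : IsClosed (M : Set R)) (h0 : 0 ≤ a) (ha : a ∈ M) :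
    ∃ c ∈ M, a = star c * c ∧ ‖c‖ ^ 2 = ‖a‖ := by
  have hsa := IsSelfAdjoint.of_nonneg h0
  refine ⟨cfc Real.sqrt a, cfc_mem (𝕜 := ℝ) (𝕜' := ℂ) (s := M) _ ha, ?_⟩
  have e : a = star (cfc Real.sqrt a) * cfc Real.sqrt a := by
    rw [(cfc_predicate Real.sqrt a : IsSelfAdjoint _).star_eq, ← cfc_mul (a := a) Real.sqrt Real.sqrt]
    conv_lhs => rw [← cfc_id' ℝ a]
    apply cfc_congr
    intro x hx
    have := spec_nn h0 hx
    simp [Real.mul_self_sqrt this]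
  refine ⟨e, ?_⟩
  conv_rhs => rw [e]
  rw [CStarRing.norm_star_mul_self, pow_two]

end Resolv

section Wlim
variable {H : Type*} [NormedAddCommGroup H] [InnerProductSpace ℂ H] [CompleteSpace H]

lemma exists_wlim {ι : Type*} (ω : Ultrafilter ι) (x : ι → H →L[ℂ] H) (C : ℝ)
    (hx : ∀ i, ‖x i‖ ≤ C) :
    ∃ Y : H →L[ℂ] H, ∀ ξ η : H, Tendsto (fun i => inner ℂ (x i ξ) η) ω (𝓝 (inner ℂ (Y ξ) η)) := by
  have hb : ∀ ξ η : H, ∀ i, ‖inner ℂ (x i ξ) η‖ ≤ C * ‖ξ‖ * ‖η‖ := fun ξ η i => by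
    refine (norm_inner_le_norm _ _).trans ?_
    gcongr
    exact ((x i).le_opNorm ξ).trans (by gcongr; exact hx i)
  have hex : ∀ ξ η : H, ∃ z : ℂ, Tendsto (fun i => inner ℂ (x i ξ) η) ω (𝓝 z) := fun ξ η => by
    obtain ⟨z, -, hz⟩ := (isCompact_closedBall (0 : ℂ) (C * ‖ξ‖ * ‖η‖)).ultrafilter_le_nhds'
      (ω.map (fun i => inner ℂ (x i ξ) η)) (by
        rw [Ultrafilter.mem_map]
        refine Filter.univ_mem' fun i => ?_
        simpa using hb ξ η i)
    exact ⟨z, hz⟩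
  choose f hf using hex
  have u : ∀ {ξ η : H} {z : ℂ}, Tendsto (fun i => inner ℂ (x i ξ) η) ω (𝓝 z) → f ξ η = z :=
    fun h => tendsto_nhds_unique (hf _ _) h
  let B : H →ₗ⋆[ℂ] H →ₗ[ℂ] ℂ := LinearMap.mk₂'ₛₗ _ _ f
    (fun a b c => u (by simpa [inner_add_left] using (hf a c).add (hf b c)))
    (fun r a c => u (by simpa [inner_smul_left, mul_comm] using (hf a c).const_mul (starRingEnd ℂ r)))
    (fun a b c => u (by simpa [inner_add_right] using (hf a b).add (hf a c)))
    (fun r a c => u (by simpa [inner_smul_right] using (hf a c).const_mul r))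
  have hB : ∀ a b, ‖B a b‖ ≤ C * ‖a‖ * ‖b‖ := fun a b =>
    le_of_tendsto (hf a b).norm (Eventually.of_forall (hb a b))
  refine ⟨InnerProductSpace.continuousLinearMapOfBilin (B.mkContinuous₂ C hB), fun ξ η => ?_⟩
  rw [InnerProductSpace.continuousLinearMapOfBilin_apply, LinearMap.mkContinuous₂_apply]
  exact hf ξ η

end Wlim
end PopaQ

open scoped ComplexOrder
open Filter Topology
namespace PopaQ

section CM
variable {H : Type*} [NormedAddCommGroup H] [InnerProductSpace ℂ H] [CompleteSpace H]
variable {R : Type*} [CStarAlgebra R]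

/-- Bounded sequence in `M`. -/
def BS (M : StarSubalgebra ℂ R) (x : ℕ → R) : Prop := (∀ n, x n ∈ M) ∧ ∃ C : ℝ, ∀ n, ‖x n‖ ≤ C

/-- Context. -/
structure UC (ω : Ultrafilter ℕ) (π : R →⋆ₐ[ℂ] (H →L[ℂ] H)) (τ : R →ₗ[ℂ] ℂ)
    (M : StarSubalgebra ℂ R) (lim : (ℕ → R) → R) : Prop where
  ts : TrSt τ
  free : ∀ s : Set ℕ, s.Finite → s ∉ ω
  inj : Function.Injective π
  bic : ∀ T, (∀ S, (∀ x, S * π x = π x * S) → S * T = T * S) → ∃ x, π x = T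
  bicM : ∀ x : R, (∀ S, (∀ y ∈ M, S * π y = π y * S) → S * π x = π x * S) → x ∈ M
  closed : IsClosed (M : Set R)
  diag : ∀ m ∈ M, lim (fun _ => m) = m
  add : ∀ x y, BS M x → BS M y → lim (fun n => x n + y n) = lim x + lim y
  mul : ∀ x y, BS M x → BS M y → lim (fun n => x n * y n) = lim x * lim y
  smul : ∀ (c : ℂ) x, BS M x → lim (fun n => c • x n) = c • lim x
  lstar : ∀ x, BS M x → lim (fun n => star (x n)) = star (lim x)
  surj : ∀ z, ∃ x, BS M x ∧ lim x = z
  tr : ∀ x, BS M x → Tendsto (fun n => τ (x n)) ω (𝓝 (τ (lim x)))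
  eq_zero : ∀ x, BS M x → (lim x = 0 ↔ Tendsto (fun n => n2 τ (x n)) ω (𝓝 0))

variable {M : StarSubalgebra ℂ R}

lemma BS.add {x y : ℕ → R} (hx : BS M x) (hy : BS M y) : BS M (fun n => x n + y n) := by
  obtain ⟨C, hC⟩ := hx.2; obtain ⟨D, hD⟩ := hy.2
  exact ⟨fun n => add_mem (hx.1 n) (hy.1 n), C + D, fun n => (norm_add_le _ _).trans
    (add_le_add (hC n) (hD n))⟩

lemma BS.mul {x y : ℕ → R} (hx : BS M x) (hy : BS M y) : BS M (fun n => x n * y n) := by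
  obtain ⟨C, hC⟩ := hx.2; obtain ⟨D, hD⟩ := hy.2
  exact ⟨fun n => mul_mem (hx.1 n) (hy.1 n), C * D, fun n => (norm_mul_le _ _).trans
    (mul_le_mul (hC n) (hD n) (norm_nonneg _) ((norm_nonneg _).trans (hC n)))⟩

lemma BS.smul {x : ℕ → R} (hx : BS M x) (c : ℂ) : BS M (fun n => c • x n) := by
  obtain ⟨C, hC⟩ := hx.2
  exact ⟨fun n => M.smul_mem (hx.1 n) c, ‖c‖ * C, fun n => (norm_smul_le _ _).trans
    (mul_le_mul_of_nonneg_left (hC n) (norm_nonneg _))⟩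

lemma BS.st {x : ℕ → R} (hx : BS M x) : BS M (fun n => star (x n)) := by
  obtain ⟨C, hC⟩ := hx.2
  exact ⟨fun n => star_mem (hx.1 n), C, fun n => by rw [norm_star]; exact hC n⟩

lemma BS.const {m : R} (hm : m ∈ M) : BS M (fun _ => m) := ⟨fun _ => hm, ‖m‖, fun _ => le_rfl⟩

lemma BS.neg {x : ℕ → R} (hx : BS M x) : BS M (fun n => - x n) := by
  simpa using hx.smul (-1)

lemma BS.sub {x y : ℕ → R} (hx : BS M x) (hy : BS M y) : BS M (fun n => x n - y n) := by
  simpa [sub_eq_add_neg] using hx.add hy.neg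

variable {ω : Ultrafilter ℕ} {π : R →⋆ₐ[ℂ] (H →L[ℂ] H)} {τ : R →ₗ[ℂ] ℂ} {lim : (ℕ → R) → R}

lemma UC.sub (h : UC ω π τ M lim) {x y : ℕ → R} (hx : BS M x) (hy : BS M y) :
    lim (fun n => x n - y n) = lim x - lim y := by
  have h1 := h.add x (fun n => (-1 : ℂ) • y n) hx (hy.smul _)
  have h2 := h.smul (-1) y hy
  rw [h2] at h1
  simpa [sub_eq_add_neg] using h1

lemma UC.congr (h : UC ω π τ M lim) {x y : ℕ → R} (hx : BS M x) (hy : BS M y)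
    (hxy : ∀ᶠ n in (ω : Filter ℕ), x n = y n) : lim x = lim y := by
  rw [← sub_eq_zero, ← h.sub hx hy, h.eq_zero _ (hx.sub hy)]
  refine tendsto_const_nhds.congr' ?_
  filter_upwards [hxy] with n hn
  rw [hn, sub_self, h.ts.n2_zero]

lemma UC.le_cofinite (h : UC ω π τ M lim) : (ω : Filter ℕ) ≤ atTop := by
  rw [← Nat.cofinite_eq_atTop]
  intro s hs
  rw [mem_cofinite] at hs
  by_contra hc
  exact h.free _ hs (Ultrafilter.compl_mem_iff_notMem.2 hc)

lemma UC.ge (h : UC ω π τ M lim) (n : ℕ) : ∀ᶠ j in (ω : Filter ℕ), n ≤ j :=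
  h.le_cofinite (eventually_ge_atTop n)

lemma UC.n2_lim (h : UC ω π τ M lim) {x : ℕ → R} (hx : BS M x) :
    Tendsto (fun n => n2 τ (x n)) ω (𝓝 (n2 τ (lim x))) := by
  have h1 := h.tr _ (hx.st.mul hx)
  rw [h.mul _ _ hx.st hx, h.lstar _ hx] at h1
  exact (Real.continuous_sqrt.tendsto _).comp ((Complex.continuous_re.tendsto _).comp h1)

section ord
variable [PartialOrder R] [StarOrderedRing R]

lemma UC.lim_nonneg (h : UC ω π τ M lim) {x : ℕ → R} (hx : BS M x) (h0 : ∀ n, 0 ≤ x n) :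
    0 ≤ lim x := by
  choose c hc e hn using fun n => sq_mem h.closed (h0 n) (hx.1 n)
  obtain ⟨C, hC⟩ := hx.2
  have hb : BS M c := ⟨hc, √C, fun n => Real.le_sqrt_of_sq_le (by rw [hn]; exact hC n)⟩
  have : lim x = star (lim c) * lim c := by
    rw [← h.lstar _ hb, ← h.mul _ _ hb.st hb]
    congr 1; funext n; exact e n
  rw [this]; exact star_mul_self_nonneg _

lemma UC.lim_mono (h : UC ω π τ M lim) {x y : ℕ → R} (hx : BS M x) (hy : BS M y)
    (h0 : ∀ᶠ n in (ω : Filter ℕ), x n ≤ y n) : lim x ≤ lim y := by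
  classical
  let z : ℕ → R := fun n => if x n ≤ y n then x n else y n
  obtain ⟨C, hC⟩ := hx.2; obtain ⟨D, hD⟩ := hy.2
  have hz : BS M z := by
    refine ⟨fun n => ?_, max C D, fun n => ?_⟩
    · simp only [z]; split_ifs; exacts [hx.1 n, hy.1 n]
    · simp only [z]; split_ifs; exacts [(hC n).trans (le_max_left _ _), (hD n).trans (le_max_right _ _)]
  have h1 : lim z = lim x := h.congr hz hx (by
    filter_upwards [h0] with n hn
    simp [z, hn])
  rw [← h1, ← sub_nonneg, ← h.sub hy hz]
  refine h.lim_nonneg (hy.sub hz) fun n => ?_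
  rw [sub_nonneg]; simp only [z]; split_ifs with hh
  exacts [hh, le_rfl]

lemma UC.lim_tt (h : UC ω π τ M lim) {x : ℕ → R} (hx : BS M x) (h0 : ∀ n, 0 ≤ x n) :
    lim (fun n => tt (x n)) = tt (lim x) ∧ BS M (fun n => tt (x n)) := by
  have hb : BS M (fun n => tt (x n)) :=
    ⟨fun n => tt_mem h.closed (hx.1 n), 1, fun n => norm_tt_le (h0 n)⟩
  refine ⟨?_, hb⟩
  have o : BS M (fun _ => (1 : R)) := BS.const (one_mem M)
  have h1 := h.mul _ _ (o.sub hb) (o.add hx)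
  simp only [tt_mul (h0 _)] at h1
  rw [h.sub o hb, h.add _ _ o hx, h.diag 1 (one_mem M)] at h1
  rw [tt_eq (h.lim_nonneg hx h0) h1.symm]; simp

lemma UC.pi_nonneg (π : R →⋆ₐ[ℂ] (H →L[ℂ] H)) {x : R} (hx : 0 ≤ x) (ξ : H) :
    0 ≤ (inner ℂ (π x ξ) ξ).re := by
  obtain ⟨b, rfl⟩ := CStarAlgebra.nonneg_iff_eq_star_mul_self.1 hx
  rw [map_mul, map_star, ContinuousLinearMap.star_eq_adjoint, mul_apply_eq_comp,
    ContinuousLinearMap.adjoint_inner_left]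
  exact inner_self_nonneg (𝕜 := ℂ)

lemma UC.pi_mono (π : R →⋆ₐ[ℂ] (H →L[ℂ] H)) {x y : R} (hx : x ≤ y) (ξ : H) :
    (inner ℂ (π x ξ) ξ).re ≤ (inner ℂ (π y ξ) ξ).re := by
  have := UC.pi_nonneg π (sub_nonneg.2 hx) ξ
  rw [map_sub, sub_apply, inner_sub_left, Complex.sub_re] at this
  linarith

lemma UC.pi_reflect (h : UC ω π τ M lim) {x : R} (hx : 0 ≤ π x) : 0 ≤ x := by
  have hsa : IsSelfAdjoint x := by
    apply h.inj
    rw [map_star]; exact (IsSelfAdjoint.of_nonneg hx).star_eq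
  have h1 : x = x⁺ - x⁻ := (CFC.posPart_sub_negPart x hsa).symm
  have h2 : x⁻ * x * x⁻ = - (x⁻ * x⁻ * x⁻) := by
    have e : x⁻ * x = - (x⁻ * x⁻) := by
      have e2 : x⁻ * x = x⁻ * (x⁺ - x⁻) := by rw [← h1]
      rw [e2, mul_sub, CFC.negPart_mul_posPart, zero_sub]
    rw [e, neg_mul]
  have hn : 0 ≤ x⁻ := CFC.negPart_nonneg x
  have hns : star (x⁻) = x⁻ := (IsSelfAdjoint.of_nonneg hn).star_eq
  have h3 : 0 ≤ π (x⁻ * x * x⁻) := by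
    have := star_left_conjugate_nonneg hx (π x⁻)
    rwa [← map_star, hns, ← map_mul, ← map_mul] at this
  have h4 : 0 ≤ x⁻ * x⁻ * x⁻ := by
    have := star_left_conjugate_nonneg hn x⁻
    rwa [hns] at this
  have h5 : 0 ≤ π (x⁻ * x⁻ * x⁻) := by
    obtain ⟨b, hb⟩ := CStarAlgebra.nonneg_iff_eq_star_mul_self.1 h4
    rw [hb, map_mul, map_star]; exact star_mul_self_nonneg _
  rw [h2, map_neg] at h3
  have h6 : π (x⁻ * x⁻ * x⁻) = 0 := le_antisymm (neg_nonneg.1 h3) h5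
  have h7 : x⁻ * x⁻ * x⁻ = 0 := h.inj (by rw [h6, map_zero])
  have h8 : star (x⁻ * x⁻) * (x⁻ * x⁻) = 0 := by
    rw [star_mul, hns, ← mul_assoc, h7, zero_mul]
  have h9 : star x⁻ * x⁻ = 0 := by rw [hns]; exact CStarRing.star_mul_self_eq_zero_iff _ |>.1 h8
  have h10 : x⁻ = 0 := CStarRing.star_mul_self_eq_zero_iff _ |>.1 h9
  rw [h1, h10, sub_zero]; exact CFC.posPart_nonneg x

end ord
end CM
end PopaQ

open scoped ComplexOrder
open Filter Topology
namespace PopaQ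

section CM2
variable {H : Type*} [NormedAddCommGroup H] [InnerProductSpace ℂ H] [CompleteSpace H]
variable {R : Type*} [CStarAlgebra R]
variable {M : StarSubalgebra ℂ R}
variable {ω : Ultrafilter ℕ} {π : R →⋆ₐ[ℂ] (H →L[ℂ] H)} {τ : R →ₗ[ℂ] ℂ} {lim : (ℕ → R) → R}

lemma norm_pi_sq (π : R →⋆ₐ[ℂ] (H →L[ℂ] H)) (d : R) (ξ : H) :
    ‖π d ξ‖ ^ 2 = (inner ℂ (π (star d * d) ξ) ξ).re := by
  rw [map_mul, map_star, ContinuousLinearMap.star_eq_adjoint, mul_apply_eq_comp,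
    ContinuousLinearMap.adjoint_inner_left, inner_self_eq_norm_sq_to_K (𝕜 := ℂ)]
  norm_cast

lemma sum_quarter (n j : ℕ) : ∑ k ∈ Finset.Icc n j, (1 / 4 : ℝ) ^ k ≤ 2 * (1 / 4 : ℝ) ^ n := by
  have key : ∀ m, ∑ k ∈ Finset.Ico n (n + m), (1 / 4 : ℝ) ^ k ≤
      2 * (1 / 4 : ℝ) ^ n - 2 * (1 / 4 : ℝ) ^ (n + m) := by
    intro m
    induction m with
    | zero => simp
    | succ m ih =>
      rw [← add_assoc, Finset.sum_Ico_succ_top (by omega), pow_succ (1 / 4 : ℝ) (n + m)]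
      have : (0 : ℝ) < (1 / 4) ^ (n + m) := by positivity
      linarith
  rcases le_or_gt n j with hnj | hnj
  · obtain ⟨m, rfl⟩ := Nat.exists_eq_add_of_le hnj
    have := key (m + 1)
    have e : Finset.Icc n (n + m) = Finset.Ico n (n + (m + 1)) := by
      ext; simp; omega
    rw [e]
    have : (0 : ℝ) < (1 / 4) ^ (n + (m + 1)) := by positivity
    linarith
  · rw [Finset.Icc_eq_empty (by omega)]; simp

/-- weak limits of sequences in `R` lie in `R`. -/
lemma UC.wlim (h : UC ω π τ M lim) (y : ℕ → R) (C : ℝ) (hy : ∀ i, ‖y i‖ ≤ C) :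
    ∃ Z : R, ∀ ξ η : H, Tendsto (fun i => inner ℂ (π (y i) ξ) η) ω (𝓝 (inner ℂ (π Z ξ) η)) := by
  obtain ⟨Y, hY⟩ := exists_wlim ω (fun i => π (y i)) C
    (fun i => by rw [NonUnitalStarAlgHom.norm_map π h.inj]; exact hy i)
  obtain ⟨Z, hZ⟩ := h.bic Y (fun S hS => by
    refine ContinuousLinearMap.ext fun ξ => ext_inner_right ℂ fun η => ?_
    have h1 := hY ξ (ContinuousLinearMap.adjoint S η)
    have h2 := hY (S ξ) η
    refine tendsto_nhds_unique ?_ h2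
    rw [mul_apply_eq_comp, ← ContinuousLinearMap.adjoint_inner_right]
    refine h1.congr fun i => ?_
    rw [ContinuousLinearMap.adjoint_inner_right]
    congr 1
    exact DFunLike.congr_fun (hS (y i)) ξ)
  exact ⟨Z, fun ξ η => by rw [hZ]; exact hY ξ η⟩

lemma nonneg_of_re_inner {T : H →L[ℂ] H} (hT : ∀ ξ, ∃ r : ℝ, 0 ≤ r ∧ inner ℂ (T ξ) ξ = (r : ℂ)) : 0 ≤ T := by
  rw [ContinuousLinearMap.nonneg_iff_isPositive, ContinuousLinearMap.isPositive_iff_complex]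
  intro ξ
  obtain ⟨r, h0, hr⟩ := hT ξ
  rw [hr]; simp [h0]

/-- 2-Cauchy sequences. -/
def C2 (τ : R →ₗ[ℂ] ℂ) (x : ℕ → R) : Prop :=
  ∀ ε > 0, ∃ N, ∀ m ≥ N, ∀ n ≥ N, n2 τ (x m - x n) ≤ ε

lemma C2.rapid {x : ℕ → R} (hx : C2 τ x) : ∃ φ : ℕ → ℕ, StrictMono φ ∧
    ∀ k j, k ≤ j → n2 τ (x (φ k) - x (φ j)) ^ 2 ≤ (1 / 4 : ℝ) ^ k := by
  choose N hN using fun k : ℕ => hx ((1 / 2 : ℝ) ^ k) (by positivity)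
  let φ : ℕ → ℕ := fun k => Nat.rec (N 0) (fun k p => max (p + 1) (N (k + 1))) k
  have hφ : StrictMono φ := strictMono_nat_of_lt_succ fun k =>
    lt_of_lt_of_le (Nat.lt_succ_self _) (le_max_left _ _)
  have hφN : ∀ k, N k ≤ φ k := fun k => by
    cases k with
    | zero => exact le_rfl
    | succ k => exact le_max_right _ _
  refine ⟨φ, hφ, fun k j hkj => ?_⟩
  have := hN k (φ k) (hφN k) (φ j) ((hφN k).trans (hφ.monotone hkj))
  calc n2 τ (x (φ k) - x (φ j)) ^ 2 ≤ ((1 / 2 : ℝ) ^ k) ^ 2 := by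
        gcongr; exact n2_nonneg _
    _ = (1 / 4 : ℝ) ^ k := by rw [← pow_mul, mul_comm, pow_mul]; norm_num

section ord
variable [PartialOrder R] [StarOrderedRing R]

lemma pi_inner_real (π : R →⋆ₐ[ℂ] (H →L[ℂ] H)) {x : R} (hx : 0 ≤ x) (ξ : H) :
    inner ℂ (π x ξ) ξ = (((inner ℂ (π x ξ) ξ).re : ℝ) : ℂ) := by
  obtain ⟨b, rfl⟩ := CStarAlgebra.nonneg_iff_eq_star_mul_self.1 hx
  rw [← norm_pi_sq, map_mul, map_star, ContinuousLinearMap.star_eq_adjoint, mul_apply_eq_comp,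
    ContinuousLinearMap.adjoint_inner_left, inner_self_eq_norm_sq_to_K (𝕜 := ℂ)]
  norm_cast

/-- weak limit of nonnegative is nonnegative -/
lemma UC.nonneg_of_wlim (h : UC ω π τ M lim) {y : ℕ → R} {Z : R}
    (hy : ∀ᶠ i in (ω : Filter ℕ), 0 ≤ y i)
    (hZ : ∀ ξ η : H, Tendsto (fun i => inner ℂ (π (y i) ξ) η) ω (𝓝 (inner ℂ (π Z ξ) η))) : 0 ≤ Z := by
  refine h.pi_reflect (nonneg_of_re_inner fun ξ => ?_)
  have h1 := hZ ξ ξ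
  have h2 := (Complex.continuous_re.tendsto _).comp h1
  refine ⟨(inner ℂ (π Z ξ) ξ).re, ge_of_tendsto h2 ?_, ?_⟩
  · filter_upwards [hy] with i hi
    exact UC.pi_nonneg π hi ξ
  · refine tendsto_nhds_unique h1 ?_
    refine ((Complex.continuous_ofReal.tendsto _).comp h2).congr' ?_
    filter_upwards [hy] with i hi
    exact (pi_inner_real π hi ξ).symm

/-- decreasing sequence with trace to zero tends to zero weakly. -/
lemma UC.antitone_zero (h : UC ω π τ M lim) {y : ℕ → R} (h0 : ∀ n, 0 ≤ y n) (hanti : Antitone y)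
    (ht : Tendsto (fun n => (τ (y n)).re) atTop (𝓝 0)) (ξ : H) :
    Tendsto (fun n => (inner ℂ (π (y n) ξ) ξ).re) atTop (𝓝 0) := by
  have hb : ∀ n, ‖y n‖ ≤ ‖y 0‖ := fun n =>
    CStarAlgebra.norm_le_norm_of_nonneg_of_le (h0 n) (hanti (Nat.zero_le n))
  obtain ⟨Z, hZ⟩ := h.wlim y _ hb
  have hZ0 : 0 ≤ Z := h.nonneg_of_wlim (Eventually.of_forall h0) hZ
  have hZle : ∀ n, Z ≤ y n := fun n => by
    rw [← sub_nonneg]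
    refine h.nonneg_of_wlim (y := fun i => y n - y i) ?_ (fun ξ η => ?_)
    · filter_upwards [h.ge n] with i hi
      exact sub_nonneg.2 (hanti hi)
    · simp only [map_sub, sub_apply, inner_sub_left]
      exact tendsto_const_nhds.sub (hZ ξ η)
  have hZz : Z = 0 := by
    refine h.ts.eq_zero_of_nonneg hZ0 ?_
    exact ge_of_tendsto' ht fun n => h.ts.re_mono (hZle n)
  subst hZz
  have h1 := (Complex.continuous_re.tendsto _).comp (hZ ξ ξ)
  simp only [map_zero, zero_apply, inner_zero_left, Complex.zero_re] at h1
  have hanti' : Antitone (fun n => (inner ℂ (π (y n) ξ) ξ).re) := fun a b hab =>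
    UC.pi_mono π (hanti hab) ξ
  have h2 := tendsto_atTop_ciInf hanti' ⟨0, by
    rintro _ ⟨n, rfl⟩; exact UC.pi_nonneg π (h0 n) ξ⟩
  have h3 := tendsto_nhds_unique (h2.mono_left h.le_cofinite) h1
  rwa [h3] at h2

lemma UC.rapid (h : UC ω π τ M lim) {x : ℕ → R} (hx : BS M x)
    (hc : ∀ k j, k ≤ j → n2 τ (x k - x j) ^ 2 ≤ (1 / 4 : ℝ) ^ k) :
    lim x ∈ M ∧ (∀ k, n2 τ (x k - lim x) ^ 2 ≤ (1 / 4 : ℝ) ^ k) ∧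
      ∀ ξ, Tendsto (fun k => π (x k) ξ) atTop (𝓝 (π (lim x) ξ)) := by
  set y := lim x with hy
  obtain ⟨C, hC⟩ := hx.2
  let s : ℕ → ℕ → R := fun k j => star (x k - x j) * (x k - x j)
  have hs0 : ∀ k j, 0 ≤ s k j := fun k j => star_mul_self_nonneg _
  have hd : ∀ k, BS M (fun j => x k - x j) := fun k => (BS.const (hx.1 k)).sub hx
  have hsB : ∀ k, BS M (s k) := fun k => (hd k).st.mul (hd k)
  have hdl : ∀ k, lim (fun j => x k - x j) = x k - y := fun k => by
    rw [h.sub (BS.const (hx.1 k)) hx, h.diag _ (hx.1 k)]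
  have hsl : ∀ k, lim (s k) = star (x k - y) * (x k - y) := fun k => by
    rw [h.mul _ _ (hd k).st (hd k), h.lstar _ (hd k), hdl]
  have hn : ∀ k, n2 τ (x k - y) ^ 2 ≤ (1 / 4 : ℝ) ^ k := fun k => by
    have := (h.n2_lim (hd k)).pow 2
    rw [hdl] at this
    refine le_of_tendsto this ?_
    filter_upwards [h.ge k] with j hj
    exact hc k j hj
  let a : ℕ → ℕ → R := fun n j => ∑ k ∈ Finset.Icc n j, s k j
  have ha0 : ∀ n j, 0 ≤ a n j := fun n j => Finset.sum_nonneg fun k _ => hs0 k j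
  have haM : ∀ n j, a n j ∈ M := fun n j => sum_mem fun k _ => (hsB k).1 j
  have htB : ∀ n, BS M (fun j => tt (a n j)) := fun n =>
    ⟨fun j => tt_mem h.closed (haM n j), 1, fun j => norm_tt_le (ha0 n j)⟩
  let Y : ℕ → R := fun n => lim (fun j => tt (a n j))
  have hY0 : ∀ n, 0 ≤ Y n := fun n => h.lim_nonneg (htB n) fun j => tt_nonneg (ha0 n j)
  have hYanti : Antitone Y := fun n n' hnn => by
    refine h.lim_mono (htB n') (htB n) (Eventually.of_forall fun j => ?_)
    refine tt_mono (ha0 _ _) ?_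
    exact Finset.sum_le_sum_of_subset_of_nonneg (Finset.Icc_subset_Icc_left hnn)
      fun k _ _ => hs0 k j
  have hYt : ∀ n, (τ (Y n)).re ≤ 2 * (1 / 4 : ℝ) ^ n := fun n => by
    have h1 := (Complex.continuous_re.tendsto _).comp (h.tr _ (htB n))
    refine le_of_tendsto h1 (Eventually.of_forall fun j => ?_)
    refine (h.ts.re_mono (tt_le_self (ha0 n j))).trans (le_trans ?_ (sum_quarter n j))
    simp only [a, map_sum, Complex.re_sum]
    refine Finset.sum_le_sum fun k hk => ?_
    rw [← h.ts.n2_sq]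
    exact hc k j (Finset.mem_Icc.1 hk).2
  have hYlim : Tendsto (fun n => (τ (Y n)).re) atTop (𝓝 0) := by
    refine squeeze_zero (fun n => h.ts.re_nonneg' (hY0 n)) hYt ?_
    have := (tendsto_pow_atTop_nhds_zero_of_lt_one (r := (1 / 4 : ℝ)) (by norm_num)
      (by norm_num)).const_mul 2
    simpa using this
  have hYge : ∀ n, tt (star (x n - y) * (x n - y)) ≤ Y n := fun n => by
    have := h.lim_tt (hsB n) (hs0 n)
    rw [← hsl, ← this.1]
    refine h.lim_mono this.2 (htB n) ?_
    filter_upwards [h.ge n] with j hj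
    refine tt_mono (hs0 n j) ?_
    exact Finset.single_le_sum (f := fun k => s k j) (fun k _ => hs0 k j) (Finset.mem_Icc.2 ⟨le_rfl, hj⟩)
  have hstrong : ∀ ξ, Tendsto (fun k => π (x k) ξ) atTop (𝓝 (π y ξ)) := fun ξ => by
    rw [tendsto_iff_norm_sub_tendsto_zero]
    have h1 := h.antitone_zero hY0 hYanti hYlim ξ
    have h2 := (h1.const_mul (1 + (C + ‖y‖) ^ 2))
    rw [mul_zero] at h2
    have h3 : Tendsto (fun k => ‖π (x k) ξ - π y ξ‖ ^ 2) atTop (𝓝 0) := by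
      refine squeeze_zero (fun k => by positivity) (fun k => ?_) h2
      rw [← sub_apply, ← map_sub, norm_pi_sq]
      have hle : ‖star (x k - y) * (x k - y)‖ ≤ (C + ‖y‖) ^ 2 := by
        rw [CStarRing.norm_star_mul_self, ← pow_two]
        gcongr
        exact (norm_sub_le _ _).trans (by gcongr; exact hC k)
      have h4 := UC.pi_mono π (le_tt (star_mul_self_nonneg (x k - y)) hle) ξ
      rw [← Complex.coe_smul, map_smul, smul_apply, inner_smul_left, Complex.conj_ofReal,
        Complex.re_ofReal_mul] at h4
      refine h4.trans ?_
      exact mul_le_mul_of_nonneg_left (UC.pi_mono π (hYge k) ξ) (by positivity)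
    have h5 := (Real.continuous_sqrt.tendsto _).comp h3
    simpa [Function.comp_def, Real.sqrt_sq] using h5
  refine ⟨h.bicM y fun S hS => ContinuousLinearMap.ext fun ξ => ?_, hn, hstrong⟩
  refine tendsto_nhds_unique ((S.continuous.tendsto _).comp (hstrong ξ)) ?_
  refine (hstrong (S ξ)).congr fun k => ?_
  exact (DFunLike.congr_fun (hS (x k) (hx.1 k)) ξ).symm

theorem UC.complete (h : UC ω π τ M lim) {x : ℕ → R} (hx : BS M x) (hc : C2 τ x) :
    ∃ y ∈ M, Tendsto (fun k => n2 τ (x k - y)) atTop (𝓝 0) ∧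
      ∀ ξ, Tendsto (fun k => π (x k) ξ) atTop (𝓝 (π y ξ)) := by
  have core : ∀ z : ℕ → R, BS M z → C2 τ z → ∃ φ : ℕ → ℕ, StrictMono φ ∧ ∃ y ∈ M,
      Tendsto (fun k => n2 τ (z k - y)) atTop (𝓝 0) ∧
      ∀ ξ, Tendsto (fun k => π (z (φ k)) ξ) atTop (𝓝 (π y ξ)) := by
    intro z hz hcz
    obtain ⟨φ, hφ, hr⟩ := hcz.rapid
    have hzφ : BS M (fun k => z (φ k)) := ⟨fun n => hz.1 _, hz.2.imp fun C hC n => hC _⟩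
    obtain ⟨h1, h2, h3⟩ := h.rapid hzφ hr
    refine ⟨φ, hφ, _, h1, ?_, h3⟩
    rw [Metric.tendsto_atTop]
    intro ε hε
    obtain ⟨N, hN⟩ := hcz (ε / 3) (by positivity)
    refine ⟨N, fun n hn => ?_⟩
    rw [Real.dist_eq, sub_zero, abs_of_nonneg (n2_nonneg _)]
    obtain ⟨k, hk⟩ := exists_pow_lt_of_lt_one (show 0 < (ε / 3) ^ 2 by positivity)
      (show (1 / 4 : ℝ) < 1 by norm_num)
    have hk' : n2 τ (z (φ (max k N)) - lim (fun k => z (φ k))) ≤ ε / 3 := by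
      refine abs_le_of_sq_le_sq' ?_ (by positivity) |>.2
      refine (h2 _).trans (le_trans ?_ hk.le)
      exact pow_le_pow_of_le_one (by norm_num) (by norm_num) (le_max_left _ _)
    have h4 := h.ts.n2_tri (z n) (z (φ (max k N))) (lim (fun k => z (φ k)))
    have h5 := hN n hn (φ (max k N)) ((le_max_right k N).trans (hφ.id_le _))
    linarith
  obtain ⟨-, -, y, hyM, hy, -⟩ := core x hx hc
  refine ⟨y, hyM, hy, fun ξ => tendsto_of_subseq_tendsto fun ns hns => ?_⟩
  have hxn : BS M (fun k => x (ns k)) := ⟨fun n => hx.1 _, hx.2.imp fun C hC n => hC _⟩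
  have hcn : C2 τ (fun k => x (ns k)) := by
    intro ε hε
    obtain ⟨N, hN⟩ := hc ε hε
    obtain ⟨K, hK⟩ := (hns.eventually_ge_atTop N).exists_forall_of_atTop
    exact ⟨K, fun m hm n hn => hN _ (hK m hm) _ (hK n hn)⟩
  obtain ⟨φ, hφ, y', -, hy', hs⟩ := core _ hxn hcn
  have : y = y' := by
    rw [← sub_eq_zero]
    apply h.ts.n2_eq_zero
    refine le_antisymm ?_ (n2_nonneg _)
    have h6 := (hy.comp hns).add hy'
    rw [add_zero] at h6
    refine ge_of_tendsto' h6 fun k => ?_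
    have := h.ts.n2_tri y (x (ns k)) y'
    rw [h.ts.n2_sub_comm y (x (ns k))] at this
    exact this
  subst this
  exact ⟨φ, hs ξ⟩

end ord
end CM2
end PopaQ

open scoped ComplexOrder
open Filter Topology
namespace PopaQ

section F1a
variable {H : Type*} [NormedAddCommGroup H] [InnerProductSpace ℂ H] [CompleteSpace H]
variable {R : Type*} [CStarAlgebra R]
variable {M : StarSubalgebra ℂ R}
variable {ω : Ultrafilter ℕ} {π : R →⋆ₐ[ℂ] (H →L[ℂ] H)} {τ : R →ₗ[ℂ] ℂ} {lim : (ℕ → R) → R}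

lemma commute_proj {V : Submodule ℂ H} [V.HasOrthogonalProjection] {S : H →L[ℂ] H}
    (h1 : ∀ v ∈ V, S v ∈ V) (h2 : ∀ v ∈ V, ContinuousLinearMap.adjoint S v ∈ V) :
    S * V.starProjection = V.starProjection * S := by
  ext v
  rw [mul_apply_eq_comp, mul_apply_eq_comp]
  refine (Submodule.eq_starProjection_of_mem_orthogonal (h1 _ (V.starProjection_apply_mem v)) ?_).symm
  rw [Submodule.mem_orthogonal]
  intro w hw
  rw [← map_sub, ← ContinuousLinearMap.adjoint_inner_left]
  exact (Submodule.mem_orthogonal _ _).1 (V.sub_starProjection_mem_orthogonal v) _ (h2 w hw)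

/-- commutant of `π M` -/
def CommM (π : R →⋆ₐ[ℂ] (H →L[ℂ] H)) (M : StarSubalgebra ℂ R) (S : H →L[ℂ] H) : Prop :=
  ∀ y ∈ M, S * π y = π y * S

lemma CommM.st {S : H →L[ℂ] H} (hS : CommM π M S) : CommM π M (star S) := fun y hy => by
  have := congrArg star (hS (star y) (star_mem hy))
  rw [star_mul, star_mul, map_star, star_star] at this
  exact this.symm

/-- closed span of `M' ξ_i`. -/
def VV (π : R →⋆ₐ[ℂ] (H →L[ℂ] H)) (M : StarSubalgebra ℂ R) (ξ : ℕ → H) : Submodule ℂ H :=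
  (Submodule.span ℂ {v | ∃ S, CommM π M S ∧ ∃ i, v = S (ξ i)}).topologicalClosure

lemma VV_inv {ξ : ℕ → H} {S : H →L[ℂ] H} (hS : CommM π M S) :
    ∀ v ∈ VV π M ξ, S v ∈ VV π M ξ := by
  have h1 : ∀ v ∈ Submodule.span ℂ {v | ∃ S, CommM π M S ∧ ∃ i, v = S (ξ i)},
      S v ∈ Submodule.span ℂ {v | ∃ S, CommM π M S ∧ ∃ i, v = S (ξ i)} := by
    intro v hv
    induction hv using Submodule.span_induction with
    | mem x hx =>
      obtain ⟨S', hS', i, rfl⟩ := hx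
      refine Submodule.subset_span ⟨S * S', fun y hy => ?_, i, rfl⟩
      rw [mul_assoc, hS' y hy, ← mul_assoc, hS y hy, mul_assoc]
    | zero => simp
    | add x y _ _ hx hy => rw [map_add]; exact add_mem hx hy
    | smul a x _ hx => rw [map_smul]; exact Submodule.smul_mem _ _ hx
  intro v hv
  exact map_mem_closure S.continuous hv h1

lemma VV_self (ξ : ℕ → H) (i : ℕ) : ξ i ∈ VV π M ξ :=
  Submodule.le_topologicalClosure _ (Submodule.subset_span ⟨1, fun y _ => by simp, i, by simp⟩)

lemma VV_le {ξ η : ℕ → H} (h : ∀ i, ξ i ∈ VV π M η) : VV π M ξ ≤ VV π M η := by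
  refine Submodule.topologicalClosure_minimal _ ?_ (Submodule.isClosed_topologicalClosure _)
  rw [Submodule.span_le]
  rintro _ ⟨S, hS, i, rfl⟩
  exact VV_inv hS _ (h i)

noncomputable instance (ξ : ℕ → H) : (VV π M ξ).HasOrthogonalProjection := by
  unfold VV; infer_instance

lemma UC.proj_mem (h : UC ω π τ M lim) (ξ : ℕ → H) : ∃ p ∈ M, π p = (VV π M ξ).starProjection := by
  have key : ∀ S, CommM π M S → S * (VV π M ξ).starProjection = (VV π M ξ).starProjection * S :=
    fun S hS => commute_proj (VV_inv hS) (VV_inv hS.st)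
  obtain ⟨p, hp⟩ := h.bic (VV π M ξ).starProjection fun S hS => key S fun y _ => hS y
  refine ⟨p, h.bicM p fun S hS => ?_, hp⟩
  rw [hp]; exact key S hS

lemma UC.separating (h : UC ω π τ M lim) :
    ∃ ξ : ℕ → H, ∀ c ∈ M, (∀ i, π c (ξ i) = 0) → c = 0 := by
  choose p hpM hp using h.proj_mem
  have hpsa : ∀ ξ, star (p ξ) = p ξ := fun ξ => h.inj (by
    rw [map_star, hp]; exact (isSelfAdjoint_starProjection _).star_eq)
  have hpid : ∀ ξ, p ξ * p ξ = p ξ := fun ξ => h.inj (by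
    rw [map_mul, hp]; exact Submodule.isIdempotentElem_starProjection _)
  have hle : ∀ ξ η, VV π M ξ ≤ VV π M η → p η * p ξ = p ξ ∧ p ξ * p η = p ξ := by
    intro ξ η hh
    have h1 : p η * p ξ = p ξ := h.inj (by
      rw [map_mul, hp, hp]
      ext v
      rw [mul_apply_eq_comp]
      exact Submodule.starProjection_eq_self_iff.2 (hh (Submodule.starProjection_apply_mem _ _)))
    refine ⟨h1, ?_⟩
    have := congrArg star h1
    rwa [star_mul, hpsa, hpsa] at this
  have hd : ∀ ξ η, VV π M ξ ≤ VV π M η → star (p η - p ξ) * (p η - p ξ) = p η - p ξ := by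
    intro ξ η hh
    rw [star_sub, hpsa, hpsa, mul_sub, sub_mul, sub_mul, (hle _ _ hh).1, (hle _ _ hh).2, hpid, hpid]
    simp
  have hmono : ∀ ξ η, VV π M ξ ≤ VV π M η → (τ (p ξ)).re ≤ (τ (p η)).re := fun ξ η hh => by
    have := h.ts.re_nonneg (p η - p ξ)
    rw [hd _ _ hh, map_sub, Complex.sub_re] at this
    linarith
  have hbd : BddAbove (Set.range fun ξ => (τ (p ξ)).re) := by
    refine ⟨1, ?_⟩
    rintro _ ⟨ξ, rfl⟩
    have := h.ts.re_nonneg (1 - p ξ)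
    have e : star (1 - p ξ) * (1 - p ξ) = 1 - p ξ := by
      rw [star_sub, hpsa, star_one, mul_sub, sub_mul, sub_mul, hpid]; simp
    rw [e, map_sub, Complex.sub_re, h.ts.one, Complex.one_re] at this
    simpa using this
  set s := ⨆ ξ, (τ (p ξ)).re with hs
  have hex : ∀ k : ℕ, ∃ ξ, s - 1 / ((k : ℝ) + 1) < (τ (p ξ)).re := fun k =>
    exists_lt_of_lt_ciSup (sub_lt_self _ (by positivity))
  choose Ξ hΞ using hex
  let ξ : ℕ → H := fun n => Ξ n.unpair.1 n.unpair.2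
  have hξ : s ≤ (τ (p ξ)).re := by
    have h1 : ∀ k : ℕ, s - 1 / ((k : ℝ) + 1) ≤ (τ (p ξ)).re := fun k => by
      refine (hΞ k).le.trans (hmono _ _ (VV_le fun i => ?_))
      have := VV_self (π := π) (M := M) ξ (Nat.pair k i)
      simpa [ξ] using this
    have h2 : Tendsto (fun k : ℕ => s - 1 / ((k : ℝ) + 1)) atTop (𝓝 (s - 0)) :=
      tendsto_const_nhds.sub tendsto_one_div_add_atTop_nhds_zero_nat
    rw [sub_zero] at h2
    exact le_of_tendsto' h2 h1
  have htop : ∀ η : H, η ∈ VV π M ξ := by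
    intro η
    let ζ : ℕ → H := fun n => Nat.casesOn n η ξ
    have hζ : VV π M ξ ≤ VV π M ζ := VV_le fun i => VV_self (π := π) (M := M) ζ (i + 1)
    have h1 : (τ (p ζ)).re ≤ s := le_ciSup hbd ζ
    have h2 : p ζ - p ξ = 0 := by
      apply h.ts.n2_eq_zero
      have := h.ts.n2_sq (p ζ - p ξ)
      rw [hd _ _ hζ, map_sub, Complex.sub_re] at this
      have h0 := n2_nonneg (τ := τ) (p ζ - p ξ)
      nlinarith
    have h3 : p ζ = p ξ := sub_eq_zero.1 h2
    have h4 : (VV π M ξ).starProjection η = η := by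
      rw [← hp, ← h3, hp]
      exact Submodule.starProjection_eq_self_iff.2 (VV_self (π := π) (M := M) ζ 0)
    rw [← h4]; exact Submodule.starProjection_apply_mem _ _
  refine ⟨ξ, fun c hc h0 => h.inj ?_⟩
  rw [map_zero]
  ext η
  have hsub : (VV π M ξ : Submodule ℂ H) ≤ (LinearMap.ker (π c).toLinearMap) := by
    refine Submodule.topologicalClosure_minimal _ ?_ (π c).isClosed_ker
    rw [Submodule.span_le]
    rintro _ ⟨S, hS, i, rfl⟩
    have := DFunLike.congr_fun (hS c hc) (ξ i)
    rw [mul_apply_eq_comp, mul_apply_eq_comp, h0, map_zero] at this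
    exact this.symm
  exact hsub (htop η)

section ord
variable [PartialOrder R] [StarOrderedRing R]

lemma TrSt.n2_sq_le_tau (h : TrSt τ) {d : R} (h0 : 0 ≤ d) (h1 : ‖d‖ ≤ 1) : n2 τ d ^ 2 ≤ (τ d).re := by
  obtain ⟨c, -, e, hn⟩ := sq_mem (M := (⊤ : StarSubalgebra ℂ R)) isClosed_univ h0 trivial
  have h2 : n2 τ d ≤ ‖c‖ * n2 τ c := by
    conv_lhs => rw [e]
    have := h.n2_mul_le (star c) c
    rwa [norm_star] at this
  have h3 : ‖c‖ ^ 2 ≤ 1 := hn.trans_le h1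
  have h4 := h.n2_sq c
  rw [← e] at h4
  rw [← h4]
  have h5 := n2_nonneg (τ := τ) c
  have h6 := n2_nonneg (τ := τ) d
  calc n2 τ d ^ 2 ≤ (‖c‖ * n2 τ c) ^ 2 := by gcongr
    _ = ‖c‖ ^ 2 * n2 τ c ^ 2 := by ring
    _ ≤ 1 * n2 τ c ^ 2 := by gcongr
    _ = _ := one_mul _

lemma UC.mono_lim (h : UC ω π τ M lim) {x : ℕ → R} (hM : ∀ n, x n ∈ M) (h0 : ∀ n, 0 ≤ x n)
    (h1 : ∀ n, x n ≤ 1) (hm : Monotone x) :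
    ∃ y ∈ M, Tendsto (fun k => n2 τ (x k - y)) atTop (𝓝 0) ∧
      (∀ ξ, Tendsto (fun k => π (x k) ξ) atTop (𝓝 (π y ξ))) := by
  have hb : ∀ n, ‖x n‖ ≤ 1 := fun n => (CStarAlgebra.norm_le_one_iff_of_nonneg _ (h0 n)).2 (h1 n)
  refine h.complete ⟨hM, 1, hb⟩ ?_
  have hmono : Monotone (fun n => (τ (x n)).re) := fun a b hab => h.ts.re_mono (hm hab)
  have hbd : BddAbove (Set.range fun n => (τ (x n)).re) := by
    refine ⟨1, ?_⟩
    rintro _ ⟨n, rfl⟩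
    have := h.ts.re_mono (h1 n)
    rwa [h.ts.one] at this
  have hlim := tendsto_atTop_ciSup hmono hbd
  have hc := hlim.cauchySeq
  rw [Metric.cauchySeq_iff] at hc
  have key : ∀ m n, m ≤ n → n2 τ (x n - x m) ^ 2 ≤ (τ (x n)).re - (τ (x m)).re := by
    intro m n hmn
    have hd : 0 ≤ x n - x m := sub_nonneg.2 (hm hmn)
    have hd1 : x n - x m ≤ 1 := (sub_le_self _ (h0 m)).trans (h1 n)
    have := h.ts.n2_sq_le_tau hd ((CStarAlgebra.norm_le_one_iff_of_nonneg _ hd).2 hd1)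
    rwa [map_sub, Complex.sub_re] at this
  intro ε hε
  obtain ⟨N, hN⟩ := hc (ε ^ 2) (by positivity)
  refine ⟨N, fun m hm n hn => ?_⟩
  refine abs_le_of_sq_le_sq' ?_ hε.le |>.2
  have hN' := hN m hm n hn
  rw [Real.dist_eq] at hN'
  rcases le_total m n with hmn | hmn
  · rw [h.ts.n2_sub_comm]
    refine (key m n hmn).trans (le_trans ?_ hN'.le)
    rw [abs_sub_comm]; exact le_abs_self _
  · exact (key n m hmn).trans ((le_abs_self _).trans hN'.le)

lemma UC.anti_lim (h : UC ω π τ M lim) {x : ℕ → R} (hM : ∀ n, x n ∈ M) (h0 : ∀ n, 0 ≤ x n)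
    (h1 : ∀ n, x n ≤ 1) (hm : Antitone x) :
    ∃ y ∈ M, Tendsto (fun k => n2 τ (x k - y)) atTop (𝓝 0) ∧
      (∀ ξ, Tendsto (fun k => π (x k) ξ) atTop (𝓝 (π y ξ))) := by
  obtain ⟨y, hy, h2, h3⟩ := h.mono_lim (x := fun n => 1 - x n) (fun n => sub_mem (one_mem M) (hM n))
    (fun n => sub_nonneg.2 (h1 n)) (fun n => sub_le_self _ (h0 n)) (fun a b hab => sub_le_sub_left (hm hab) _)
  refine ⟨1 - y, sub_mem (one_mem M) hy, ?_, fun ξ => ?_⟩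
  · refine h2.congr fun k => ?_
    rw [← h.ts.n2_neg]; congr 1; abel
  · have := (tendsto_const_nhds (x := ξ)).sub (h3 ξ)
    simp only [map_sub, map_one, sub_apply] at this ⊢
    simpa using this

lemma UC.nonneg_of_strong (h : UC ω π τ M lim) {x : ℕ → R} {y : R} (h0 : ∀ᶠ n in atTop, 0 ≤ x n)
    (hs : ∀ ξ, Tendsto (fun k => π (x k) ξ) atTop (𝓝 (π y ξ))) : 0 ≤ y :=
  h.nonneg_of_wlim (h0.filter_mono h.le_cofinite) fun ξ _ =>
    ((hs ξ).mono_left h.le_cofinite).inner tendsto_const_nhds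

lemma UC.sep_small (h : UC ω π τ M lim) {ξ : ℕ → H} (hξ : ∀ c ∈ M, (∀ i, π c (ξ i) = 0) → c = 0)
    {z : ℕ → R} (hzM : ∀ n, z n ∈ M) (hz0 : ∀ n, 0 ≤ z n) (hz1 : ∀ n, z n ≤ 1)
    (hz : ∀ n, ∀ i ≤ n, (inner ℂ (π (z n) (ξ i)) (ξ i)).re ≤ (1 / 4 : ℝ) ^ n) :
    Tendsto (fun n => (τ (z n)).re) atTop (𝓝 0) := by
  let a : ℕ → ℕ → R := fun n m => ∑ k ∈ Finset.Icc n m, z k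
  have ha0 : ∀ n m, 0 ≤ a n m := fun n m => Finset.sum_nonneg fun k _ => hz0 k
  have haM : ∀ n m, a n m ∈ M := fun n m => sum_mem fun k _ => hzM k
  have ham : ∀ n, Monotone (a n) := fun n m m' hm =>
    Finset.sum_le_sum_of_subset_of_nonneg (Finset.Icc_subset_Icc_right hm) fun k _ _ => hz0 k
  have haa : ∀ m, Antitone (fun n => a n m) := fun m n n' hn =>
    Finset.sum_le_sum_of_subset_of_nonneg (Finset.Icc_subset_Icc_left hn) fun k _ _ => hz0 k
  have H1 := fun n => h.mono_lim (x := fun m => tt (a n m)) (fun m => tt_mem h.closed (haM n m))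
    (fun m => tt_nonneg (ha0 n m)) (fun m => tt_le_one (ha0 n m))
    (fun m m' hm => tt_mono (ha0 n m) (ham n hm))
  choose t htM ht2 hts using H1
  have ht0 : ∀ n, 0 ≤ t n := fun n =>
    h.nonneg_of_strong (Eventually.of_forall fun m => tt_nonneg (ha0 n m)) (hts n)
  have hsub : ∀ (x x' : ℕ → R) (y y' : R), (∀ ξ, Tendsto (fun k => π (x k) ξ) atTop (𝓝 (π y ξ))) →
      (∀ ξ, Tendsto (fun k => π (x' k) ξ) atTop (𝓝 (π y' ξ))) →
      (∀ᶠ n in atTop, x n ≤ x' n) → y ≤ y' := by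
    intro x x' y y' h1 h2 h3
    rw [← sub_nonneg]
    refine h.nonneg_of_strong (x := fun k => x' k - x k) (h3.mono fun n hn => sub_nonneg.2 hn) fun ξ => ?_
    simp only [map_sub, sub_apply]
    exact (h2 ξ).sub (h1 ξ)
  have ht1 : ∀ n, t n ≤ 1 := fun n => hsub _ (fun _ => 1) _ _ (hts n) (fun _ => tendsto_const_nhds)
    (Eventually.of_forall fun m => tt_le_one (ha0 n m))
  have hta : Antitone t := fun n n' hn => hsub _ _ _ _ (hts n') (hts n)
    (Eventually.of_forall fun m => tt_mono (ha0 _ m) (haa m hn))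
  obtain ⟨y, hyM, hy2, hys⟩ := h.anti_lim htM ht0 ht1 hta
  have hy0 : 0 ≤ y := h.nonneg_of_strong (Eventually.of_forall ht0) hys
  have hbig : ∀ n i, i ≤ n → (inner ℂ (π (t n) (ξ i)) (ξ i)).re ≤ 2 * (1 / 4 : ℝ) ^ n := by
    intro n i hin
    have h1 := (Complex.continuous_re.tendsto _).comp ((hts n (ξ i)).inner (tendsto_const_nhds (x := ξ i)))
    refine le_of_tendsto h1 (Eventually.of_forall fun m => ?_)
    refine (UC.pi_mono π (tt_le_self (ha0 n m)) (ξ i)).trans (le_trans ?_ (sum_quarter n m))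
    simp only [a, map_sum, ContinuousLinearMap.sum_apply, sum_inner, Complex.re_sum]
    exact Finset.sum_le_sum fun k hk => hz k i (hin.trans (Finset.mem_Icc.1 hk).1)
  have hyz : ∀ i, (inner ℂ (π y (ξ i)) (ξ i)).re ≤ 0 := by
    intro i
    have h1 := (Complex.continuous_re.tendsto _).comp ((hys (ξ i)).inner (tendsto_const_nhds (x := ξ i)))
    have h2 : Tendsto (fun n : ℕ => 2 * (1 / 4 : ℝ) ^ n) atTop (𝓝 0) := by
      simpa using (tendsto_pow_atTop_nhds_zero_of_lt_one (r := (1 / 4 : ℝ)) (by norm_num)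
        (by norm_num)).const_mul 2
    refine le_of_tendsto_of_tendsto h1 h2 ?_
    filter_upwards [eventually_ge_atTop i] with n hn
    exact hbig n i hn
  have hy : y = 0 := by
    obtain ⟨c, hcM, e, -⟩ := sq_mem h.closed hy0 hyM
    have : c = 0 := hξ c hcM fun i => by
      have h1 := norm_pi_sq π c (ξ i)
      rw [← e] at h1
      have h2 := hyz i
      rw [← h1] at h2
      have h3 : ‖π c (ξ i)‖ = 0 := by nlinarith [norm_nonneg (π c (ξ i))]
      simpa using h3
    rw [e, this]; simp
  have hzt : ∀ n, z n ≤ (2 : ℝ) • t n := by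
    intro n
    have h1 : tt (z n) ≤ t n := hsub (fun _ => tt (z n)) _ _ _ (fun _ => tendsto_const_nhds) (hts n) (by
      filter_upwards [eventually_ge_atTop n] with m hm
      exact tt_mono (hz0 n) (Finset.single_le_sum (f := z) (fun k _ => hz0 k) (Finset.mem_Icc.2 ⟨le_rfl, hm⟩)))
    have h2 := le_tt (hz0 n) ((CStarAlgebra.norm_le_one_iff_of_nonneg _ (hz0 n)).2 (hz1 n))
    norm_num at h2
    exact h2.trans (smul_le_smul_of_nonneg_left h1 (by norm_num))
  have hlast : Tendsto (fun n => 2 * n2 τ (t n - y)) atTop (𝓝 0) := by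
    simpa using hy2.const_mul 2
  refine squeeze_zero (fun n => h.ts.re_nonneg' (hz0 n)) (fun n => ?_) hlast
  refine (h.ts.re_mono (hzt n)).trans ?_
  rw [← Complex.coe_smul, map_smul, smul_eq_mul, Complex.re_ofReal_mul, hy, sub_zero]
  have := (Complex.re_le_norm (τ (t n))).trans (h.ts.norm_tau_le (t n))
  linarith

end ord
end F1a
end PopaQ

open scoped ComplexOrder
open Filter Topology
namespace PopaQ

section F1b
variable {H : Type*} [NormedAddCommGroup H] [InnerProductSpace ℂ H] [CompleteSpace H]
variable {R : Type*} [CStarAlgebra R]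
variable {M : StarSubalgebra ℂ R}
variable {ω : Ultrafilter ℕ} {π : R →⋆ₐ[ℂ] (H →L[ℂ] H)} {τ : R →ₗ[ℂ] ℂ} {lim : (ℕ → R) → R}
variable {ι : Type*} [Fintype ι]

/-- diagonal amplification -/
noncomputable def dg (T : H →L[ℂ] H) : (PiLp 2 fun _ : ι => H) →L[ℂ] (PiLp 2 fun _ : ι => H) :=
  ((PiLp.continuousLinearEquiv 2 ℂ (fun _ : ι => H)).symm.toContinuousLinearMap).comp
    (ContinuousLinearMap.pi fun i => T.comp (PiLp.proj 2 (fun _ : ι => H) i))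

lemma dg_apply (T : H →L[ℂ] H) (x : PiLp 2 fun _ : ι => H) (i : ι) : dg T x i = T (x i) := rfl

lemma dg_adj (T : H →L[ℂ] H) :
    ContinuousLinearMap.adjoint (dg (ι := ι) T) = dg (ContinuousLinearMap.adjoint T) := by
  symm
  rw [ContinuousLinearMap.eq_adjoint_iff]
  intro x y
  simp only [PiLp.inner_apply, dg_apply, ContinuousLinearMap.adjoint_inner_left]

open Classical in
/-- injection -/
noncomputable def ij (j : ι) : H →L[ℂ] (PiLp 2 fun _ : ι => H) :=
  ((PiLp.continuousLinearEquiv 2 ℂ (fun _ : ι => H)).symm.toContinuousLinearMap).comp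
    (ContinuousLinearMap.single ℂ (fun _ : ι => H) j)

open Classical in
lemma ij_apply (j : ι) (v : H) (i : ι) : (ij j v : PiLp 2 fun _ : ι => H) i = if i = j then v else 0 := by
  change (Pi.single j v : ι → H) i = _
  rw [Pi.single_apply]

lemma sum_ij (v : PiLp 2 fun _ : ι => H) : ∑ j, ij j (v j) = v := by
  classical
  ext i
  have : (∑ j, ij j (v j)).ofLp i = ∑ j, (ij j (v j) : PiLp 2 fun _ : ι => H) i := by
    exact map_sum (PiLp.proj 2 (𝕜 := ℂ) (fun _ : ι => H) i) _ _
  rw [this]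
  simp only [ij_apply]
  simp

lemma dg_ij (T : H →L[ℂ] H) (j : ι) (v : H) : dg T (ij j v : PiLp 2 fun _ : ι => H) = ij j (T v) := by
  classical
  ext i
  rw [dg_apply, ij_apply, ij_apply]; split_ifs <;> simp

/-- orbit map -/
noncomputable def orb (π : R →⋆ₐ[ℂ] (H →L[ℂ] H)) (ξ : PiLp 2 fun _ : ι => H) :
    R →ₗ[ℂ] (PiLp 2 fun _ : ι => H) where
  toFun a := dg (π a) ξ
  map_add' a b := by ext i; simp [dg_apply]
  map_smul' a b := by ext i; simp [dg_apply]

lemma bic_closure (A : StarSubalgebra ℂ R) {y : R} (hy : ∀ S, CommM π A S → S * π y = π y * S)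
    (ξ : PiLp 2 fun _ : ι => H) :
    dg (π y) ξ ∈ ((Subalgebra.toSubmodule A.toSubalgebra).map (orb π ξ)).topologicalClosure := by
  set V := ((Subalgebra.toSubmodule A.toSubalgebra).map (orb π ξ)).topologicalClosure with hV
  have hinv : ∀ a ∈ A, ∀ v ∈ V, dg (π a) v ∈ V := by
    intro a ha v hv
    refine map_mem_closure (dg (π a)).continuous hv ?_
    rintro _ ⟨b, hb, rfl⟩
    refine ⟨a * b, show a * b ∈ A from mul_mem ha (show b ∈ A from hb), ?_⟩
    ext i; simp [orb, dg_apply]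
  have hcomm : ∀ a ∈ A, dg (π a) * V.starProjection = V.starProjection * dg (π a) := by
    intro a ha
    refine commute_proj (hinv a ha) ?_
    rw [dg_adj, ← ContinuousLinearMap.star_eq_adjoint, ← map_star]
    exact hinv _ (star_mem ha)
  have hPij : ∀ i j : ι, CommM π A ((PiLp.proj 2 (𝕜 := ℂ) (fun _ : ι => H) i).comp
      (V.starProjection.comp (ij j))) := by
    intro i j a ha
    ext v
    have := DFunLike.congr_fun (hcomm a ha) (ij j v)
    rw [mul_apply_eq_comp, mul_apply_eq_comp, dg_ij] at this
    have h2 := congrArg (fun w : PiLp 2 fun _ : ι => H => w i) this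
    exact h2.symm
  have hξ : ξ ∈ V := Submodule.le_topologicalClosure _ ⟨1, one_mem A, by ext i; simp [orb, dg_apply]⟩
  have hgen : ∀ ζ, V.starProjection (dg (π y) ζ) = dg (π y) (V.starProjection ζ) := by
    intro ζ
    ext i
    rw [dg_apply]
    conv_lhs => rw [← sum_ij ζ]
    conv_rhs => rw [← sum_ij ζ]
    simp only [map_sum, dg_ij]
    have e : ∀ f : ι → PiLp 2 fun _ : ι => H, (∑ j, f j).ofLp i = ∑ j, (f j).ofLp i := fun f =>
      map_sum (PiLp.proj 2 (𝕜 := ℂ) (fun _ : ι => H) i) _ _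
    rw [e, e, map_sum]
    refine Finset.sum_congr rfl fun j _ => ?_
    exact DFunLike.congr_fun (hy _ (hPij i j)) (ζ j)
  have hfin := hgen ξ
  rw [Submodule.starProjection_eq_self_iff.2 hξ] at hfin
  exact Submodule.starProjection_eq_self_iff.1 hfin

lemma bic_seq (A : StarSubalgebra ℂ R) {y : R} (hy : ∀ S, CommM π A S → S * π y = π y * S)
    (ξ : ι → H) : ∃ a : ℕ → R, (∀ n, a n ∈ A) ∧
      ∀ i, Tendsto (fun n => π (a n) (ξ i)) atTop (𝓝 (π y (ξ i))) := by
  have := bic_closure A hy (WithLp.toLp 2 ξ)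
  obtain ⟨v, hv, hl⟩ := mem_closure_iff_seq_limit.1 this
  choose a ha hav using hv
  refine ⟨a, ha, fun i => ?_⟩
  have h1 := ((PiLp.proj 2 (𝕜 := ℂ) (fun _ : ι => H) i).continuous.tendsto _).comp hl
  refine h1.congr fun n => ?_
  rw [Function.comp_apply, ← hav]
  rfl

lemma bic_sa (A : StarSubalgebra ℂ R) {y : R} (hy : ∀ S, CommM π A S → S * π y = π y * S)
    (hsa : IsSelfAdjoint y) (ξ : ι → H) : ∃ a : ℕ → R, (∀ n, a n ∈ A ∧ IsSelfAdjoint (a n)) ∧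
      ∀ i, Tendsto (fun n => π (a n) (ξ i)) atTop (𝓝 (π y (ξ i))) := by
  let ξ' : PiLp 2 fun _ : ι => H := WithLp.toLp 2 ξ
  let _ : InnerProductSpace ℝ (PiLp 2 fun _ : ι => H) := InnerProductSpace.complexToReal
  let W : Submodule ℝ (PiLp 2 fun _ : ι => H) :=
    { carrier := {v | ∃ a ∈ A, IsSelfAdjoint a ∧ dg (π a) ξ' = v}
      add_mem' := by
        rintro _ _ ⟨a, ha, hsa, rfl⟩ ⟨b, hb, hsb, rfl⟩
        exact ⟨a + b, add_mem ha hb, hsa.add hsb, (orb π ξ').map_add a b⟩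
      zero_mem' := ⟨0, zero_mem A, IsSelfAdjoint.zero _, (orb π ξ').map_zero⟩
      smul_mem' := by
        rintro c _ ⟨a, ha, hsa, rfl⟩
        refine ⟨(c : ℂ) • a, A.smul_mem ha _, ?_, ?_⟩
        · rw [IsSelfAdjoint, star_smul, hsa.star_eq]; simp
        · rw [← Complex.coe_smul c (dg (π a) ξ')]
          exact (orb π ξ').map_smul (c : ℂ) a }
  have key : dg (π y) ξ' ∈ W.topologicalClosure := by
    rw [← Submodule.orthogonal_orthogonal_eq_closure, Submodule.mem_orthogonal]
    intro η hη
    rw [Submodule.mem_orthogonal] at hη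
    let ψ : R → ℂ := fun a => ∑ i, (inner ℂ (η i) (π a (ξ i)) + inner ℂ (ξ i) (π a (η i)))
    have hψ : ∀ a, IsSelfAdjoint a → ψ a = ((2 * inner ℝ η (dg (π a) ξ') : ℝ) : ℂ) := by
      intro a ha
      have e1 : (inner ℝ η (dg (π a) ξ') : ℝ) = (inner ℂ η (dg (π a) ξ')).re := rfl
      rw [e1, PiLp.inner_apply]
      simp only [ψ, Complex.re_sum, Finset.mul_sum, Complex.ofReal_sum]
      refine Finset.sum_congr rfl fun i _ => ?_
      rw [dg_apply]
      have e2 : inner ℂ (ξ i) (π a (η i)) = (starRingEnd ℂ) (inner ℂ (η i) (π a (ξ i))) := by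
        rw [inner_conj_symm, ← ContinuousLinearMap.adjoint_inner_right,
          ← ContinuousLinearMap.star_eq_adjoint, ← map_star, ha.star_eq]
      rw [e2, Complex.add_conj]
    have hψadd : ∀ (a b : R) (c : ℂ), ψ (a + c • b) = ψ a + c * ψ b := by
      intro a b c
      simp only [ψ, map_add, map_smul, add_apply, smul_apply, inner_add_right,
        inner_smul_right, Finset.mul_sum, ← Finset.sum_add_distrib]
      refine Finset.sum_congr rfl fun i _ => ?_
      ring
    have hψ0 : ∀ a ∈ A, IsSelfAdjoint a → ψ a = 0 := by
      intro a ha hsa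
      have := hη _ ⟨a, ha, hsa, rfl⟩
      rw [hψ a hsa, real_inner_comm]
      rw [this]; simp
    have hψA : ∀ a ∈ A, ψ a = 0 := by
      intro a ha
      have e : a = (realPart a : R) + Complex.I • (imaginaryPart a : R) :=
        (realPart_add_I_smul_imaginaryPart a).symm
      have hr : (realPart a : R) ∈ A := by
        rw [realPart_apply_coe]
        exact A.smul_mem (add_mem ha (star_mem ha)) ((2⁻¹ : ℝ) : ℂ)
      have hi : (imaginaryPart a : R) ∈ A := by
        rw [imaginaryPart_apply_coe]
        exact A.smul_mem (A.smul_mem (sub_mem ha (star_mem ha)) ((2⁻¹ : ℝ) : ℂ)) _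
      rw [e, hψadd, hψ0 _ hr (realPart a).2, hψ0 _ hi (imaginaryPart a).2]; simp
    obtain ⟨a, haA, hal⟩ := bic_seq A hy (Sum.elim ξ (fun i => η i))
    have h1 : Tendsto (fun n => ψ (a n)) atTop (𝓝 (ψ y)) := by
      refine tendsto_finsetSum _ fun i _ => ?_
      exact (tendsto_const_nhds.inner (hal (Sum.inl i))).add (tendsto_const_nhds.inner (hal (Sum.inr i)))
    have h2 : ψ y = 0 := tendsto_nhds_unique h1 (by simp [hψA _ (haA _)])
    rw [hψ y hsa] at h2
    rw [real_inner_comm]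
    have h3 : (2 * inner ℝ η (dg (π y) ξ') : ℝ) = 0 := by exact_mod_cast h2
    rw [real_inner_comm]
    linarith
  obtain ⟨v, hv, hl⟩ := mem_closure_iff_seq_limit.1 key
  choose a ha hsa' hav using hv
  refine ⟨a, fun n => ⟨ha n, hsa' n⟩, fun i => ?_⟩
  have h1 := ((PiLp.proj 2 (𝕜 := ℂ) (fun _ : ι => H) i).continuous.tendsto _).comp hl
  refine h1.congr fun n => ?_
  rw [Function.comp_apply, ← hav]
  rfl

section ord
variable [PartialOrder R] [StarOrderedRing R]

/-- resolvent-type -/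
noncomputable def rs (b : R) : R := 1 - tt (b * b)

lemma rs_spec {b : R} (hb : IsSelfAdjoint b) : rs b * (1 + b * b) = 1 ∧ (1 + b * b) * rs b = 1 ∧
    ‖rs b‖ ≤ 1 ∧ ‖rs b * b‖ ≤ 1 ∧ IsSelfAdjoint (rs b) ∧ rs b * b = b * rs b := by
  have h0 : 0 ≤ b * b := by
    have := star_mul_self_nonneg b
    rwa [hb.star_eq] at this
  have hsa : IsSelfAdjoint (rs b) := (IsSelfAdjoint.one R).sub (IsSelfAdjoint.of_nonneg (tt_nonneg h0))
  have e1 : rs b * (1 + b * b) = 1 := tt_mul h0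
  have e2 : (1 + b * b) * rs b = 1 := mul_tt h0
  have hn : ‖rs b‖ ≤ 1 := by
    refine (CStarAlgebra.norm_le_one_iff_of_nonneg _ (sub_nonneg.2 (tt_le_one h0))).2 ?_
    exact sub_le_self _ (tt_nonneg h0)
  have hc : rs b * b = b * rs b := by
    calc rs b * b = rs b * b * ((1 + b * b) * rs b) := by rw [e2, mul_one]
      _ = rs b * (1 + b * b) * b * rs b := by noncomm_ring
      _ = b * rs b := by rw [e1, one_mul]
  refine ⟨e1, e2, hn, ?_, hsa, hc⟩
  have h2 : star (rs b * b) * (rs b * b) = tt (b * b) * rs b := by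
    rw [star_mul, hb.star_eq, hsa.star_eq, hc]
    have : rs b * (b * b) = tt (b * b) := by
      have h4 : rs b * (b * b) = 1 - rs b := by
        rw [← e1]; noncomm_ring
      rw [h4]; unfold rs; abel
    have h5 : b * rs b * (b * rs b) = rs b * (b * b) * rs b := by
      rw [← hc]
      have : rs b * b * (rs b * b) = rs b * b * (b * rs b) := by rw [hc]
      rw [this]; noncomm_ring
    rw [h5, this]
  have h3 : ‖rs b * b‖ * ‖rs b * b‖ ≤ 1 := by
    rw [← CStarRing.norm_star_mul_self, h2]
    refine (norm_mul_le _ _).trans ?_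
    have := norm_tt_le h0
    calc _ ≤ (1 : ℝ) * 1 := by gcongr
      _ = 1 := by norm_num
  nlinarith [norm_nonneg (rs b * b)]

lemma rs_diff {y b : R} (hy : IsSelfAdjoint y) (hb : IsSelfAdjoint b) :
    rs y * y - rs b * b = rs y * ((y - b) * rs b) - (rs y * y) * ((y - b) * (b * rs b)) := by
  obtain ⟨y1, y2, -, -, -, y5⟩ := rs_spec hy
  obtain ⟨b1, b2, -, -, -, b5⟩ := rs_spec hb
  have e : rs y * y - rs b * b = rs y * (y * (1 + b * b) - (1 + y * y) * b) * rs b := by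
    rw [b5]
    calc rs y * y - b * rs b = rs y * y * ((1 + b * b) * rs b) - (rs y * (1 + y * y)) * b * rs b := by
          rw [b2, y1, mul_one, one_mul]
      _ = _ := by noncomm_ring
  rw [e]; noncomm_ring

lemma UC.dense_sa (h : UC ω π τ M lim) (A : StarSubalgebra ℂ R) (hAM : A ≤ M)
    (hrs : ∀ a ∈ A, IsSelfAdjoint a → rs a ∈ A) {b : R} (hbM : b ∈ M)
    (hb : ∀ S, CommM π A S → S * π b = π b * S)
    (hsa : IsSelfAdjoint b) : ∀ ε > 0, ∃ a ∈ A, n2 τ (a - rs b * b) < ε := by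
  obtain ⟨ξ, hξ⟩ := h.separating
  obtain ⟨b1, b2, b3, b4, b5, b6⟩ := rs_spec hsa
  have hex : ∀ n : ℕ, ∃ y ∈ A, IsSelfAdjoint y ∧ ∀ i ≤ n, ‖π (rs y * y - rs b * b) (ξ i)‖ ≤ (1 / 2 : ℝ) ^ n := by
    intro n
    obtain ⟨a, ha, hal⟩ := bic_sa A hb hsa (Sum.elim (fun i : Fin (n + 1) => π (rs b) (ξ i))
      (fun i : Fin (n + 1) => π (b * rs b) (ξ i)))
    have hev : ∀ᶠ k in atTop, ∀ j, ‖π (a k) (Sum.elim (fun i : Fin (n + 1) => π (rs b) (ξ i))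
      (fun i : Fin (n + 1) => π (b * rs b) (ξ i)) j) - π b (Sum.elim (fun i : Fin (n + 1) => π (rs b) (ξ i))
      (fun i : Fin (n + 1) => π (b * rs b) (ξ i)) j)‖ < (1 / 2 : ℝ) ^ n / 2 := by
      rw [eventually_all]
      intro j
      have := (tendsto_iff_norm_sub_tendsto_zero.1 (hal j))
      exact this.eventually_lt_const (by positivity)
    obtain ⟨k, hk⟩ := hev.exists
    refine ⟨a k, (ha k).1, (ha k).2, fun i hi => ?_⟩
    have h1 := hk (Sum.inl ⟨i, by omega⟩)
    have h2 := hk (Sum.inr ⟨i, by omega⟩)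
    simp only [Sum.elim_inl, Sum.elim_inr] at h1 h2
    rw [← sub_apply, ← map_sub] at h1 h2
    obtain ⟨-, -, y3, y4, -, -⟩ := rs_spec (ha k).2
    rw [rs_diff (ha k).2 hsa, map_sub, sub_apply, map_mul, map_mul π (a k - b) (rs b), map_mul π (rs (a k) * a k),
      map_mul π (a k - b) (b * rs b)]
    simp only [mul_apply_eq_comp]
    have n1 : ‖π (rs (a k))‖ ≤ 1 := by rw [NonUnitalStarAlgHom.norm_map π h.inj]; exact y3
    have n2 : ‖π (rs (a k) * a k)‖ ≤ 1 := by rw [NonUnitalStarAlgHom.norm_map π h.inj]; exact y4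
    refine (norm_sub_le _ _).trans ?_
    have q1 := (π (rs (a k))).le_of_opNorm_le n1 (π (a k - b) (π (rs b) (ξ i)))
    have q2 := (π (rs (a k) * a k)).le_of_opNorm_le n2 (π (a k - b) (π (b * rs b) (ξ i)))
    linarith
  choose y hyA hysa hy using hex
  let d : ℕ → R := fun n => rs (y n) * y n - rs b * b
  have hrsb : rs b ∈ M := sub_mem (one_mem M) (tt_mem h.closed (mul_mem hbM hbM))
  have hdM : ∀ n, d n ∈ M := fun n => sub_mem (hAM (mul_mem (hrs _ (hyA n) (hysa n)) (hyA n)))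
    (mul_mem hrsb hbM)
  have hdn : ∀ n, ‖d n‖ ≤ 2 := fun n => by
    refine (norm_sub_le _ _).trans ?_
    have := (rs_spec (hysa n)).2.2.2.1
    linarith
  let z : ℕ → R := fun n => star (((1 / 2 : ℝ) : ℂ) • d n) * (((1 / 2 : ℝ) : ℂ) • d n)
  have hz := h.sep_small hξ (z := z) (fun n => mul_mem (star_mem (M.smul_mem (hdM n) _)) (M.smul_mem (hdM n) _))
    (fun n => star_mul_self_nonneg _) (fun n => by
      refine (CStarAlgebra.norm_le_one_iff_of_nonneg _ (star_mul_self_nonneg _)).1 ?_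
      rw [CStarRing.norm_star_mul_self, norm_smul]
      have := hdn n
      have h0 := norm_nonneg (d n)
      norm_num
      nlinarith)
    (fun n i hi => by
      rw [← norm_pi_sq, map_smul, smul_apply, norm_smul]
      have := hy n i hi
      have h4 : ((1 / 2 : ℝ) ^ n) ^ 2 = (1 / 4 : ℝ) ^ n := by
        rw [← pow_mul, mul_comm, pow_mul]; norm_num
      rw [← h4]
      have h5 : ‖((1 / 2 : ℝ) : ℂ)‖ ≤ 1 := by norm_num
      gcongr
      calc _ ≤ 1 * ‖π (d n) (ξ i)‖ := by gcongr
        _ ≤ _ := by rw [one_mul]; exact this)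
  intro ε hε
  obtain ⟨n, hn⟩ := (hz.eventually_lt_const (show 0 < ε ^ 2 / 4 by positivity)).exists
  refine ⟨rs (y n) * y n, mul_mem (hrs _ (hyA n) (hysa n)) (hyA n), ?_⟩
  rw [← h.ts.n2_sq, h.ts.n2_smul] at hn
  have h5 : ‖((1 / 2 : ℝ) : ℂ)‖ = 1 / 2 := by norm_num
  rw [h5] at hn
  refine abs_lt_of_sq_lt_sq' ?_ hε.le |>.2
  change n2 τ (d n) ^ 2 < _
  linarith [show (1 / 2 * n2 τ (d n)) ^ 2 = n2 τ (d n) ^ 2 / 4 by ring]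

lemma UC.dense_alg (h : UC ω π τ M lim) (A : StarSubalgebra ℂ R) (hAM : A ≤ M)
    (hrs : ∀ a ∈ A, IsSelfAdjoint a → rs a ∈ A) {x : R} (hxM : x ∈ M)
    (hx : ∀ S, CommM π A S → S * π x = π x * S) : ∀ ε > 0, ∃ a ∈ A, n2 τ (a - x) < ε := by
  have sa : ∀ b ∈ M, IsSelfAdjoint b → (∀ S, CommM π A S → S * π b = π b * S) →
      ∀ ε > 0, ∃ a ∈ A, n2 τ (a - b) < ε := by
    intro b hbM hsa hb ε hε
    -- scale
    have hlim : Tendsto (fun t : ℝ => t ^ 2 * ‖b‖ ^ 3) (𝓝[>] 0) (𝓝 0) := by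
      have : Tendsto (fun t : ℝ => t ^ 2 * ‖b‖ ^ 3) (𝓝 0) (𝓝 (0 ^ 2 * ‖b‖ ^ 3)) :=
        (Continuous.tendsto (by fun_prop) 0)
      simp at this
      exact this.mono_left nhdsWithin_le_nhds
    obtain ⟨t, ht, ht0⟩ := ((hlim.eventually_lt_const (show 0 < ε / 2 by positivity)).and
      self_mem_nhdsWithin).exists
    have ht0 : 0 < t := ht0
    have hsb : IsSelfAdjoint ((t : ℂ) • b) := by
      rw [IsSelfAdjoint, star_smul, hsa.star_eq]; simp
    obtain ⟨a, haA, han⟩ := h.dense_sa A hAM hrs (M.smul_mem hbM (t : ℂ)) (fun S hS => by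
      rw [map_smul, mul_smul_comm, smul_mul_assoc, hb S hS]) hsb (t * (ε / 2)) (by positivity)
    refine ⟨((t⁻¹ : ℝ) : ℂ) • a, A.smul_mem haA _, ?_⟩
    obtain ⟨c, hc⟩ : ∃ c, c = (t : ℂ) • b := ⟨_, rfl⟩
    rw [← hc] at hsb han
    have hb' : b = ((t⁻¹ : ℝ) : ℂ) • c := by
      rw [hc, smul_smul, ← Complex.ofReal_mul, inv_mul_cancel₀ ht0.ne']; simp
    have h0 : 0 ≤ c * c := by
      have := star_mul_self_nonneg c
      rwa [hsb.star_eq] at this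
    have e1 : ((t⁻¹ : ℝ) : ℂ) • a - b = ((t⁻¹ : ℝ) : ℂ) • (a - rs c * c) - tt (c * c) * b := by
      rw [hb', mul_smul_comm, ← smul_sub, ← smul_sub]
      congr 1
      unfold rs; noncomm_ring
    rw [e1]
    refine (h.ts.n2_sub _ _).trans_lt ?_
    have q1 : n2 τ (((t⁻¹ : ℝ) : ℂ) • (a - rs c * c)) < ε / 2 := by
      rw [h.ts.n2_smul, Complex.norm_real, Real.norm_eq_abs, abs_of_pos (by positivity)]
      rw [inv_mul_lt_iff₀ ht0]; exact han
    have q2 : n2 τ (tt (c * c) * b) ≤ t ^ 2 * ‖b‖ ^ 3 := by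
      refine (h.ts.n2_le_norm _).trans ((norm_mul_le _ _).trans ?_)
      have : ‖tt (c * c)‖ ≤ ‖c * c‖ := CStarAlgebra.norm_le_norm_of_nonneg_of_le (tt_nonneg h0) (tt_le_self h0)
      have h3 : ‖c * c‖ ≤ (t * ‖b‖) * (t * ‖b‖) := by
        refine (norm_mul_le _ _).trans_eq ?_
        rw [hc, norm_smul, Complex.norm_real, Real.norm_eq_abs, abs_of_pos ht0]
      calc _ ≤ ((t * ‖b‖) * (t * ‖b‖)) * ‖b‖ := by gcongr; exact this.trans h3
        _ = _ := by ring
    linarith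
  intro ε hε
  have hst : ∀ S, CommM π A S → S * π (star x) = π (star x) * S := fun S hS => by
    have := congrArg star (hx _ hS.st)
    rw [star_mul, star_mul, star_star, ← map_star] at this
    exact this.symm
  have hr : (realPart x : R) ∈ M ∧ ∀ S, CommM π A S → S * π (realPart x : R) = π (realPart x : R) * S := by
    rw [realPart_apply_coe, ← Complex.coe_smul]
    refine ⟨M.smul_mem (add_mem hxM (star_mem hxM)) _, fun S hS => ?_⟩
    rw [map_smul, map_add, mul_smul_comm, smul_mul_assoc, mul_add, add_mul, hx S hS, hst S hS]
  have hi : (imaginaryPart x : R) ∈ M ∧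
      ∀ S, CommM π A S → S * π (imaginaryPart x : R) = π (imaginaryPart x : R) * S := by
    rw [imaginaryPart_apply_coe, ← Complex.coe_smul]
    refine ⟨M.smul_mem (M.smul_mem (sub_mem hxM (star_mem hxM)) _) _, fun S hS => ?_⟩
    rw [map_smul, map_smul, map_sub, mul_smul_comm, smul_mul_assoc, mul_smul_comm, smul_mul_assoc,
      mul_sub, sub_mul, hx S hS, hst S hS]
  obtain ⟨a, ha, han⟩ := sa _ hr.1 (realPart x).2 hr.2 (ε / 2) (by positivity)
  obtain ⟨b, hb, hbn⟩ := sa _ hi.1 (imaginaryPart x).2 hi.2 (ε / 2) (by positivity)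
  refine ⟨a + Complex.I • b, add_mem ha (A.smul_mem hb _), ?_⟩
  have e : a + Complex.I • b - x = (a - (realPart x : R)) + Complex.I • (b - (imaginaryPart x : R)) := by
    conv_lhs => rw [← realPart_add_I_smul_imaginaryPart x]
    rw [smul_sub]; abel
  rw [e]
  refine (h.ts.n2_add _ _).trans_lt ?_
  rw [h.ts.n2_smul, Complex.norm_I, one_mul]
  linarith

end ord

/-- union of an increasing sequence -/
def uni (A : ℕ → StarSubalgebra ℂ R) (hA : Monotone A) : StarSubalgebra ℂ R where
  carrier := {a | ∃ m, a ∈ A m}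
  mul_mem' := by
    rintro a b ⟨m, hm⟩ ⟨n, hn⟩
    exact ⟨max m n, mul_mem (hA (le_max_left m n) hm) (hA (le_max_right m n) hn)⟩
  add_mem' := by
    rintro a b ⟨m, hm⟩ ⟨n, hn⟩
    exact ⟨max m n, add_mem (hA (le_max_left m n) hm) (hA (le_max_right m n) hn)⟩
  algebraMap_mem' r := ⟨0, (A 0).algebraMap_mem r⟩
  star_mem' := by
    rintro a ⟨m, hm⟩
    exact ⟨m, star_mem hm⟩

theorem UC.dense (h : UC ω π τ M lim) {A : ℕ → StarSubalgebra ℂ R} (hA : Monotone A)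
    (hAM : ∀ m, A m ≤ M) (hcl : ∀ m, IsClosed (A m : Set R)) {x : R} (hxM : x ∈ M)
    (hx : ∀ S, (∀ m, CommM π (A m) S) → S * π x = π x * S) :
    ∀ ε > 0, ∃ m, ∃ a ∈ A m, n2 τ (a - x) < ε := by
  let _ := CStarAlgebra.spectralOrder R
  let _ := CStarAlgebra.spectralOrderedRing R
  intro ε hε
  obtain ⟨a, ⟨m, ha⟩, hn⟩ := h.dense_alg (uni A hA) (by rintro a ⟨m, hm⟩; exact hAM m hm)
    (by
      rintro a ⟨m, hm⟩ _
      exact ⟨m, sub_mem (one_mem _) (tt_mem (hcl m) (mul_mem hm hm))⟩)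
    hxM (fun S hS => hx S fun m y hy => hS y ⟨m, hy⟩) ε hε
  exact ⟨m, a, ha, hn⟩

end F1b
end PopaQ

open scoped ComplexOrder
open Filter Topology
namespace PopaQ

section Hull

lemma hull_compact {E : Type*} [NormedAddCommGroup E] [InnerProductSpace ℝ E]
    [FiniteDimensional ℝ E] {s : Set E} (hs : IsCompact s) : IsCompact (convexHull ℝ s) := by
  rcases s.eq_empty_or_nonempty with rfl | ⟨s0, hs0⟩
  · simp
  let D := Module.finrank ℝ E + 1
  let P : Set ((Fin D → E) × (Fin D → ℝ)) := (Set.univ.pi fun _ => s) ×ˢ stdSimplex ℝ (Fin D)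
  have hP : IsCompact P := (isCompact_univ_pi fun _ => hs).prod (isCompact_stdSimplex ℝ _)
  let f : (Fin D → E) × (Fin D → ℝ) → E := fun p => ∑ i, p.2 i • p.1 i
  have hf : Continuous f := by fun_prop
  have : convexHull ℝ s = f '' P := by
    apply Set.Subset.antisymm
    · intro x hx
      obtain ⟨ι, _, z, w, hz, hai, hw, hw1, hwx⟩ := eq_pos_convex_span_of_mem_convexHull hx
      have hc : Fintype.card ι ≤ Fintype.card (Fin D) := by
        rw [Fintype.card_fin]
        exact hai.card_le_finrank_succ.trans (Nat.add_le_add_right (Submodule.finrank_le _) 1)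
      obtain ⟨e⟩ := Function.Embedding.nonempty_of_card_le hc
      refine ⟨(Function.extend e z (fun _ => s0), Function.extend e w 0), ⟨?_, ?_, ?_⟩, ?_⟩
      · intro j _
        by_cases hj : ∃ i, e i = j
        · obtain ⟨i, rfl⟩ := hj
          simp only [e.injective.extend_apply]; exact hz ⟨i, rfl⟩
        · simp only [Function.extend_apply' _ _ _ hj]; exact hs0
      · intro j
        by_cases hj : ∃ i, e i = j
        · obtain ⟨i, rfl⟩ := hj
          simp only [e.injective.extend_apply]; exact (hw i).le
        · simp only [Function.extend_apply' _ _ _ hj]; exact le_rfl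
      · rw [← hw1]; symm
        apply Fintype.sum_of_injective e e.injective
        · intro j hj
          exact Function.extend_apply' _ _ _ hj
        · intro i; simp only [e.injective.extend_apply]
      · rw [← hwx]; symm
        apply Fintype.sum_of_injective e e.injective
        · intro j hj
          simp only [Function.extend_apply' _ _ _ hj, Pi.zero_apply, zero_smul]
        · intro i; simp only [e.injective.extend_apply]
    · rintro _ ⟨⟨z, w⟩, ⟨hz, hw, hw1⟩, rfl⟩
      exact (convex_convexHull ℝ s).sum_mem (fun i _ => hw i) hw1
        (fun i _ => subset_convexHull ℝ s (hz i trivial))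
  rw [this]; exact hP.image hf

lemma hull_min {E : Type*} [NormedAddCommGroup E] [InnerProductSpace ℝ E]
    [FiniteDimensional ℝ E] {s : Set E} (hs : IsCompact s) (hne : s.Nonempty) :
    ∃ k ∈ convexHull ℝ s, ∀ y ∈ convexHull ℝ s, ‖y‖ = ‖k‖ → y = k := by
  obtain ⟨k, hk, hmin⟩ := (hull_compact hs).exists_isMinOn (hne.mono (subset_convexHull ℝ s))
    continuous_norm.continuousOn
  refine ⟨k, hk, fun y hy hyk => ?_⟩
  have hm : (1 / 2 : ℝ) • y + (1 / 2 : ℝ) • k ∈ convexHull ℝ s :=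
    convex_convexHull ℝ s hy hk (by norm_num) (by norm_num) (by norm_num)
  have h1 : ‖k‖ ≤ ‖(1 / 2 : ℝ) • y + (1 / 2 : ℝ) • k‖ := hmin hm
  rw [← smul_add, norm_smul] at h1
  have h1' : 2 * ‖k‖ ≤ ‖y + k‖ := by
    rw [Real.norm_of_nonneg (by norm_num)] at h1; linarith
  have h2 := parallelogram_law_with_norm ℝ y k
  rw [hyk] at h2
  have h3 : ‖y - k‖ * ‖y - k‖ ≤ 0 := by nlinarith [norm_nonneg k]
  have h4 : ‖y - k‖ = 0 := by nlinarith [norm_nonneg (y - k)]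
  exact sub_eq_zero.mp (norm_eq_zero.mp h4)

lemma core_onb {V : Type*} [AddCommGroup V] [Module ℂ V] [FiniteDimensional ℂ V]
    (c : InnerProductSpace.Core ℂ V) : ∃ (d : ℕ) (g : Fin d → V),
      (∀ i j, c.inner (g i) (g j) = if i = j then 1 else 0) ∧
      ∀ v, v = ∑ i, c.inner (g i) v • g i := by
  let _ : NormedAddCommGroup V := c.toNormedAddCommGroup
  let _ : InnerProductSpace ℂ V := InnerProductSpace.ofCore c.toCore
  let b := stdOrthonormalBasis ℂ V
  refine ⟨_, b, fun i j => ?_, fun v => ?_⟩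
  · exact orthonormal_iff_ite.mp b.orthonormal i j
  · exact (b.sum_repr' v).symm

variable {R : Type*} [CStarAlgebra R] {τ : R →ₗ[ℂ] ℂ}

lemma TrSt.onb (h : TrSt τ) (A : StarSubalgebra ℂ R) [FiniteDimensional ℂ A] :
    ∃ (d : ℕ) (e : Fin d → R), (∀ i, e i ∈ A) ∧
      (∀ i j, τ (star (e i) * e j) = if i = j then 1 else 0) ∧
      ∀ a ∈ A, a = ∑ i, τ (star (e i) * a) • e i := by
  let c : InnerProductSpace.Core ℂ A :=
    { inner := fun x y => τ (star (x : R) * y)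
      conj_inner_symm := fun x y => h.core.conj_inner_symm x y
      re_inner_nonneg := fun x => h.core.re_inner_nonneg x
      add_left := fun x y z => h.core.add_left x y z
      smul_left := fun x y r => h.core.smul_left x y r
      definite := fun x hx => Subtype.ext (h.faithful x hx) }
  obtain ⟨d, g, h1, h2⟩ := core_onb c
  refine ⟨d, fun i => g i, fun i => (g i).2, h1, fun a ha => ?_⟩
  have := congrArg (Subtype.val) (h2 ⟨a, ha⟩)
  rw [AddSubmonoidClass.coe_finsetSum] at this
  exact this

end Hull
end PopaQ

open scoped ComplexOrder
open Filter Topology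
namespace PopaQ

section Avg
variable {R : Type*} [CStarAlgebra R] {τ : R →ₗ[ℂ] ℂ}

/-- Finite invariant average over unitaries of `A`. -/
structure IsAvg (A : StarSubalgebra ℂ R) {n : ℕ} (w : Fin n → ℝ) (u : Fin n → R) : Prop where
  w0 : ∀ i, 0 ≤ w i
  w1 : ∑ i, w i = 1
  mem : ∀ i, u i ∈ A
  l : ∀ i, star (u i) * u i = 1
  r : ∀ i, u i * star (u i) = 1
  L : ∀ (β : R →ₗ[ℂ] R →ₗ[ℂ] R), ∀ a ∈ A, ∑ i, (w i : ℂ) • β (a * u i) (star (u i))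
    = ∑ i, (w i : ℂ) • β (u i) (star (u i) * a)
  Rt : ∀ (β : R →ₗ[ℂ] R →ₗ[ℂ] R), ∀ a ∈ A, ∑ i, (w i : ℂ) • β (u i * a) (star (u i))
    = ∑ i, (w i : ℂ) • β (u i) (a * star (u i))

lemma TrSt.continuous (h : TrSt τ) : Continuous τ := by
  let _ := CStarAlgebra.spectralOrder R
  let _ := CStarAlgebra.spectralOrderedRing R
  exact AddMonoidHomClass.continuous_of_bound τ 1
    (fun x => by rw [one_mul]; exact (h.norm_tau_le x).trans (h.n2_le_norm x))

/-- unitaries in `A` -/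
def UA (A : StarSubalgebra ℂ R) : Set R := {u | u ∈ A ∧ star u * u = 1 ∧ u * star u = 1}

lemma norm_le_one_of_un {u : R} (hu : star u * u = 1) : ‖u‖ ≤ 1 := by
  have h1 := CStarRing.norm_star_mul_self (x := u)
  rw [hu] at h1
  rcases subsingleton_or_nontrivial R with _ | _
  · rw [Subsingleton.elim u 0, norm_zero]; exact zero_le_one
  · rw [norm_one] at h1
    nlinarith [norm_nonneg u]

lemma isCompact_UA (A : StarSubalgebra ℂ R) [FiniteDimensional ℂ A] : IsCompact (UA A) := by
  have : ProperSpace A := FiniteDimensional.proper ℂ A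
  have h1 : UA A = Subtype.val '' {u : A | star (u : R) * u = 1 ∧ (u : R) * star (u : R) = 1} := by
    ext u; constructor
    · rintro ⟨h1, h2⟩; exact ⟨⟨u, h1⟩, h2, rfl⟩
    · rintro ⟨v, h, rfl⟩; exact ⟨v.2, h⟩
  rw [h1]
  refine IsCompact.image ?_ continuous_subtype_val
  refine IsCompact.of_isClosed_subset (isCompact_closedBall (0 : A) 1) ?_ ?_
  · have c : Continuous fun u : A => (u : R) := continuous_subtype_val
    exact (isClosed_eq (by fun_prop) (by fun_prop)).inter (isClosed_eq (by fun_prop) (by fun_prop))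
  · intro u hu
    rw [mem_closedBall_zero_iff]
    exact norm_le_one_of_un hu.1

lemma span_UA (A : StarSubalgebra ℂ R) [FiniteDimensional ℂ A] {a : R} (ha : a ∈ A) :
    a ∈ Submodule.span ℂ (UA A) := by
  have hcl : IsClosed (A : Set R) := by
    have : FiniteDimensional ℂ (Subalgebra.toSubmodule A.toSubalgebra) :=
      ‹FiniteDimensional ℂ A›
    exact Submodule.closed_of_finiteDimensional (Subalgebra.toSubmodule A.toSubalgebra)
  let _ : CStarAlgebra A := StarSubalgebra.cstarAlgebra A (h_closed := hcl)
  have h1 : (⟨a, ha⟩ : A) ∈ Submodule.span ℂ (unitary A : Set A) := by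
    rw [CStarAlgebra.span_unitary]; trivial
  have h2 := Submodule.mem_map_of_mem (f := A.toSubalgebra.val.toLinearMap) h1
  rw [Submodule.map_span] at h2
  refine Submodule.span_mono ?_ h2
  rintro _ ⟨v, hv, rfl⟩
  refine ⟨v.2, ?_, ?_⟩
  · exact congrArg Subtype.val (Unitary.star_mul_self_of_mem hv)
  · exact congrArg Subtype.val (Unitary.mul_star_self_of_mem hv)

lemma TrSt.exists_avg (h : TrSt τ) (A : StarSubalgebra ℂ R) [FiniteDimensional ℂ A] :
    ∃ (n : ℕ) (w : Fin n → ℝ) (u : Fin n → R), IsAvg A w u := by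
  obtain ⟨d, e, heA, heo, hex⟩ := h.onb A
  let F : R → EuclideanSpace ℂ (Fin d × Fin d) := fun u =>
    WithLp.toLp 2 (fun p => τ (star (e p.1) * u) * star (τ (star (e p.2) * u)))
  have hFa : ∀ u p, F u p = τ (star (e p.1) * u) * star (τ (star (e p.2) * u)) := fun _ _ => rfl
  have hc := h.continuous
  have hF : Continuous F := by
    refine (PiLp.continuous_toLp 2 _).comp (continuous_pi fun p => ?_)
    fun_prop
  have hpar : ∀ a ∈ A, ∀ b, τ (star a * b) = ∑ i, star (τ (star (e i) * a)) * τ (star (e i) * b) := by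
    intro a ha b
    conv_lhs => rw [hex a ha]
    rw [star_sum, Finset.sum_mul, map_sum]
    simp only [star_smul, smul_mul_assoc, map_smul, smul_eq_mul]
  have hin : ∀ a ∈ A, ∀ b ∈ A, inner ℝ (F a) (F b) = Complex.normSq (τ (star a * b)) := by
    intro a ha b hb
    have : inner ℂ (F a) (F b) = τ (star a * b) * star (τ (star a * b)) := by
      rw [PiLp.inner_apply, hpar a ha b, star_sum, Finset.sum_mul_sum, Fintype.sum_prod_type]
      refine Finset.sum_congr rfl fun i _ => Finset.sum_congr rfl fun j _ => ?_
      rw [RCLike.inner_apply', hFa, hFa]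
      simp only [star_mul', star_star, starRingEnd_apply]
      ring
    have h2 : inner ℝ (F a) (F b) = (inner ℂ (F a) (F b)).re := by
      rw [PiLp.inner_apply, PiLp.inner_apply, Complex.re_sum]
      rfl
    rw [h2, this, Complex.star_def, Complex.mul_conj, Complex.ofReal_re]
  obtain ⟨k, hk, hku⟩ := hull_min ((isCompact_UA A).image hF)
    ⟨F 1, 1, ⟨one_mem _, by simp, by simp⟩, rfl⟩
  obtain ⟨ι, _, w', z, hw0, hw1, hz, hwk⟩ := mem_convexHull_iff_exists_fintype.1 hk
  choose u' hu' hu'z using hz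
  let eq := (Fintype.equivFin ι).symm
  obtain ⟨n, w, u, hw0, hw1, hu, hwk⟩ : ∃ (n : ℕ) (w : Fin n → ℝ) (u : Fin n → R),
      (∀ i, 0 ≤ w i) ∧ ∑ i, w i = 1 ∧ (∀ i, u i ∈ UA A) ∧ ∑ i, w i • F (u i) = k := by
    refine ⟨_, w' ∘ eq, u' ∘ eq, fun i => hw0 _, ?_, fun i => hu' _, ?_⟩
    · rw [← hw1]; exact eq.sum_comp w'
    · rw [← hwk]
      simp only [← hu'z]
      exact eq.sum_comp (fun i => w' i • F (u' i))
  have inv : ∀ g : R → R, (∀ x ∈ UA A, g x ∈ UA A) →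
      (∀ x ∈ UA A, ∀ y ∈ UA A, τ (star (g x) * g y) = τ (star x * y)) →
      ∀ p, ∑ i, (w i : ℂ) * F (g (u i)) p = ∑ i, (w i : ℂ) * F (u i) p := by
    intro g hg1 hg2 p
    have h1 : ∑ i, w i • F (g (u i)) = k := by
      apply hku
      · exact (convex_convexHull ℝ _).sum_mem (fun i _ => hw0 i) hw1
          (fun i _ => subset_convexHull ℝ _ ⟨_, hg1 _ (hu i), rfl⟩)
      · rw [← hwk, ← sq_eq_sq₀ (norm_nonneg _) (norm_nonneg _), ← real_inner_self_eq_norm_sq,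
          ← real_inner_self_eq_norm_sq]
        simp only [sum_inner, inner_sum, real_inner_smul_left, real_inner_smul_right]
        refine Finset.sum_congr rfl fun i _ => Finset.sum_congr rfl fun j _ => ?_
        rw [hin _ (hg1 _ (hu j)).1 _ (hg1 _ (hu i)).1, hin _ (hu j).1 _ (hu i).1,
          hg2 _ (hu j) _ (hu i)]
    rw [← hwk] at h1
    have h2 := congrArg (fun v : EuclideanSpace ℂ (Fin d × Fin d) => v p) h1
    simpa using h2
  have invβ : ∀ g : R → R, (∀ x ∈ UA A, g x ∈ UA A) →
      (∀ x ∈ UA A, ∀ y ∈ UA A, τ (star (g x) * g y) = τ (star x * y)) →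
      ∀ (β : R →ₗ[ℂ] R →ₗ[ℂ] R),
      ∑ i, (w i : ℂ) • β (g (u i)) (star (g (u i))) = ∑ i, (w i : ℂ) • β (u i) (star (u i)) := by
    intro g hg1 hg2 β
    have key : ∀ x ∈ A, β x (star x) = ∑ p : Fin d × Fin d, F x p • β (e p.1) (star (e p.2)) := by
      intro x hx
      conv_lhs => rw [hex x hx]
      rw [star_sum, map_sum β, LinearMap.sum_apply, Fintype.sum_prod_type]
      refine Finset.sum_congr rfl fun i _ => ?_
      rw [map_sum]
      refine Finset.sum_congr rfl fun j _ => ?_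
      rw [star_smul, map_smul, map_smul, LinearMap.smul_apply, smul_smul, hFa, mul_comm]
    have e1 : ∀ v : Fin n → R, (∀ i, v i ∈ A) → ∑ i, (w i : ℂ) • β (v i) (star (v i))
        = ∑ p : Fin d × Fin d, (∑ i, (w i : ℂ) * F (v i) p) • β (e p.1) (star (e p.2)) := by
      intro v hv
      simp only [Finset.sum_smul]
      rw [Finset.sum_comm]
      refine Finset.sum_congr rfl fun i _ => ?_
      rw [key _ (hv i), Finset.smul_sum]
      simp only [smul_smul]
    rw [e1 _ (fun i => (hg1 _ (hu i)).1), e1 _ (fun i => (hu i).1)]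
    simp only [inv g hg1 hg2]
  refine ⟨n, w, u, hw0, hw1, fun i => (hu i).1, fun i => (hu i).2.1, fun i => (hu i).2.2, ?_, ?_⟩
  · intro β a ha
    have hs := span_UA A ha
    clear ha
    induction hs using Submodule.span_induction with
    | zero => simp
    | add x y _ _ hx hy => simp only [add_mul, mul_add, map_add, LinearMap.add_apply, smul_add,
        Finset.sum_add_distrib, hx, hy]
    | smul c x _ hx =>
      simp only [smul_mul_assoc, mul_smul_comm, map_smul, LinearMap.smul_apply,
        smul_comm _ c, ← Finset.smul_sum, hx]
    | mem v hv =>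
      have := invβ (fun x => v * x) (fun x hx => ⟨mul_mem hv.1 hx.1, by
          rw [star_mul, mul_assoc, ← mul_assoc (star v), hv.2.1, one_mul, hx.2.1], by
          rw [star_mul, mul_assoc, ← mul_assoc x, hx.2.2, one_mul, hv.2.2]⟩)
        (fun x _ y _ => by rw [star_mul, mul_assoc, ← mul_assoc (star v), hv.2.1, one_mul])
        (β.compl₂ (LinearMap.mulRight ℂ v))
      simpa [mul_assoc, hv.2.1] using this
  · intro β a ha
    have hs := span_UA A ha
    clear ha
    induction hs using Submodule.span_induction with
    | zero => simp
    | add x y _ _ hx hy => simp only [add_mul, mul_add, map_add, LinearMap.add_apply, smul_add,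
        Finset.sum_add_distrib, hx, hy]
    | smul c x _ hx =>
      simp only [smul_mul_assoc, mul_smul_comm, map_smul, LinearMap.smul_apply,
        smul_comm _ c, ← Finset.smul_sum, hx]
    | mem v hv =>
      have := invβ (fun x => x * v) (fun x hx => ⟨mul_mem hx.1 hv.1, by
          rw [star_mul, mul_assoc, ← mul_assoc (star x), hx.2.1, one_mul, hv.2.1], by
          rw [star_mul, mul_assoc, ← mul_assoc v, hv.2.2, one_mul, hx.2.2]⟩)
        (fun x _ y _ => by
          rw [star_mul, mul_assoc, h.comm, mul_assoc, mul_assoc, hv.2.2, mul_one])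
        (β.compl₂ (LinearMap.mulLeft ℂ v))
      simpa [← mul_assoc, hv.2.2] using this

end Avg
end PopaQ

open scoped ComplexOrder
open Filter Topology
namespace PopaQ

section AvgCons
variable {H : Type*} [NormedAddCommGroup H] [InnerProductSpace ℂ H] [CompleteSpace H]
variable {R : Type*} [CStarAlgebra R] {τ : R →ₗ[ℂ] ℂ}

/-- bundled average -/
structure AvD (A : StarSubalgebra ℂ R) where
  /-- number -/
  n : ℕ
  /-- weights -/
  w : Fin n → ℝ
  /-- unitaries -/
  u : Fin n → R
  is : IsAvg A w u

lemma TrSt.avg (h : TrSt τ) (A : StarSubalgebra ℂ R) [FiniteDimensional ℂ A] : Nonempty (AvD A) := by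
  obtain ⟨n, w, u, hh⟩ := h.exists_avg A
  exact ⟨⟨n, w, u, hh⟩⟩

variable {A M : StarSubalgebra ℂ R}

/-- conjugation average -/
noncomputable def AvD.ph (p : AvD A) : R →ₗ[ℂ] R :=
  ∑ i, (p.w i : ℂ) • (LinearMap.mulLeft ℂ (p.u i)).comp (LinearMap.mulRight ℂ (star (p.u i)))

lemma AvD.ph_apply (p : AvD A) (z : R) :
    p.ph z = ∑ i, (p.w i : ℂ) • (p.u i * z * star (p.u i)) := by
  simp [AvD.ph, mul_assoc]

/-- module average -/
noncomputable def AvD.av (p : AvD A) (S : R →ₗ[ℂ] R) : R →ₗ[ℂ] R :=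
  ∑ i, (p.w i : ℂ) • (LinearMap.mulLeft ℂ (p.u i)).comp
    (S.comp (LinearMap.mulLeft ℂ (star (p.u i))))

lemma AvD.av_apply (p : AvD A) (S : R →ₗ[ℂ] R) (x : R) :
    p.av S x = ∑ i, (p.w i : ℂ) • (p.u i * S (star (p.u i) * x)) := by
  simp [AvD.av]

lemma AvD.av_mul (p : AvD A) (S : R →ₗ[ℂ] R) {a : R} (ha : a ∈ A) (x : R) :
    p.av S (a * x) = a * p.av S x := by
  have := p.is.L (LinearMap.mk₂ ℂ (fun s t => s * S (t * x)) (by intros; simp [add_mul])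
    (by intros; simp) (by intros; simp [add_mul, mul_add]) (by intros; simp)) a ha
  simp only [LinearMap.mk₂_apply] at this
  rw [AvD.av_apply, AvD.av_apply, Finset.mul_sum]
  simp only [mul_smul_comm, ← mul_assoc] at this ⊢
  exact this.symm

lemma AvD.ph_comm (p : AvD A) {a : R} (ha : a ∈ A) (z : R) : a * p.ph z = p.ph z * a := by
  have := p.is.L (LinearMap.mk₂ ℂ (fun s t => s * z * t) (by intros; simp [add_mul])
    (by intros; simp) (by intros; simp [mul_add]) (by intros; simp)) a ha
  simp only [LinearMap.mk₂_apply] at this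
  rw [AvD.ph_apply, Finset.mul_sum, Finset.sum_mul]
  simp only [mul_smul_comm, smul_mul_assoc, ← mul_assoc] at this ⊢
  exact this

lemma AvD.ph_swap (p : AvD A) {a : R} (ha : a ∈ A) (z : R) : p.ph (a * z) = p.ph (z * a) := by
  have := p.is.Rt (LinearMap.mk₂ ℂ (fun s t => s * z * t) (by intros; simp [add_mul])
    (by intros; simp) (by intros; simp [mul_add]) (by intros; simp)) a ha
  simp only [LinearMap.mk₂_apply] at this
  rw [AvD.ph_apply, AvD.ph_apply]
  simp only [← mul_assoc] at this ⊢
  exact this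

lemma AvD.wsum (p : AvD A) : ∑ i, (p.w i : ℂ) = 1 := by
  rw [← Complex.ofReal_sum, p.is.w1, Complex.ofReal_one]

lemma AvD.ph_lmul (p : AvD A) {c : R} (hc : ∀ a ∈ A, a * c = c * a) (z : R) :
    p.ph (c * z) = c * p.ph z := by
  rw [AvD.ph_apply, AvD.ph_apply, Finset.mul_sum]
  refine Finset.sum_congr rfl fun i _ => ?_
  rw [← mul_assoc, hc _ (p.is.mem i), mul_smul_comm, mul_assoc, mul_assoc, mul_assoc]

lemma AvD.ph_one (p : AvD A) : p.ph 1 = 1 := by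
  rw [AvD.ph_apply]
  simp only [mul_one, p.is.r]
  rw [← Finset.sum_smul, p.wsum, one_smul]

lemma AvD.ph_fix (p : AvD A) {c : R} (hc : ∀ a ∈ A, a * c = c * a) : p.ph c = c := by
  have := p.ph_lmul hc 1
  rwa [p.ph_one, mul_one] at this

lemma AvD.tau_ph (h : TrSt τ) (p : AvD A) (z : R) : τ (p.ph z) = τ z := by
  rw [AvD.ph_apply, map_sum]
  have : ∀ i, τ ((p.w i : ℂ) • (p.u i * z * star (p.u i))) = (p.w i : ℂ) * τ z := fun i => by
    rw [map_smul, h.comm, ← mul_assoc, p.is.l, one_mul, smul_eq_mul]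
  simp only [this]
  rw [← Finset.sum_mul, p.wsum, one_mul]

lemma AvD.tau_mul_ph (h : TrSt τ) (p : AvD A) {c : R} (hc : ∀ a ∈ A, a * c = c * a) (z : R) :
    τ (c * p.ph z) = τ (c * z) := by
  rw [← p.ph_lmul hc, p.tau_ph h]

lemma AvD.ph_star (p : AvD A) (z : R) : star (p.ph z) = p.ph (star z) := by
  rw [AvD.ph_apply, AvD.ph_apply, star_sum]
  refine Finset.sum_congr rfl fun i _ => ?_
  simp [mul_assoc]

lemma AvD.ph_mem (p : AvD A) (hA : A ≤ M) {z : R} (hz : z ∈ M) : p.ph z ∈ M := by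
  rw [AvD.ph_apply]
  refine sum_mem fun i _ => M.smul_mem (mul_mem (mul_mem (hA (p.is.mem i)) hz)
    (star_mem (hA (p.is.mem i)))) _

lemma AvD.av_mem (p : AvD A) (hA : A ≤ M) {S : R →ₗ[ℂ] R} (hS : ∀ x ∈ M, S x ∈ M) {z : R}
    (hz : z ∈ M) : p.av S z ∈ M := by
  rw [AvD.av_apply]
  exact sum_mem fun i _ => M.smul_mem (mul_mem (hA (p.is.mem i))
    (hS _ (mul_mem (star_mem (hA (p.is.mem i))) hz))) _

lemma AvD.n2_sum (h : TrSt τ) (p : AvD A) (f : Fin p.n → R) (C : ℝ) (hC : ∀ i, n2 τ (f i) ≤ C) :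
    n2 τ (∑ i, (p.w i : ℂ) • f i) ≤ C := by
  refine (h.n2_sum _ _).trans ?_
  calc ∑ i, n2 τ ((p.w i : ℂ) • f i) ≤ ∑ i, p.w i * C := by
        refine Finset.sum_le_sum fun i _ => ?_
        rw [h.n2_smul, Complex.norm_real, Real.norm_of_nonneg (p.is.w0 i)]
        exact mul_le_mul_of_nonneg_left (hC i) (p.is.w0 i)
    _ = C := by rw [← Finset.sum_mul, p.is.w1, one_mul]

lemma AvD.norm_sum (p : AvD A) (f : Fin p.n → R) (C : ℝ) (hC : ∀ i, ‖f i‖ ≤ C) :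
    ‖∑ i, (p.w i : ℂ) • f i‖ ≤ C := by
  refine (norm_sum_le _ _).trans ?_
  calc ∑ i, ‖(p.w i : ℂ) • f i‖ ≤ ∑ i, p.w i * C := by
        refine Finset.sum_le_sum fun i _ => ?_
        rw [norm_smul, Complex.norm_real, Real.norm_of_nonneg (p.is.w0 i)]
        exact mul_le_mul_of_nonneg_left (hC i) (p.is.w0 i)
    _ = C := by rw [← Finset.sum_mul, p.is.w1, one_mul]

lemma n2_un_mul (u x : R) (hu : star u * u = 1) : n2 τ (u * x) = n2 τ x := by
  unfold n2
  rw [star_mul, mul_assoc, ← mul_assoc (star u), hu, one_mul]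

lemma TrSt.n2_mul_un (h : TrSt τ) (u x : R) (hu : u * star u = 1) : n2 τ (x * u) = n2 τ x := by
  rw [← h.n2_star, star_mul, n2_un_mul, h.n2_star]
  rwa [star_star]

lemma AvD.un_star (p : AvD A) (i) : star (star (p.u i)) * star (p.u i) = 1 := by
  rw [star_star]; exact p.is.r i

lemma AvD.norm_u (p : AvD A) (i) : ‖p.u i‖ ≤ 1 := norm_le_one_of_un (p.is.l i)

lemma AvD.norm_ph (p : AvD A) (z : R) : ‖p.ph z‖ ≤ ‖z‖ := by
  rw [p.ph_apply]
  refine p.norm_sum _ _ fun i => ?_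
  have h1 := p.norm_u i
  have h2 : ‖star (p.u i)‖ ≤ 1 := by rw [norm_star]; exact h1
  calc _ ≤ ‖p.u i‖ * ‖z‖ * ‖star (p.u i)‖ := norm_mul₃_le
    _ ≤ 1 * ‖z‖ * 1 := by gcongr
    _ = ‖z‖ := by ring

lemma AvD.n2_ph (h : TrSt τ) (p : AvD A) (z : R) : n2 τ (p.ph z) ≤ n2 τ z := by
  rw [p.ph_apply]
  refine p.n2_sum h _ _ fun i => ?_
  rw [h.n2_mul_un _ _ (by rw [star_star]; exact p.is.l i), n2_un_mul _ _ (p.is.l i)]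

lemma AvD.n2_av (h : TrSt τ) (p : AvD A) (hA : A ≤ M) {S : R →ₗ[ℂ] R} {C : ℝ}
    (hS : ∀ x ∈ M, n2 τ (S x) ≤ C * n2 τ x) {z : R} (hz : z ∈ M) :
    n2 τ (p.av S z) ≤ C * n2 τ z := by
  rw [p.av_apply]
  refine p.n2_sum h _ _ fun i => ?_
  rw [n2_un_mul _ _ (p.is.l i)]
  refine (hS _ (mul_mem (star_mem (hA (p.is.mem i))) hz)).trans_eq ?_
  rw [n2_un_mul _ _ (p.un_star i)]

/-- orthonormal basis -/
structure IsONB (τ : R →ₗ[ℂ] ℂ) (A : StarSubalgebra ℂ R) {d : ℕ} (e : Fin d → R) : Prop where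
  mem : ∀ i, e i ∈ A
  orth : ∀ i j, τ (star (e i) * e j) = if i = j then 1 else 0
  ex : ∀ a ∈ A, a = ∑ i, τ (star (e i) * a) • e i

lemma IsONB.comm (h : TrSt τ) {d : ℕ} {e : Fin d → R} (he : IsONB τ A e) {a : R} (ha : a ∈ A)
    (y : R) : a * ∑ i, e i * y * star (e i) = (∑ i, e i * y * star (e i)) * a := by
  rw [Finset.mul_sum, Finset.sum_mul]
  have e1 : ∀ i, a * (e i * y * star (e i))
      = ∑ j, τ (star (e j) * (a * e i)) • (e j * y * star (e i)) := fun i => by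
    rw [← mul_assoc, ← mul_assoc, he.ex _ (mul_mem ha (he.mem i)), Finset.sum_mul, Finset.sum_mul]
    simp only [smul_mul_assoc, ← he.ex _ (mul_mem ha (he.mem i))]
  have e2 : ∀ j, e j * y * star (e j) * a
      = ∑ i, τ (star (e j) * (a * e i)) • (e j * y * star (e i)) := fun j => by
    have : star (e j) * a = ∑ i, τ (star (e j) * (a * e i)) • star (e i) := by
      have h1 : star (star a * e j) = star (e j) * a := by simp
      rw [← h1, he.ex _ (mul_mem (star_mem ha) (he.mem j)), star_sum]
      refine Finset.sum_congr rfl fun i _ => ?_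
      rw [star_smul, ← h.tau_star]
      simp [mul_assoc]
    rw [mul_assoc, this, Finset.mul_sum]
    simp only [mul_smul_comm]
  simp only [e1, e2]
  exact Finset.sum_comm

lemma IsONB.inv [FiniteDimensional ℂ A] (h : TrSt τ) {d : ℕ} {e : Fin d → R} (he : IsONB τ A e) :
    ∃ h' ∈ A, h' * (∑ i, e i * star (e i)) = 1 ∧ (∑ i, e i * star (e i)) * h' = 1 := by
  obtain ⟨q, hq⟩ : ∃ q, q = ∑ i, e i * star (e i) := ⟨_, rfl⟩
  have hqA : q ∈ A := hq ▸ sum_mem fun i _ => mul_mem (he.mem i) (star_mem (he.mem i))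
  have hc : ∀ a ∈ A, a * q = q * a := fun a ha => by
    have := he.comm h ha 1
    simpa only [mul_one, ← hq] using this
  let f : A →ₗ[ℂ] A := LinearMap.mulLeft ℂ (⟨q, hqA⟩ : A)
  have hf : Function.Injective f := by
    rw [injective_iff_map_eq_zero]
    intro a ha
    have h1 : q * (a : R) = 0 := congrArg Subtype.val ha
    have h2 : ∑ i, n2 τ (star (e i) * a) ^ 2 = 0 := by
      have : τ (star (a : R) * (q * a)) = 0 := by rw [h1, mul_zero, map_zero]
      rw [hq, Finset.sum_mul, Finset.mul_sum, map_sum] at this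
      have h3 := congrArg Complex.re this
      rw [Complex.re_sum, Complex.zero_re] at h3
      rw [← h3]
      refine Finset.sum_congr rfl fun i _ => ?_
      rw [h.n2_sq, star_mul, star_star]; simp only [mul_assoc]
    rw [Finset.sum_eq_zero_iff_of_nonneg (fun i _ => sq_nonneg _)] at h2
    have h4 : ∀ i, star (e i) * (a : R) = 0 := fun i =>
      h.n2_eq_zero (by simpa using h2 i (Finset.mem_univ i))
    apply Subtype.ext
    have h5 : star (1 : R) * a = 0 := by
      rw [he.ex 1 (one_mem _), star_sum, Finset.sum_mul]
      refine Finset.sum_eq_zero fun i _ => ?_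
      rw [star_smul, smul_mul_assoc, h4, smul_zero]
    simpa using h5
  obtain ⟨b, hb⟩ := LinearMap.surjective_of_injective hf 1
  have hb' : q * (b : R) = 1 := congrArg Subtype.val hb
  refine ⟨b, b.2, ?_, ?_⟩
  · rw [← hq, hc _ b.2, hb']
  · rw [← hq, hb']

variable [PartialOrder R] [StarOrderedRing R]
variable {ω : Ultrafilter ℕ} {π : R →⋆ₐ[ℂ] (H →L[ℂ] H)} {lim : (ℕ → R) → R}

/-- convergence of averages -/
theorem UC.ph_tendsto (h : UC ω π τ M lim) {A : ℕ → StarSubalgebra ℂ R} (hA : Monotone A)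
    (hAM : ∀ m, A m ≤ M) (p : ∀ m, AvD (A m))
    (hc : ∀ x ∈ M, (∀ m, ∀ a ∈ A m, a * x = x * a) → ∃ c : ℂ, x = c • 1) {z : R} (hz : z ∈ M) :
    Tendsto (fun m => n2 τ ((p m).ph z - τ z • 1)) atTop (𝓝 0) := by
  have ts := h.ts
  let x : ℕ → R := fun m => (p m).ph z
  have hbs : BS M x := ⟨fun m => (p m).ph_mem (hAM m) hz, ‖z‖, fun m => (p m).norm_ph z⟩
  have hcm : ∀ m, ∀ a ∈ A m, a * x m = x m * a := fun m a ha => (p m).ph_comm ha z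
  have hpy : ∀ k m, k ≤ m → n2 τ (x k - x m) ^ 2 = n2 τ (x k) ^ 2 - n2 τ (x m) ^ 2 := by
    intro k m hkm
    have hcs : ∀ a ∈ A m, a * star (x m) = star (x m) * a := fun a ha => by
      have := congrArg star (hcm m (star a) (star_mem ha))
      simpa using this.symm
    have e1 : τ (star (x m) * x k) = τ (star (x m) * z) :=
      (p k).tau_mul_ph ts (fun a ha => hcs a (hA hkm ha)) z
    have e2 : τ (star (x m) * x m) = τ (star (x m) * z) := (p m).tau_mul_ph ts hcs z
    have e3 : τ (star (x k) * x m) = star (τ (star (x m) * x k)) := by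
      rw [← ts.tau_star]; simp
    have e4 : star (τ (star (x m) * x m)) = τ (star (x m) * x m) := by
      rw [← ts.tau_star]; simp
    rw [ts.n2_sq, ts.n2_sq, ts.n2_sq, star_sub, sub_mul, mul_sub, mul_sub, map_sub, map_sub,
      map_sub, e3, e1, ← e2, e4]
    simp
  have hanti : Antitone fun m => n2 τ (x m) ^ 2 := fun k m hkm => by
    have := hpy k m hkm
    have := sq_nonneg (n2 τ (x k - x m))
    change n2 τ (x m) ^ 2 ≤ n2 τ (x k) ^ 2
    linarith
  have hconv := tendsto_atTop_ciInf hanti ⟨0, by rintro _ ⟨m, rfl⟩; exact sq_nonneg _⟩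
  have hcau := hconv.cauchySeq
  have hC2 : C2 τ x := by
    have hw : ∀ ε > 0, ∃ N, ∀ m ≥ N, ∀ n ≥ N, m ≤ n → n2 τ (x m - x n) ≤ ε := by
      intro ε hε
      obtain ⟨N, hN⟩ := Metric.cauchySeq_iff.mp hcau (ε ^ 2) (by positivity)
      refine ⟨N, fun m hm n hn hmn => ?_⟩
      have h1 := hN m hm n hn
      rw [Real.dist_eq] at h1
      have h2 := (abs_lt.mp h1).2
      rw [← hpy m n hmn] at h2
      exact (pow_lt_pow_iff_left₀ (n2_nonneg _) hε.le two_ne_zero).mp h2 |>.le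
    intro ε hε
    obtain ⟨N, hN⟩ := hw ε hε
    refine ⟨N, fun m hm n hn => ?_⟩
    rcases le_total m n with hmn | hmn
    · exact hN m hm n hn hmn
    · rw [ts.n2_sub_comm]; exact hN n hn m hm hmn
  obtain ⟨y, hyM, hy, -⟩ := h.complete hbs hC2
  have hyc : ∀ m, ∀ a ∈ A m, a * y = y * a := by
    intro m a ha
    rw [← sub_eq_zero]
    apply ts.n2_eq_zero
    refine le_antisymm ?_ (n2_nonneg _)
    have hl : Tendsto (fun k => ‖a‖ * n2 τ (x k - y) + n2 τ (x k - y) * ‖a‖) atTop (𝓝 0) := by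
      simpa using (hy.const_mul ‖a‖).add (hy.mul_const ‖a‖)
    refine ge_of_tendsto hl ?_
    filter_upwards [eventually_ge_atTop m] with k hk
    have e : a * y - y * a = (x k - y) * a - a * (x k - y) := by
      have := hcm k a (hA hk ha)
      rw [sub_mul, mul_sub, this]; abel
    rw [e]
    have h1 := ts.n2_mul_le a (x k - y)
    have h2 := ts.n2_mul_le' (x k - y) a
    have h3 := ts.n2_sub ((x k - y) * a) (a * (x k - y))
    linarith
  obtain ⟨c, rfl⟩ := hc y hyM hyc
  have hτ : c = τ z := by
    have : ‖τ z - c‖ ≤ 0 := by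
      refine ge_of_tendsto hy (Eventually.of_forall fun k => ?_)
      have h1 := ts.norm_tau_le (x k - c • 1)
      rw [map_sub, map_smul, ts.one, (p k).tau_ph ts] at h1
      simpa using h1
    exact (sub_eq_zero.mp (norm_le_zero_iff.mp this)).symm
  rw [← hτ]; exact hy

end AvgCons
end PopaQ

open scoped ComplexOrder
open Filter Topology
namespace PopaQ

section StepE
variable {H : Type*} [NormedAddCommGroup H] [InnerProductSpace ℂ H] [CompleteSpace H]
variable {R : Type*} [CStarAlgebra R] {τ : R →ₗ[ℂ] ℂ}
variable {M N : StarSubalgebra ℂ R} {E : R →ₗ[ℂ] R}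

/-- conditional expectation, extended linearly -/
structure CE (τ : R →ₗ[ℂ] ℂ) (M N : StarSubalgebra ℂ R) (E : R →ₗ[ℂ] R) : Prop where
  le : N ≤ M
  mem : ∀ x ∈ M, E x ∈ N
  fix : ∀ x ∈ N, E x = x
  left : ∀ a ∈ N, ∀ x ∈ M, E (a * x) = a * E x
  right : ∀ a ∈ N, ∀ x ∈ M, E (x * a) = E x * a
  tr : ∀ x ∈ M, τ (E x) = τ x

lemma CE.orth (hE : CE τ M N E) {x y : R} (hx : x ∈ M) (hy : y ∈ N) : τ (y * (x - E x)) = 0 := by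
  rw [mul_sub, map_sub, ← hE.left y hy x hx, hE.tr _ (mul_mem (hE.le hy) hx), sub_self]

lemma CE.n2_le (ts : TrSt τ) (hE : CE τ M N E) {x : R} (hx : x ∈ M) : n2 τ (E x) ≤ n2 τ x := by
  have h1 := hE.orth hx (star_mem (hE.mem x hx))
  rw [mul_sub, map_sub, sub_eq_zero] at h1
  have h2 := ts.cs (E x) x
  rw [h1, ts.tau_sq, Complex.norm_real, Real.norm_of_nonneg (sq_nonneg _)] at h2
  rcases (n2_nonneg (τ := τ) (E x)).eq_or_lt with h0 | h0
  · rw [← h0]; exact n2_nonneg _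
  · nlinarith

lemma CE.n2_sub_le (ts : TrSt τ) (hE : CE τ M N E) {x y : R} (hx : x ∈ M) (hy : y ∈ N) :
    n2 τ (x - E x) ≤ n2 τ (x - y) := by
  have h1 := hE.orth hx (star_mem (sub_mem (hE.mem x hx) hy))
  have h1' : τ (star (x - E x) * (E x - y)) = 0 := by
    have := congrArg star h1
    rw [← ts.tau_star] at this; simpa using this
  have h2 := ts.cs (x - E x) (x - y)
  have e : x - y = (x - E x) + (E x - y) := by abel
  rw [e, mul_add, map_add, h1', add_zero, ts.tau_sq, Complex.norm_real,
    Real.norm_of_nonneg (sq_nonneg _), ← e] at h2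
  rcases (n2_nonneg (τ := τ) (x - E x)).eq_or_lt with h0 | h0
  · rw [← h0]; exact n2_nonneg _
  · nlinarith

/-- the approximating family is 2-dense -/
def Dn (τ : R →ₗ[ℂ] ℂ) (A : ℕ → StarSubalgebra ℂ R) (M : StarSubalgebra ℂ R) : Prop :=
  ∀ x ∈ M, ∀ ε > 0, ∃ m, ∃ a ∈ A m, n2 τ (a - x) < ε

/-- commuting with -/
def Cm (A : StarSubalgebra ℂ R) (b : R) : Prop := ∀ a ∈ A, a * b = b * a

lemma F_id {An Am : StarSubalgebra ℂ R} (hnm : An ≤ Am) (ts : TrSt τ) {d : ℕ} {e : Fin d → R}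
    (he : IsONB τ An e) (T : R →ₗ[ℂ] R) (hT : ∀ b ∈ Am, Cm An b → ∀ x, T (b * x) = b * T x)
    (p : AvD Am) {x : R} (hx : x ∈ An) :
    (∑ i, ∑ j, e i * p.ph (star (e i) * e j) * star (e j)) * T x
    = ∑ i, ∑ j, e i * (star (e j) * x) * p.av
      ((LinearMap.mulLeft ℂ (star (e i))).comp (T.comp (LinearMap.mulLeft ℂ (e j)))) 1 := by
  have hQ : ∀ y ∈ Am, (∑ j, e j * y * star (e j)) ∈ Am := fun y hy =>
    sum_mem fun j _ => mul_mem (mul_mem (hnm (he.mem j)) hy) (star_mem (hnm (he.mem j)))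
  have key : ∑ k, (p.w k : ℂ) • ((∑ i, e i * p.u k * star (e i)) *
      T ((∑ j, e j * star (p.u k) * star (e j)) * x))
      = (∑ i, ∑ j, e i * p.ph (star (e i) * e j) * star (e j)) * T x := by
    have e1 : ∀ k, T ((∑ j, e j * star (p.u k) * star (e j)) * x)
        = (∑ j, e j * star (p.u k) * star (e j)) * T x := fun k =>
      hT _ (hQ _ (star_mem (p.is.mem k))) (fun a ha => he.comm ts ha _) x
    simp only [e1, ← mul_assoc, ← smul_mul_assoc]
    rw [← Finset.sum_mul]
    congr 1
    simp only [p.ph_apply, Finset.sum_mul, Finset.mul_sum, Finset.smul_sum]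
    conv_rhs => rw [Finset.sum_comm]
    rw [Finset.sum_comm]
    refine Finset.sum_congr rfl fun i _ => ?_
    rw [Finset.sum_comm]
    refine Finset.sum_congr rfl fun j _ => Finset.sum_congr rfl fun k _ => ?_
    simp only [mul_smul_comm, smul_mul_assoc, mul_assoc]
  rw [← key]
  have e2 : ∀ i j, e i * (star (e j) * x) * p.av
      ((LinearMap.mulLeft ℂ (star (e i))).comp (T.comp (LinearMap.mulLeft ℂ (e j)))) 1
      = e i * p.av
      ((LinearMap.mulLeft ℂ (star (e i))).comp (T.comp (LinearMap.mulLeft ℂ (e j))))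
        (star (e j) * x) := fun i j => by
    rw [mul_assoc, ← p.av_mul _ (hnm (mul_mem (star_mem (he.mem j)) hx)), mul_one]
  simp only [e2]
  simp only [p.av_apply, Finset.sum_mul, Finset.mul_sum, Finset.smul_sum, map_sum]
  conv_rhs => rw [Finset.sum_comm]
  rw [Finset.sum_comm]
  refine Finset.sum_congr rfl fun i _ => ?_
  rw [Finset.sum_comm]
  refine Finset.sum_congr rfl fun j _ => Finset.sum_congr rfl fun k _ => ?_
  simp only [LinearMap.comp_apply, LinearMap.mulLeft_apply, mul_smul_comm, mul_assoc]

variable [PartialOrder R] [StarOrderedRing R]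
variable {ω : Ultrafilter ℕ} {π : R →⋆ₐ[ℂ] (H →L[ℂ] H)} {lim : (ℕ → R) → R}
variable {A : ℕ → StarSubalgebra ℂ R}

lemma UC.ev (h : UC ω π τ M lim) (m : ℕ) : ∀ᶠ n in (ω : Filter ℕ), m ≤ n :=
  h.le_cofinite (Nat.cofinite_eq_atTop ▸ eventually_ge_atTop m)

/-- a bounded sequence asymptotically commuting with the family is central -/
lemma UC.central (h : UC ω π τ M lim) (hA : Monotone A) (hAM : ∀ m, A m ≤ M) (hD : Dn τ A M)
    {b : ℕ → R} (hb : BS M b) (hc : ∀ m, ∀ᶠ n in (ω : Filter ℕ), Cm (A m) (b n))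
    {y : R} (hy : y ∈ M) : y * lim b = lim b * y := by
  have ts := h.ts
  obtain ⟨K, hK⟩ := hb.2
  have hK0 : 0 ≤ K := (norm_nonneg _).trans (hK 0)
  have hyb := BS.const hy
  have e1 : lim (fun n => y * b n - b n * y) = y * lim b - lim b * y := by
    rw [h.sub (hyb.mul hb) (hb.mul hyb), h.mul _ _ hyb hb, h.mul _ _ hb hyb, h.diag y hy]
  rw [← sub_eq_zero, ← e1, h.eq_zero _ ((hyb.mul hb).sub (hb.mul hyb))]
  rw [Metric.tendsto_nhds]
  intro ε hε
  obtain ⟨m, a, ha, hay⟩ := hD y hy (ε / (2 * (K + 1))) (by positivity)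
  filter_upwards [hc m] with n hn
  rw [Real.dist_eq, sub_zero, abs_of_nonneg (n2_nonneg _)]
  have e2 : y * b n - b n * y = b n * (a - y) - (a - y) * b n := by
    have := hn a ha
    rw [mul_sub, sub_mul, this]; abel
  rw [e2]
  have h1 := ts.n2_mul_le (b n) (a - y)
  have h2 := ts.n2_mul_le' (a - y) (b n)
  have h3 := ts.n2_sub (b n * (a - y)) ((a - y) * b n)
  have h4 : n2 τ (a - y) * (2 * (K + 1)) < ε := (lt_div_iff₀ (by positivity)).mp hay
  have h5 : ‖b n‖ * n2 τ (a - y) ≤ K * n2 τ (a - y) :=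
    mul_le_mul_of_nonneg_right (hK n) (n2_nonneg _)
  nlinarith [n2_nonneg (τ := τ) (a - y)]

lemma UC.near (h : UC ω π τ M lim) (hA : Monotone A) (hAM : ∀ m, A m ≤ M) (hD : Dn τ A M)
    (hE : CE τ M N E)
    (hcs : ∀ b, BS M b → (∀ y ∈ M, y * lim b = lim b * y) → ∃ c, BS N c ∧ lim c = lim b) :
    ∀ ε > 0, ∃ n, ∀ b ∈ M, Cm (A n) b → ‖b‖ ≤ 1 → n2 τ (b - E b) ≤ ε := by
  have ts := h.ts
  by_contra hcon
  push Not at hcon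
  obtain ⟨ε, hε, hcon⟩ := hcon
  choose b hbM hbc hb1 hbE using hcon
  have hbs : BS M b := ⟨hbM, 1, hb1⟩
  obtain ⟨c, hcN, hcl⟩ := hcs b hbs fun y hy => h.central hA hAM hD hbs (fun m => by
    filter_upwards [h.ev m] with n hn
    exact fun a ha => hbc n a (hA hn ha)) hy
  have hcM : BS M c := ⟨fun n => hE.le (hcN.1 n), hcN.2⟩
  have h0 : lim (fun n => b n - c n) = 0 := by rw [h.sub hbs hcM, hcl, sub_self]
  rw [h.eq_zero _ (hbs.sub hcM)] at h0
  obtain ⟨n, hn⟩ := (h0.eventually (gt_mem_nhds hε)).exists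
  exact absurd ((hE.n2_sub_le ts (hbM n) (hcN.1 n)).trans_lt hn) (not_lt.mpr (hbE n).le)

end StepE
end PopaQ

open scoped ComplexOrder
open Filter Topology
namespace PopaQ

section StepF
variable {H : Type*} [NormedAddCommGroup H] [InnerProductSpace ℂ H] [CompleteSpace H]
variable {R : Type*} [CStarAlgebra R] {τ : R →ₗ[ℂ] ℂ}
variable {M N : StarSubalgebra ℂ R} {E : R →ₗ[ℂ] R}

lemma fd_of_le {B A : StarSubalgebra ℂ R} (hBA : B ≤ A) [FiniteDimensional ℂ A] :
    FiniteDimensional ℂ B :=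
  FiniteDimensional.of_injective (StarSubalgebra.inclusion hBA : B →⋆ₐ[ℂ] A).toAlgHom.toLinearMap
    (fun x y hxy => Subtype.ext (congrArg (Subtype.val : A → R) hxy))

/-- relative commutant -/
noncomputable def rc (A B : StarSubalgebra ℂ R) : StarSubalgebra ℂ R :=
  B ⊓ StarSubalgebra.centralizer ℂ (A : Set R)

lemma mem_rc {A B : StarSubalgebra ℂ R} {b : R} : b ∈ rc A B ↔ b ∈ B ∧ Cm A b := by
  unfold rc
  rw [StarSubalgebra.mem_inf, StarSubalgebra.mem_centralizer_iff]
  constructor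
  · rintro ⟨h1, h2⟩; exact ⟨h1, fun a ha => (h2 a ha).1⟩
  · rintro ⟨h1, h2⟩; exact ⟨h1, fun a ha => ⟨h2 a ha, h2 _ (star_mem ha)⟩⟩

lemma rc_le {A B : StarSubalgebra ℂ R} : rc A B ≤ B := fun _ hb => (mem_rc.mp hb).1

variable [PartialOrder R] [StarOrderedRing R]
variable {ω : Ultrafilter ℕ} {π : R →⋆ₐ[ℂ] (H →L[ℂ] H)} {lim : (ℕ → R) → R}
variable {A C : ℕ → StarSubalgebra ℂ R}

lemma asy1 (ts : TrSt τ) (hA : Monotone A) (hAM : ∀ m, A m ≤ M) (hD : Dn τ A M) (hNM : N ≤ M)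
    {G : ℕ → R →ₗ[ℂ] R} {K : ℝ} (hK : 0 ≤ K) (hG : ∀ m, ∀ x ∈ M, n2 τ (G m x) ≤ K * n2 τ x)
    (hGl : ∀ m, ∀ a ∈ A m, G m a = a * G m 1) (hGr : ∀ m, ∀ y ∈ N, G m y = G m 1 * y)
    {y z : R} (hy : y ∈ N) :
    Tendsto (fun m => τ (z * (G m 1 * y - y * G m 1))) atTop (𝓝 0) := by
  rw [Metric.tendsto_nhds]
  intro δ hδ
  obtain ⟨p, a, ha, hay⟩ := hD y (hNM hy) (δ / (2 * ‖z‖ * K + 1)) (by positivity)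
  filter_upwards [eventually_ge_atTop p] with m hm
  rw [dist_zero_right]
  have e1 : z * (G m 1 * y - y * G m 1) = z * G m (y - a) + z * (a - y) * G m 1 := by
    rw [map_sub, hGl m a (hA hm ha), hGr m y hy]; noncomm_ring
  have hyaM : y - a ∈ M := sub_mem (hNM hy) (hAM p ha)
  have h1 : ‖τ (z * G m (y - a))‖ ≤ ‖z‖ * (K * n2 τ (a - y)) := by
    refine (ts.cs' _ _).trans ?_
    rw [ts.n2_sub_comm a y]
    exact mul_le_mul (ts.n2_le_norm z) (hG m _ hyaM) (n2_nonneg _) (norm_nonneg _)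
  have h2 : ‖τ (z * (a - y) * G m 1)‖ ≤ ‖z‖ * n2 τ (a - y) * K := by
    refine (ts.cs' _ _).trans ?_
    refine mul_le_mul (ts.n2_mul_le z _) ?_ (n2_nonneg _) (mul_nonneg (norm_nonneg _) (n2_nonneg _))
    have := hG m 1 (one_mem _)
    rwa [ts.n2_one, mul_one] at this
  rw [e1, map_add]
  have h3 := norm_add_le (τ (z * G m (y - a))) (τ (z * (a - y) * G m 1))
  have h4 : n2 τ (a - y) * (2 * ‖z‖ * K + 1) < δ := (lt_div_iff₀ (by positivity)).mp hay
  nlinarith [n2_nonneg (τ := τ) (a - y)]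

lemma UC.asy2 (h : UC ω π τ M lim) (hA : Monotone A) (hAM : ∀ m, A m ≤ M) (hD : Dn τ A M)
    (hNM : N ≤ M) (hC : Monotone C) (hCN : ∀ m, C m ≤ N) (q : ∀ m, AvD (C m))
    (hcC : ∀ x ∈ M, (∀ m, ∀ a ∈ C m, a * x = x * a) → ∃ c : ℂ, x = c • 1)
    {G : ℕ → R →ₗ[ℂ] R} {K : ℝ} (hK : 0 ≤ K) (hG : ∀ m, ∀ x ∈ M, n2 τ (G m x) ≤ K * n2 τ x)
    (hGl : ∀ m, ∀ a ∈ A m, G m a = a * G m 1) (hGr : ∀ m, ∀ y ∈ N, G m y = G m 1 * y)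
    {z : R} (hz : z ∈ M) :
    Tendsto (fun m => τ (z * G m 1) - τ z * τ (G m 1)) atTop (𝓝 0) := by
  have ts := h.ts
  have hph := h.ph_tendsto hC (fun m => (hCN m).trans hNM) q hcC hz
  rw [Metric.tendsto_nhds]
  intro δ hδ
  obtain ⟨p, hp⟩ := (hph.eventually (gt_mem_nhds (show 0 < δ / (2 * (K + 1)) by positivity))).exists
  have hlim : Tendsto (fun m => ∑ k, ((q p).w k : ℂ) * τ (((q p).u k * z) *
      (G m 1 * star ((q p).u k) - star ((q p).u k) * G m 1))) atTop (𝓝 0) := by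
    have := tendsto_finsetSum (Finset.univ : Finset (Fin (q p).n)) (fun k _ =>
      (asy1 ts hA hAM hD hNM hK hG hGl hGr (z := (q p).u k * z)
        (star_mem (hCN p ((q p).is.mem k)))).const_mul ((q p).w k : ℂ))
    simpa using this
  have e1 : ∀ g, ∑ k, ((q p).w k : ℂ) * τ (((q p).u k * z) *
      (g * star ((q p).u k) - star ((q p).u k) * g)) = τ (z * g) - τ ((q p).ph z * g) := by
    intro g
    rw [(q p).ph_apply, Finset.sum_mul, map_sum]
    have : τ (z * g) = ∑ k, ((q p).w k : ℂ) * τ (z * g) := by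
      rw [← Finset.sum_mul, (q p).wsum, one_mul]
    rw [this, ← Finset.sum_sub_distrib]
    refine Finset.sum_congr rfl fun k _ => ?_
    rw [smul_mul_assoc, map_smul, smul_eq_mul, ← mul_sub, mul_sub, map_sub]
    congr 2
    · rw [mul_assoc, ts.comm, mul_assoc, mul_assoc, (q p).is.l, mul_one]
    · rw [mul_assoc, mul_assoc, mul_assoc]
  rw [Metric.tendsto_nhds] at hlim
  filter_upwards [hlim (δ / 2) (by positivity)] with m hm
  rw [dist_zero_right] at hm ⊢
  rw [e1] at hm
  have h1 : ‖τ (((q p).ph z - τ z • 1) * G m 1)‖ ≤ δ / (2 * (K + 1)) * K := by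
    refine (ts.cs' _ _).trans ?_
    refine mul_le_mul hp.le ?_ (n2_nonneg _) (by positivity)
    have := hG m 1 (one_mem _)
    rwa [ts.n2_one, mul_one] at this
  have h2 : δ / (2 * (K + 1)) * K < δ / 2 := by
    rw [div_mul_eq_mul_div, div_lt_div_iff₀ (by positivity) (by positivity)]; nlinarith
  have e2 : τ (z * G m 1) - τ z * τ (G m 1) = (τ (z * G m 1) - τ ((q p).ph z * G m 1))
      + τ (((q p).ph z - τ z • 1) * G m 1) := by
    rw [sub_mul, map_sub, smul_mul_assoc, one_mul, map_smul, smul_eq_mul]; ring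
  rw [e2]
  exact (norm_add_le _ _).trans_lt (by linarith)

lemma UC.H_tendsto (h : UC ω π τ M lim) (hA : Monotone A) (hAM : ∀ m, A m ≤ M) (p : ∀ m, AvD (A m))
    (hcA : ∀ x ∈ M, (∀ m, ∀ a ∈ A m, a * x = x * a) → ∃ c : ℂ, x = c • 1) {d : ℕ} {e : Fin d → R}
    (he : ∀ i, e i ∈ M) {x : R} (hx : x ∈ M) :
    Tendsto (fun m => n2 τ ((∑ i, ∑ j, e i * (p m).ph (star (e i) * x * e j) * star (e j))
      - ∑ i, ∑ j, τ (star (e i) * x * e j) • (e i * star (e j)))) atTop (𝓝 0) := by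
  have ts := h.ts
  have hl : Tendsto (fun m => ∑ i, ∑ j, ‖e i‖ * n2 τ ((p m).ph (star (e i) * x * e j)
      - τ (star (e i) * x * e j) • 1) * ‖star (e j)‖) atTop (𝓝 0) := by
    have := tendsto_finsetSum (Finset.univ : Finset (Fin d)) (fun i _ =>
      tendsto_finsetSum (Finset.univ : Finset (Fin d)) (fun j _ =>
      ((h.ph_tendsto hA hAM p hcA (mul_mem (mul_mem (star_mem (he i)) hx) (he j))).const_mul
        ‖e i‖).mul_const ‖star (e j)‖))
    simpa using this
  refine squeeze_zero (fun m => n2_nonneg _) (fun m => ?_) hl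
  have e1 : (∑ i, ∑ j, e i * (p m).ph (star (e i) * x * e j) * star (e j))
      - ∑ i, ∑ j, τ (star (e i) * x * e j) • (e i * star (e j))
      = ∑ i, ∑ j, e i * ((p m).ph (star (e i) * x * e j) - τ (star (e i) * x * e j) • 1)
        * star (e j) := by
    simp only [← Finset.sum_sub_distrib]
    refine Finset.sum_congr rfl fun i _ => Finset.sum_congr rfl fun j _ => ?_
    rw [mul_sub, sub_mul, mul_smul_comm, mul_one, smul_mul_assoc]
  rw [e1]
  refine (ts.n2_sum _ _).trans (Finset.sum_le_sum fun i _ => ?_)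
  refine (ts.n2_sum _ _).trans (Finset.sum_le_sum fun j _ => ?_)
  exact (ts.n2_mul_le' _ _).trans (mul_le_mul_of_nonneg_right (ts.n2_mul_le _ _) (norm_nonneg _))

lemma IsONB.q_eq {A : StarSubalgebra ℂ R} {d : ℕ} {e : Fin d → R} (he : IsONB τ A e) :
    ∑ i, ∑ j, τ (star (e i) * 1 * e j) • (e i * star (e j)) = ∑ i, e i * star (e i) := by
  refine Finset.sum_congr rfl fun i _ => ?_
  simp [he.orth]

theorem UC.coreF (h : UC ω π τ M lim) (hA : Monotone A) (hAM : ∀ m, A m ≤ M) (hD : Dn τ A M)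
    (hfd : ∀ m, FiniteDimensional ℂ (A m))
    (hcA : ∀ x ∈ M, (∀ m, ∀ a ∈ A m, a * x = x * a) → ∃ c : ℂ, x = c • 1)
    (hE : CE τ M N E) (hC : Monotone C) (hCN : ∀ m, C m ≤ N)
    (hfdC : ∀ m, FiniteDimensional ℂ (C m))
    (hcC : ∀ x ∈ M, (∀ m, ∀ a ∈ C m, a * x = x * a) → ∃ c : ℂ, x = c • 1) {ε : ℝ}
    (hε : ∀ b ∈ M, Cm (A 0) b → ‖b‖ ≤ 1 → n2 τ (b - E b) ≤ ε) {x : R} (hx : x ∈ A 0) :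
    n2 τ (E x - x) ≤ ε * (‖x‖ + ‖E x‖ + 2 * ‖x‖) := by
  have ts := h.ts
  have hε0 : 0 ≤ ε := (n2_nonneg _).trans (hε 0 (zero_mem _) (fun a _ => by simp) (by simp))
  have pA : ∀ m, AvD (A m) := fun m => (ts.avg (A m)).some
  have pC : ∀ m, AvD (C m) := fun m => (ts.avg (C m)).some
  have hfdB : ∀ m, FiniteDimensional ℂ (rc (A 0) (A m)) := fun m => fd_of_le rc_le
  have pB : ∀ m, AvD (rc (A 0) (A m)) := fun m => (ts.avg (rc (A 0) (A m))).some
  have hBM : ∀ m, rc (A 0) (A m) ≤ M := fun m => rc_le.trans (hAM m)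
  obtain ⟨T, hTd⟩ : ∃ T : ℕ → R →ₗ[ℂ] R, T = fun m => (pB m).av E := ⟨_, rfl⟩
  have hT1 : ∀ m, ∀ x ∈ M, n2 τ (T m x) ≤ n2 τ x := fun m x hx => by
    have := (pB m).n2_av ts (hBM m) (C := 1) (fun x hx => by
      rw [one_mul]; exact hE.n2_le ts hx) hx
    rw [one_mul] at this; rw [hTd]; exact this
  have hT2 : ∀ m, ∀ x ∈ M, n2 τ (T m x - E x) ≤ ε * (‖x‖ + ‖E x‖) := by
    intro m x hx
    have e1 : T m x - E x = ∑ k, ((pB m).w k : ℂ) • ((pB m).u k *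
        (E (star ((pB m).u k) * x) - star ((pB m).u k) * E x)) := by
      have : E x = ∑ k, ((pB m).w k : ℂ) • E x := by
        rw [← Finset.sum_smul, (pB m).wsum, one_smul]
      conv_lhs => rw [this]
      rw [hTd]; simp only [AvD.av_apply]
      rw [← Finset.sum_sub_distrib]
      refine Finset.sum_congr rfl fun k _ => ?_
      rw [← smul_sub, mul_sub, ← mul_assoc, (pB m).is.r, one_mul]
    rw [e1]
    refine (pB m).n2_sum ts _ _ fun k => ?_
    rw [n2_un_mul _ _ ((pB m).is.l k)]
    obtain ⟨b, hb⟩ : ∃ b, b = star ((pB m).u k) := ⟨_, rfl⟩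
    have hbB := star_mem ((pB m).is.mem k)
    rw [← hb] at hbB ⊢
    have hbM := hBM m hbB
    have hb1 : n2 τ (b - E b) ≤ ε := hε b hbM (mem_rc.mp hbB).2 (by
      rw [hb, norm_star]; exact (pB m).norm_u k)
    have e2 : E (b * x) - b * E x = E ((b - E b) * x) - (b - E b) * E x := by
      rw [sub_mul, map_sub, hE.left _ (hE.mem b hbM) x hx, sub_mul]; abel
    rw [e2]
    have hbEM : b - E b ∈ M := sub_mem hbM (hE.le (hE.mem b hbM))
    have h1 := hE.n2_le ts (mul_mem hbEM hx)
    have h2 := ts.n2_mul_le' (b - E b) x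
    have h3 := ts.n2_mul_le' (b - E b) (E x)
    have h4 := ts.n2_sub (E ((b - E b) * x)) ((b - E b) * E x)
    have h5 := mul_le_mul_of_nonneg_right hb1 (norm_nonneg x)
    have h6 := mul_le_mul_of_nonneg_right hb1 (norm_nonneg (E x))
    linarith
  have hT3 : ∀ m, ∀ b ∈ A m, Cm (A 0) b → ∀ x, T m (b * x) = b * T m x := fun m b hb hbc x => by
    rw [hTd]; exact (pB m).av_mul E (mem_rc.mpr ⟨hb, hbc⟩) x
  have hT4 : ∀ m, ∀ x ∈ M, ∀ y ∈ N, T m (x * y) = T m x * y := fun m x hx y hy => by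
    rw [hTd]; simp only [AvD.av_apply]
    rw [Finset.sum_mul]
    refine Finset.sum_congr rfl fun k _ => ?_
    rw [← mul_assoc, hE.right y hy _ (mul_mem (star_mem (hBM m ((pB m).is.mem k))) hx),
      smul_mul_assoc, mul_assoc]
  have hTM : ∀ m, ∀ x ∈ M, T m x ∈ M := fun m x hx => by
    rw [hTd]; exact (pB m).av_mem (hBM m) (fun y hy => hE.le (hE.mem y hy)) hx
  obtain ⟨d, e, he1, he2, he3⟩ := ts.onb (A 0)
  have he : IsONB τ (A 0) e := ⟨he1, he2, he3⟩
  have heM : ∀ i, e i ∈ M := fun i => hAM 0 (he1 i)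
  obtain ⟨h', hh'A, hh'1, -⟩ := he.inv ts
  obtain ⟨q, hq⟩ : ∃ q, q = ∑ i, e i * star (e i) := ⟨_, rfl⟩
  rw [← hq] at hh'1
  obtain ⟨G, hG⟩ : ∃ G : Fin d → Fin d → ℕ → R →ₗ[ℂ] R, G = fun i j m => (pA m).av
      ((LinearMap.mulLeft ℂ (star (e i))).comp ((T m).comp (LinearMap.mulLeft ℂ (e j)))) := ⟨_, rfl⟩
  have hGb : ∀ i j m, ∀ x ∈ M, n2 τ (G i j m x) ≤ (‖e i‖ * ‖e j‖) * n2 τ x := by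
    intro i j m x hx
    rw [hG]
    refine (pA m).n2_av ts (hAM m) (fun y hy => ?_) hx
    simp only [LinearMap.comp_apply, LinearMap.mulLeft_apply]
    refine (ts.n2_mul_le _ _).trans ?_
    rw [norm_star, mul_assoc]
    refine mul_le_mul_of_nonneg_left ?_ (norm_nonneg _)
    exact (hT1 m _ (mul_mem (heM j) hy)).trans (ts.n2_mul_le _ _)
  have hGl : ∀ i j m, ∀ a ∈ A m, G i j m a = a * G i j m 1 := fun i j m a ha => by
    have := (pA m).av_mul
      ((LinearMap.mulLeft ℂ (star (e i))).comp ((T m).comp (LinearMap.mulLeft ℂ (e j)))) ha 1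
    rw [mul_one] at this
    rw [hG]; exact this
  have hGr : ∀ i j m, ∀ y ∈ N, G i j m y = G i j m 1 * y := fun i j m y hy => by
    rw [hG]; simp only [AvD.av_apply, LinearMap.comp_apply, LinearMap.mulLeft_apply]
    rw [Finset.sum_mul]
    refine Finset.sum_congr rfl fun k _ => ?_
    rw [mul_one, ← mul_assoc (e j),
      hT4 m _ (mul_mem (heM j) (star_mem (hAM m ((pA m).is.mem k)))) y hy, smul_mul_assoc]
    simp only [mul_assoc]
  have hasy : ∀ i j, ∀ z ∈ M, Tendsto (fun m => τ (z * G i j m 1) - τ z * τ (G i j m 1))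
      atTop (𝓝 0) := fun i j z hz =>
    h.asy2 hA hAM hD hE.le hC hCN pC hcC (mul_nonneg (norm_nonneg _) (norm_nonneg _))
      (hGb i j) (hGl i j) (hGr i j) hz
  obtain ⟨Hm, hHm⟩ : ∃ Hm : ℕ → R, Hm = fun m =>
    ∑ i, ∑ j, e i * (pA m).ph (star (e i) * e j) * star (e j) := ⟨_, rfl⟩
  have hHt : Tendsto (fun m => n2 τ (Hm m - q)) atTop (𝓝 0) := by
    have := h.H_tendsto hA hAM pA hcA heM (one_mem M)
    rw [he.q_eq, ← hq] at this
    simpa only [mul_one, hHm] using this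
  have hid : ∀ m, ∀ x ∈ A 0, Hm m * T m x
      = ∑ i, ∑ j, e i * (star (e j) * x) * G i j m 1 := fun m x hx => by
    rw [hHm, hG]; exact F_id (hA (Nat.zero_le m)) ts he (T m) (hT3 m) (pA m) hx
  have hxM := hAM 0 hx
  have D1 : ∀ z ∈ M, Tendsto (fun m => τ (z * (Hm m * T m x)) - τ (x * z * (Hm m * T m 1)))
      atTop (𝓝 0) := by
    intro z hz
    have hh : ∀ i j, Tendsto (fun m => τ (z * (e i * (star (e j) * x)) * G i j m 1)
        - τ (x * z * (e i * (star (e j) * 1)) * G i j m 1)) atTop (𝓝 0) := by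
      intro i j
      have h1 := hasy i j (z * (e i * (star (e j) * x)))
        (mul_mem hz (mul_mem (heM i) (mul_mem (star_mem (heM j)) hxM)))
      have h2 := hasy i j (x * z * (e i * (star (e j) * 1)))
        (mul_mem (mul_mem hxM hz) (mul_mem (heM i) (mul_mem (star_mem (heM j)) (one_mem M))))
      have h3 : τ (z * (e i * (star (e j) * x))) = τ (x * z * (e i * (star (e j) * 1))) := by
        rw [mul_one, mul_assoc x, ts.comm x]; simp only [mul_assoc]
      have h4 := h1.sub h2
      rw [sub_zero] at h4
      refine h4.congr fun m => ?_
      rw [h3]; ring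
    have := tendsto_finsetSum (Finset.univ : Finset (Fin d)) (fun i _ =>
      tendsto_finsetSum (Finset.univ : Finset (Fin d)) (fun j _ => hh i j))
    simp only [Finset.sum_const_zero] at this
    refine this.congr fun m => ?_
    rw [hid m x hx, hid m 1 (one_mem _)]
    simp only [Finset.mul_sum, map_sum, ← Finset.sum_sub_distrib, ← mul_assoc]
  have D2a : ∀ z y, y ∈ M → Tendsto (fun m => τ (z * (q * T m y)) - τ (z * (Hm m * T m y)))
      atTop (𝓝 0) := by
    intro z y hy
    have hl : Tendsto (fun m => ‖z‖ * n2 τ (Hm m - q) * n2 τ y) atTop (𝓝 0) := by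
      simpa using (hHt.const_mul ‖z‖).mul_const (n2 τ y)
    refine squeeze_zero_norm (fun m => ?_) hl
    rw [← map_sub, ← mul_sub, ← sub_mul, ← mul_assoc]
    refine (ts.cs' _ _).trans (mul_le_mul ?_ (hT1 m y hy) (n2_nonneg _)
      (mul_nonneg (norm_nonneg _) (n2_nonneg _)))
    rw [ts.n2_sub_comm (Hm m)]
    exact ts.n2_mul_le _ _
  have D3 : ∀ z ∈ M, Tendsto (fun m => τ (z * T m x) - τ (x * z * T m 1)) atTop (𝓝 0) := by
    intro z hz
    have h1 := D1 (z * h') (mul_mem hz (hAM 0 hh'A))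
    have h2 := D2a (z * h') x hxM
    have h3 := D2a (x * (z * h')) 1 (one_mem _)
    have h4 := (h1.add h2).sub h3
    simp only [add_zero, sub_zero] at h4
    refine h4.congr fun m => ?_
    have e1 : ∀ s t, s * h' * (q * t) = s * t := fun s t => by
      rw [mul_assoc, ← mul_assoc h', hh'1, one_mul]
    rw [← mul_assoc x z h', e1, e1]; ring
  obtain ⟨z, hz⟩ : ∃ z, z = star (E x - x) := ⟨_, rfl⟩
  have hzM : z ∈ M := hz ▸ star_mem (sub_mem (hE.le (hE.mem x hxM)) hxM)
  have hfin : ‖τ (z * (E x - x))‖ ≤ n2 τ z * (ε * (‖x‖ + ‖E x‖ + 2 * ‖x‖)) := by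
    have hl := ((D3 z hzM).norm).add_const (n2 τ z * (ε * (‖x‖ + ‖E x‖ + 2 * ‖x‖)))
    rw [norm_zero, zero_add] at hl
    refine ge_of_tendsto hl (Eventually.of_forall fun m => ?_)
    have e1 : τ (z * (E x - x)) = (τ (z * T m x) - τ (x * z * T m 1)) - τ (z * (T m x - E x))
        + τ (x * z * (T m 1 - E 1)) := by
      rw [hE.fix 1 (one_mem _)]
      simp only [mul_sub, map_sub, mul_one]
      rw [ts.comm x z]; ring
    have h1 : ‖τ (z * (T m x - E x))‖ ≤ n2 τ z * (ε * (‖x‖ + ‖E x‖)) :=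
      (ts.cs' _ _).trans (mul_le_mul_of_nonneg_left (hT2 m x hxM) (n2_nonneg _))
    have hn1 : ‖(1 : R)‖ ≤ 1 := norm_le_one_of_un (by simp)
    have h2 : ‖τ (x * z * (T m 1 - E 1))‖ ≤ (‖x‖ * n2 τ z) * (ε * 2) := by
      refine (ts.cs' _ _).trans (mul_le_mul (ts.n2_mul_le _ _) ?_ (n2_nonneg _)
        (mul_nonneg (norm_nonneg _) (n2_nonneg _)))
      refine (hT2 m 1 (one_mem _)).trans (mul_le_mul_of_nonneg_left ?_ hε0)
      rw [hE.fix 1 (one_mem _)]; linarith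
    rw [e1]
    refine (norm_add_le _ _).trans ?_
    have h3 := norm_sub_le (τ (z * T m x) - τ (x * z * T m 1)) (τ (z * (T m x - E x)))
    linarith
  have hzn : n2 τ z = n2 τ (E x - x) := by rw [hz, ts.n2_star]
  rw [hzn, hz, ts.tau_sq, Complex.norm_real, Real.norm_of_nonneg (sq_nonneg _)] at hfin
  rcases (n2_nonneg (τ := τ) (E x - x)).eq_or_lt with h0 | h0
  · rw [← h0]; positivity
  · nlinarith

theorem UC.fixA (h : UC ω π τ M lim) (hA : Monotone A) (hAM : ∀ m, A m ≤ M) (hD : Dn τ A M)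
    (hfd : ∀ m, FiniteDimensional ℂ (A m))
    (hcA : ∀ x ∈ M, (∀ m, ∀ a ∈ A m, a * x = x * a) → ∃ c : ℂ, x = c • 1)
    (hE : CE τ M N E) (hC : Monotone C) (hCN : ∀ m, C m ≤ N)
    (hfdC : ∀ m, FiniteDimensional ℂ (C m))
    (hcC : ∀ x ∈ M, (∀ m, ∀ a ∈ C m, a * x = x * a) → ∃ c : ℂ, x = c • 1)
    (hcs : ∀ b, BS M b → (∀ y ∈ M, y * lim b = lim b * y) → ∃ c, BS N c ∧ lim c = lim b)
    {p : ℕ} {x : R} (hx : x ∈ A p) : x ∈ N := by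
  have ts := h.ts
  have key : ∀ ε > 0, n2 τ (E x - x) ≤ ε * (‖x‖ + ‖E x‖ + 2 * ‖x‖) := by
    intro ε hε
    obtain ⟨n, hn⟩ := h.near hA hAM hD hE hcs ε hε
    let A' : ℕ → StarSubalgebra ℂ R := fun m => A (n + p + m)
    have hsub : ∀ m, A m ≤ A' m := fun m => hA (by omega)
    refine h.coreF (A := A') (fun i j hij => hA (by omega)) (fun m => hAM _) ?_ (fun m => hfd _)
      ?_ hE hC hCN hfdC hcC (ε := ε) ?_ (hA (by omega : p ≤ n + p + 0) hx)
    · intro y hy δ hδ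
      obtain ⟨m, a, ha, hay⟩ := hD y hy δ hδ
      exact ⟨m, a, hsub m ha, hay⟩
    · intro y hy hyc
      exact hcA y hy fun m a ha => hyc m a (hsub m ha)
    · intro b hb hbc
      exact hn b hb fun a ha => hbc a (hA (by omega : n ≤ n + p + 0) ha)
  have h0 : n2 τ (E x - x) = 0 := by
    refine le_antisymm ?_ (n2_nonneg _)
    refine le_of_forall_pos_le_add fun δ hδ => ?_
    obtain ⟨K, hK⟩ : ∃ K, K = ‖x‖ + ‖E x‖ + 2 * ‖x‖ := ⟨_, rfl⟩
    have hK0 : 0 ≤ K := by rw [hK]; positivity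
    refine (key (δ / (K + 1)) (by positivity)).trans ?_
    rw [← hK, zero_add, div_mul_eq_mul_div, div_le_iff₀ (by positivity)]
    nlinarith
  have h1 := ts.n2_eq_zero h0
  rw [sub_eq_zero] at h1
  rw [← h1]; exact hE.mem x (hAM p hx)

end StepF
end PopaQ

open scoped ComplexOrder
open Filter Topology
namespace PopaQ

section StepI
variable {H : Type*} [NormedAddCommGroup H] [InnerProductSpace ℂ H] [CompleteSpace H]
variable {R : Type*} [CStarAlgebra R] {τ : R →ₗ[ℂ] ℂ}
variable {M : StarSubalgebra ℂ R}

lemma I_id {An Am : StarSubalgebra ℂ R} (hnm : An ≤ Am) (ts : TrSt τ) {d : ℕ} {e : Fin d → R}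
    (he : IsONB τ An e) (p : AvD Am) (s : AvD (rc An Am)) (x : R) :
    (∑ i, ∑ j, e i * p.ph (star (e i) * e j) * star (e j)) * s.ph x
    = ∑ i, ∑ j, e i * p.ph (star (e i) * x * e j) * star (e j) := by
  obtain ⟨y, hy⟩ : ∃ y, y = s.ph x := ⟨_, rfl⟩
  have hyc : ∀ b ∈ rc An Am, b * y = y * b := fun b hb => hy ▸ s.ph_comm hb x
  have hQ : ∀ z ∈ Am, (∑ j, e j * z * star (e j)) ∈ rc An Am := fun z hz =>
    mem_rc.mpr ⟨sum_mem fun j _ => mul_mem (mul_mem (hnm (he.mem j)) hz)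
      (star_mem (hnm (he.mem j))), fun a ha => he.comm ts ha _⟩
  have e0 : ∀ i j, p.ph (star (e i) * x * e j) = p.ph (star (e i) * y * e j) := by
    intro i j
    rw [hy, s.ph_apply, Finset.mul_sum, Finset.sum_mul, map_sum]
    have : ∀ k, p.ph (star (e i) * ((s.w k : ℂ) • (s.u k * x * star (s.u k))) * e j)
        = (s.w k : ℂ) • p.ph (star (e i) * x * e j) := fun k => by
      have hu := mem_rc.mp (s.is.mem k)
      have hu' := mem_rc.mp (star_mem (s.is.mem k))
      rw [mul_smul_comm, smul_mul_assoc, map_smul]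
      congr 1
      have e1 : star (e i) * (s.u k * x * star (s.u k)) * e j
          = s.u k * (star (e i) * x * e j * star (s.u k)) := by
        rw [mul_assoc (star (e i) * x) (e j), hu'.2 _ (he.mem j)]
        have := hu.2 _ (star_mem (he.mem i))
        rw [mul_assoc (s.u k) x, ← mul_assoc (star (e i)), this]
        simp only [mul_assoc]
      rw [e1, p.ph_swap hu.1, mul_assoc _ (star (s.u k)), s.is.l, mul_one]
    simp only [this]
    rw [← Finset.sum_smul, s.wsum, one_smul]
  simp only [e0]
  rw [← hy]
  have key : ∑ k, (p.w k : ℂ) • ((∑ i, e i * p.u k * star (e i)) *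
      (∑ j, e j * star (p.u k) * star (e j)) * y)
      = (∑ i, ∑ j, e i * p.ph (star (e i) * e j) * star (e j)) * y := by
    simp only [← smul_mul_assoc]
    rw [← Finset.sum_mul]
    congr 1
    simp only [p.ph_apply, Finset.sum_mul, Finset.mul_sum, Finset.smul_sum]
    conv_rhs => rw [Finset.sum_comm]
    rw [Finset.sum_comm]
    refine Finset.sum_congr rfl fun i _ => ?_
    rw [Finset.sum_comm]
    refine Finset.sum_congr rfl fun j _ => Finset.sum_congr rfl fun k _ => ?_
    simp only [mul_smul_comm, smul_mul_assoc, mul_assoc]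
  rw [← key]
  have e2 : ∀ k, (∑ i, e i * p.u k * star (e i)) * (∑ j, e j * star (p.u k) * star (e j)) * y
      = (∑ i, e i * p.u k * star (e i)) * (y * ∑ j, e j * star (p.u k) * star (e j)) := fun k => by
    rw [mul_assoc, hyc _ (hQ _ (star_mem (p.is.mem k)))]
  simp only [e2]
  simp only [p.ph_apply, Finset.sum_mul, Finset.mul_sum, Finset.smul_sum]
  conv_rhs => rw [Finset.sum_comm]
  rw [Finset.sum_comm]
  refine Finset.sum_congr rfl fun i _ => ?_
  rw [Finset.sum_comm]
  refine Finset.sum_congr rfl fun j _ => Finset.sum_congr rfl fun k _ => ?_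
  simp only [mul_smul_comm, smul_mul_assoc, mul_assoc]

variable [PartialOrder R] [StarOrderedRing R]
variable {ω : Ultrafilter ℕ} {π : R →⋆ₐ[ℂ] (H →L[ℂ] H)} {lim : (ℕ → R) → R}
variable {A : ℕ → StarSubalgebra ℂ R}

lemma UC.I_near (h : UC ω π τ M lim) (hA : Monotone A) (hAM : ∀ m, A m ≤ M)
    (hfd : ∀ m, FiniteDimensional ℂ (A m))
    (hcA : ∀ x ∈ M, (∀ m, ∀ a ∈ A m, a * x = x * a) → ∃ c : ℂ, x = c • 1) (k : ℕ) :
    ∃ L : R →ₗ[ℂ] R, (∀ xs, BS M xs → Tendsto (fun n => L (xs n)) ω (𝓝 (L (lim xs)))) ∧ (∀ x, L x ∈ A k) ∧ ∀ x ∈ M, ∀ ε : ℝ,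
      (∀ b ∈ M, Cm (A k) b → star b * b = 1 → n2 τ (b * x - x * b) ≤ ε) → n2 τ (x - L x) ≤ ε := by
  have ts := h.ts
  have pA : ∀ m, AvD (A m) := fun m => (ts.avg (A m)).some
  have hfdB : ∀ m, FiniteDimensional ℂ (rc (A k) (A m)) := fun m => fd_of_le rc_le
  have pB : ∀ m, AvD (rc (A k) (A m)) := fun m => (ts.avg (rc (A k) (A m))).some
  have hBM : ∀ m, rc (A k) (A m) ≤ M := fun m => rc_le.trans (hAM m)
  obtain ⟨d, e, he1, he2, he3⟩ := ts.onb (A k)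
  have he : IsONB τ (A k) e := ⟨he1, he2, he3⟩
  have heM : ∀ i, e i ∈ M := fun i => hAM k (he1 i)
  obtain ⟨h', hh'A, hh'1, -⟩ := he.inv ts
  obtain ⟨q, hq⟩ : ∃ q, q = ∑ i, e i * star (e i) := ⟨_, rfl⟩
  rw [← hq] at hh'1
  obtain ⟨L, hL⟩ : ∃ L : R →ₗ[ℂ] R, ∀ x, L x
      = h' * ∑ i, ∑ j, τ (star (e i) * x * e j) • (e i * star (e j)) := by
    refine ⟨(LinearMap.mulLeft ℂ h').comp (∑ i, ∑ j,
      (τ.comp ((LinearMap.mulRight ℂ (e j)).comp (LinearMap.mulLeft ℂ (star (e i))))).smulRight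
        (e i * star (e j))), fun x => ?_⟩
    simp only [LinearMap.comp_apply, LinearMap.mulLeft_apply, LinearMap.sum_apply,
      LinearMap.smulRight_apply, LinearMap.mulRight_apply]
  refine ⟨L, ?_, ?_, ?_⟩
  · intro xs hxs
    simp only [hL]
    refine Tendsto.const_mul _ (tendsto_finsetSum _ fun i _ => tendsto_finsetSum _ fun j _ => ?_)
    refine Tendsto.smul_const ?_ _
    have h1 := (BS.const (star_mem (heM i))).mul hxs
    have h2 := h.tr _ (h1.mul (BS.const (heM j)))
    rwa [h.mul _ _ h1 (BS.const (heM j)), h.mul _ _ (BS.const (star_mem (heM i))) hxs,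
      h.diag _ (heM j), h.diag _ (star_mem (heM i))] at h2
  · intro x
    rw [hL]
    exact mul_mem hh'A (sum_mem fun i _ => sum_mem fun j _ =>
      (A k).smul_mem (mul_mem (he1 i) (star_mem (he1 j))) _)
  · intro x hx ε hε
    have t1 := h.H_tendsto hA hAM pA hcA heM hx
    have t2 := h.H_tendsto hA hAM pA hcA heM (one_mem M)
    rw [he.q_eq, ← hq] at t2
    simp only [mul_one] at t2
    have t3 := ((t2.const_mul (‖h'‖ * ‖x‖)).add (t1.const_mul ‖h'‖)).const_add ε
    simp only [mul_zero, add_zero] at t3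
    refine ge_of_tendsto t3 ?_
    filter_upwards [eventually_ge_atTop k] with m hm
    have hid := I_id (hA hm) ts he (pA m) (pB m) x
    obtain ⟨y, hy⟩ : ∃ y, y = (pB m).ph x := ⟨_, rfl⟩
    obtain ⟨Hm, hHm⟩ : ∃ z, z = ∑ i, ∑ j, e i * (pA m).ph (star (e i) * e j) * star (e j) := ⟨_, rfl⟩
    obtain ⟨G, hG⟩ : ∃ z, z = ∑ i, ∑ j, e i * (pA m).ph (star (e i) * x * e j) * star (e j) :=
      ⟨_, rfl⟩
    obtain ⟨S, hS⟩ : ∃ S, S = ∑ i, ∑ j, τ (star (e i) * x * e j) • (e i * star (e j)) := ⟨_, rfl⟩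
    rw [← hy, ← hHm, ← hG] at hid
    rw [← hHm, ← hG, ← hS]
    have s1 : n2 τ (x - y) ≤ ε := by
      have : x - y = ∑ i, ((pB m).w i : ℂ) • (x - (pB m).u i * x * star ((pB m).u i)) := by
        simp only [smul_sub]
        rw [Finset.sum_sub_distrib, ← Finset.sum_smul, (pB m).wsum, one_smul, hy, (pB m).ph_apply]
      rw [this]
      refine (pB m).n2_sum ts _ _ fun i => ?_
      rw [← ts.n2_mul_un ((pB m).u i) _ ((pB m).is.r i), sub_mul, mul_assoc _ (star _),
        (pB m).is.l, mul_one, ts.n2_sub_comm]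
      exact hε _ (hBM m ((pB m).is.mem i)) (mem_rc.mp ((pB m).is.mem i)).2 ((pB m).is.l i)
    have e1 : y - L x = -(h' * (Hm - q) * y) + h' * (G - S) := by
      rw [hL, ← hS, ← hid, mul_sub, sub_mul, hh'1, mul_sub]; noncomm_ring
    have s2 : n2 τ (h' * (Hm - q) * y) ≤ ‖h'‖ * n2 τ (Hm - q) * ‖x‖ := by
      refine (ts.n2_mul_le' _ _).trans (mul_le_mul (ts.n2_mul_le _ _) ?_ (norm_nonneg _)
        (mul_nonneg (norm_nonneg _) (n2_nonneg _)))
      rw [hy]; exact (pB m).norm_ph x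
    have s3 := ts.n2_mul_le h' (G - S)
    have s4 := ts.n2_tri x y (L x)
    have s5 := ts.n2_add (-(h' * (Hm - q) * y)) (h' * (G - S))
    rw [ts.n2_neg, ← e1] at s5
    linarith

lemma UC.I_unif (h : UC ω π τ M lim) (hA : Monotone A) (hAM : ∀ m, A m ≤ M) (hD : Dn τ A M)
    {x : ℕ → R} (hx : BS M x)
    (hxx : ∀ b, BS M b → (∀ y ∈ M, y * lim b = lim b * y) → lim b * lim x = lim x * lim b)
    {ε : ℝ} (hε : 0 < ε) : ∃ k, ∀ᶠ j in (ω : Filter ℕ), ∀ b ∈ M, Cm (A k) b → star b * b = 1 →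
      n2 τ (b * x j - x j * b) ≤ ε := by
  classical
  have ts := h.ts
  by_contra hcon
  push Not at hcon
  have hcon' : ∀ k, ∀ᶠ j in (ω : Filter ℕ), ∃ b ∈ M, Cm (A k) b ∧ star b * b = 1 ∧
      ε < n2 τ (b * x j - x j * b) := hcon
  obtain ⟨P, hP⟩ : ∃ P : ℕ → ℕ → Prop, P = fun j k => ∃ b ∈ M, Cm (A k) b ∧ star b * b = 1 ∧
      ε < n2 τ (b * x j - x j * b) := ⟨_, rfl⟩
  have hb : ∀ j, ∃ b ∈ M, star b * b = 1 ∧ ((∃ m ≤ j, P j m) →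
      Cm (A (Nat.findGreatest (P j) j)) b ∧ ε < n2 τ (b * x j - x j * b)) := by
    intro j
    by_cases hj : ∃ m ≤ j, P j m
    · obtain ⟨m, hm, hPm⟩ := hj
      have := Nat.findGreatest_spec hm hPm
      rw [hP] at this
      obtain ⟨b, hbM, hbc, hb1, hbε⟩ := this
      refine ⟨b, hbM, hb1, fun _ => ⟨?_, hbε⟩⟩
      rw [hP]; exact hbc
    · exact ⟨1, one_mem _, by simp, fun hh => absurd hh hj⟩
  choose b hbM hb1 hbP using hb
  have hbs : BS M b := ⟨hbM, 1, fun n => norm_le_one_of_un (hb1 n)⟩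
  have hPe : ∀ k, ∀ᶠ j in (ω : Filter ℕ), P j k := fun k => by rw [hP]; exact hcon' k
  have hc := hxx b hbs fun y hy => h.central hA hAM hD hbs (fun m => by
    filter_upwards [h.ev m, hPe m] with n hn hPn
    intro a ha
    exact (hbP n ⟨m, hn, hPn⟩).1 a (hA (Nat.le_findGreatest hn hPn) ha)) hy
  have h0 : lim (fun n => b n * x n - x n * b n) = 0 := by
    rw [h.sub (hbs.mul hx) (hx.mul hbs), h.mul _ _ hbs hx, h.mul _ _ hx hbs, hc, sub_self]
  rw [h.eq_zero _ ((hbs.mul hx).sub (hx.mul hbs))] at h0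
  obtain ⟨n, hn, hPn⟩ := ((h0.eventually (gt_mem_nhds hε)).and (hPe 0)).exists
  exact absurd hn (not_lt.mpr (hbP n ⟨0, Nat.zero_le _, hPn⟩).2.le)

theorem UC.factor (h : UC ω π τ M lim) (hA : Monotone A) (hAM : ∀ m, A m ≤ M) (hD : Dn τ A M)
    (hfd : ∀ m, FiniteDimensional ℂ (A m))
    (hcA : ∀ x ∈ M, (∀ m, ∀ a ∈ A m, a * x = x * a) → ∃ c : ℂ, x = c • 1) {x : R}
    (hxc : ∀ y ∈ M, y * x = x * y)
    (hxx : ∀ z, (∀ y ∈ M, y * z = z * y) → z * x = x * z) : ∃ c : ℂ, x = c • 1 := by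
  have ts := h.ts
  have pA : ∀ m, AvD (A m) := fun m => (ts.avg (A m)).some
  obtain ⟨xs, hxs, rfl⟩ := h.surj x
  refine ⟨τ (lim xs), ?_⟩
  rw [← sub_eq_zero]
  apply ts.n2_eq_zero
  refine le_antisymm ?_ (n2_nonneg _)
  refine le_of_forall_pos_le_add fun ε hε => ?_
  obtain ⟨k, hk⟩ := h.I_unif hA hAM hD hxs (fun b hb hbc => hxx _ hbc) (half_pos hε)
  obtain ⟨L, hLc, hLA, hLn⟩ := h.I_near hA hAM hfd hcA k
  obtain ⟨x, hx⟩ : ∃ x, x = lim xs := ⟨_, rfl⟩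
  have hLM : L x ∈ M := hAM k (hLA x)
  have s1 : n2 τ (x - L x) ≤ ε / 2 := by
    have hb := hxs.sub (BS.const hLM)
    have t1 := h.n2_lim hb
    rw [h.sub hxs (BS.const hLM), h.diag _ hLM, ← hx] at t1
    have t2 : Tendsto (fun n => ε / 2 + ‖L (xs n) - L x‖) ω (𝓝 (ε / 2)) := by
      have t3 := (((hLc xs hxs).sub_const (L x)).norm).const_add (ε / 2)
      rwa [hx, sub_self, norm_zero, add_zero, ← hx] at t3
    refine le_of_tendsto_of_tendsto t1 t2 ?_
    filter_upwards [hk] with n hn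
    have u1 := hLn (xs n) (hxs.1 n) _ hn
    have u2 := ts.n2_tri (xs n) (L (xs n)) (L x)
    have u3 := ts.n2_le_norm (L (xs n) - L x)
    linarith
  have s2 : n2 τ (x - τ (L x) • 1) ≤ ε / 2 := by
    have t1 := (h.ph_tendsto hA hAM pA hcA hLM).const_add (ε / 2)
    rw [add_zero] at t1
    refine ge_of_tendsto t1 (Eventually.of_forall fun m => ?_)
    have u1 : (pA m).ph x = x := (pA m).ph_fix fun a ha => hx ▸ hxc a (hAM m ha)
    have u2 := (pA m).n2_ph ts (x - L x)
    rw [map_sub, u1] at u2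
    have u3 := ts.n2_tri x ((pA m).ph (L x)) (τ (L x) • 1)
    linarith
  have s3 : n2 τ (τ (L x) • (1 : R) - τ x • 1) ≤ ε / 2 := by
    rw [← sub_smul, ts.n2_smul, ts.n2_one, mul_one, ← map_sub]
    refine (ts.norm_tau_le _).trans ?_
    rw [ts.n2_sub_comm]; exact s1
  have s4 := ts.n2_tri x (τ (L x) • 1) (τ x • 1)
  rw [← hx]
  linarith

end StepI
end PopaQ

open scoped ComplexOrder
open Filter Topology
namespace PopaQ

section StepJ
variable {H : Type*} [NormedAddCommGroup H] [InnerProductSpace ℂ H] [CompleteSpace H]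
variable {R : Type*} [CStarAlgebra R] {τ : R →ₗ[ℂ] ℂ}
variable {M : StarSubalgebra ℂ R}

lemma IsONB.finrank_le {A : StarSubalgebra ℂ R} {d : ℕ} {e : Fin d → R} (he : IsONB τ A e) :
    Module.finrank ℂ A ≤ d := by
  have h1 : Subalgebra.toSubmodule A.toSubalgebra ≤ Submodule.span ℂ (Set.range e) := fun a ha => by
    rw [he.ex a ha]
    exact sum_mem fun i _ => Submodule.smul_mem _ _ (Submodule.subset_span ⟨i, rfl⟩)
  have h2 : FiniteDimensional ℂ (Submodule.span ℂ (Set.range e)) :=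
    FiniteDimensional.span_of_finite ℂ (Set.finite_range e)
  have h3 := Submodule.finrank_mono h1
  have h4 := finrank_range_le_card (R := ℂ) e
  rw [Fintype.card_fin] at h4
  exact h3.trans h4

/-- Pythagoras -/
lemma IsONB.pyth (ts : TrSt τ) {A : StarSubalgebra ℂ R} {d : ℕ} {e : Fin d → R} (he : IsONB τ A e)
    {u a : R} (ha : a ∈ A) : n2 τ (u - ∑ i, τ (star (e i) * u) • e i) ^ 2
      = n2 τ u ^ 2 - ∑ i, ‖τ (star (e i) * u)‖ ^ 2 ∧
      n2 τ (u - ∑ i, τ (star (e i) * u) • e i) ≤ n2 τ (u - a) := by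
  obtain ⟨P, hP⟩ : ∃ P, P = ∑ i, τ (star (e i) * u) • e i := ⟨_, rfl⟩
  have hPA : P ∈ A := hP ▸ sum_mem fun i _ => A.smul_mem (he.mem i) _
  have h0 : ∀ i, τ (star (e i) * (u - P)) = 0 := fun i => by
    rw [mul_sub, map_sub, hP, Finset.mul_sum, map_sum]
    simp [he.orth]
  have h1 : ∀ b ∈ A, τ (star b * (u - P)) = 0 := fun b hb => by
    rw [he.ex b hb, star_sum, Finset.sum_mul, map_sum]
    refine Finset.sum_eq_zero fun i _ => ?_
    rw [star_smul, smul_mul_assoc, map_smul, h0, smul_zero]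
  have h2 : ∀ b ∈ A, τ (star (u - P) * b) = 0 := fun b hb => by
    have := congrArg star (h1 b hb)
    rwa [← ts.tau_star, star_mul, star_star, star_zero] at this
  rw [← hP]
  constructor
  · rw [ts.n2_sq, ts.n2_sq]
    have e1 : star (u - P) * (u - P) = star u * u - star P * u - star (u - P) * P := by
      rw [star_sub]; noncomm_ring
    rw [e1, map_sub, map_sub, h2 P hPA, sub_zero, Complex.sub_re]
    congr 1
    conv_lhs => rw [hP]
    rw [star_sum, Finset.sum_mul, map_sum, Complex.re_sum]
    refine Finset.sum_congr rfl fun i _ => ?_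
    rw [star_smul, smul_mul_assoc, map_smul, smul_eq_mul]
    have := Complex.normSq_eq_conj_mul_self (z := τ (star (e i) * u))
    rw [← Complex.normSq_eq_norm_sq]
    exact (congrArg Complex.re this).symm
  · have e2 : star (u - P) * (u - P) = star (u - P) * (u - a) - star (u - P) * (P - a) := by
      noncomm_ring
    have h3 := ts.cs (u - P) (u - a)
    have h4 := ts.tau_sq (u - P)
    rw [e2, map_sub, h2 _ (sub_mem hPA ha), sub_zero] at h4
    rw [h4, Complex.norm_real, Real.norm_of_nonneg (sq_nonneg _)] at h3
    rcases (n2_nonneg (τ := τ) (u - P)).eq_or_lt with h5 | h5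
    · rw [← h5]; exact n2_nonneg _
    · nlinarith

/-- evaluation map -/
noncomputable def tauOne (τ : R →ₗ[ℂ] ℂ) : R →ₗ[ℂ] R := τ.smulRight 1

variable [PartialOrder R] [StarOrderedRing R]
variable {ω : Ultrafilter ℕ} {π : R →⋆ₐ[ℂ] (H →L[ℂ] H)} {lim : (ℕ → R) → R}
variable {A : ℕ → StarSubalgebra ℂ R}

lemma big_dim (ts : TrSt τ) (hA : Monotone A) (hD : Dn τ A M)
    (hfd : ∀ m, FiniteDimensional ℂ (A m)) (hinf : ¬ FiniteDimensional ℂ M) (D : ℕ) :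
    ∃ p, D ≤ Module.finrank ℂ (A p) := by
  by_contra hcon
  push Not at hcon
  have hbd : BddAbove (Set.range fun p => Module.finrank ℂ (A p)) :=
    ⟨D, by rintro _ ⟨p, rfl⟩; exact (hcon p).le⟩
  obtain ⟨p, hp⟩ := Nat.sSup_mem (Set.range_nonempty _) hbd
  have hmax : ∀ m, Module.finrank ℂ (A m) ≤ Module.finrank ℂ (A p) := fun m => by
    have := le_csSup hbd ⟨m, rfl⟩
    rw [← hp] at this; exact this
  have heq : ∀ m, A m ≤ A p := fun m => by
    have h1 : Subalgebra.toSubmodule (A p).toSubalgebra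
        ≤ Subalgebra.toSubmodule (A (max m p)).toSubalgebra := hA (le_max_right m p)
    have : FiniteDimensional ℂ (Subalgebra.toSubmodule (A (max m p)).toSubalgebra) :=
      hfd (max m p)
    have h2 := Submodule.eq_of_le_of_finrank_le h1 (hmax (max m p))
    intro a ha
    have : a ∈ Subalgebra.toSubmodule (A (max m p)).toSubalgebra := hA (le_max_left m p) ha
    rw [← h2] at this; exact this
  obtain ⟨d, e, he1, he2, he3⟩ := ts.onb (A p)
  have he : IsONB τ (A p) e := ⟨he1, he2, he3⟩
  apply hinf
  refine fd_of_le (A := A p) fun x hx => ?_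
  have h0 : n2 τ (x - ∑ i, τ (star (e i) * x) • e i) = 0 := by
    refine le_antisymm (le_of_forall_pos_le_add fun ε hε => ?_) (n2_nonneg _)
    obtain ⟨m, a, ha, hax⟩ := hD x hx ε hε
    have := (he.pyth ts (u := x) (heq m ha)).2
    rw [ts.n2_sub_comm] at hax
    linarith
  have h1 := ts.n2_eq_zero h0
  rw [sub_eq_zero] at h1
  rw [h1]
  exact sum_mem fun i _ => (A p).smul_mem (he1 i) _

lemma avg_tau (ts : TrSt τ) {B : StarSubalgebra ℂ R} (p : AvD B) {g : R} (hg : g ∈ B) :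
    ((∑ k, p.w k * ‖τ (star g * p.u k)‖ ^ 2 : ℝ) : ℂ)
      = τ (p.av (tauOne τ) 1 * (star g * g)) := by
  have h1 := p.av_mul (tauOne τ) hg 1
  rw [mul_one] at h1
  have h2 : τ (star g * p.av (tauOne τ) g) = τ (p.av (tauOne τ) 1 * (star g * g)) := by
    rw [h1, ts.comm (p.av _ 1), mul_assoc]
  rw [← h2, p.av_apply, Finset.mul_sum, map_sum, Complex.ofReal_sum]
  refine Finset.sum_congr rfl fun k _ => ?_
  have h3 : τ (star (p.u k) * g) = star (τ (star g * p.u k)) := by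
    rw [← ts.tau_star, star_mul, star_star]
  rw [tauOne, LinearMap.smulRight_apply, h3, mul_smul_comm, mul_smul_comm, mul_smul_comm, map_smul,
    map_smul, mul_one, smul_eq_mul, smul_eq_mul, Complex.ofReal_mul]
  congr 1
  rw [← Complex.normSq_eq_norm_sq]
  exact Complex.normSq_eq_conj_mul_self

lemma UC.avg_asy (h : UC ω π τ M lim) (hA : Monotone A) (hAM : ∀ m, A m ≤ M) (p : ∀ m, AvD (A m))
    (hcA : ∀ x ∈ M, (∀ m, ∀ a ∈ A m, a * x = x * a) → ∃ c : ℂ, x = c • 1) {z : R} (hz : z ∈ M) :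
    Tendsto (fun m => τ ((p m).av (tauOne τ) 1 * z) - τ z * τ ((p m).av (tauOne τ) 1))
      atTop (𝓝 0) := by
  have ts := h.ts
  refine squeeze_zero_norm (fun m => ?_) (h.ph_tendsto hA hAM p hcA hz)
  obtain ⟨r, hr⟩ : ∃ r, r = (p m).av (tauOne τ) 1 := ⟨_, rfl⟩
  rw [← hr]
  have hrn : n2 τ r ≤ 1 := by
    rw [hr, (p m).av_apply]
    refine (p m).n2_sum ts _ _ fun k => ?_
    rw [n2_un_mul _ _ ((p m).is.l k), tauOne, LinearMap.smulRight_apply, ts.n2_smul, ts.n2_one,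
      mul_one, mul_one]
    refine (ts.norm_tau_le _).trans ((ts.n2_le_norm _).trans ?_)
    rw [norm_star]; exact (p m).norm_u k
  have hrc : ∀ a ∈ A m, a * r = r * a := fun a ha => by
    have h1 := (p m).av_mul (tauOne τ) ha 1
    rw [mul_one, ← hr] at h1
    rw [← h1, hr, (p m).av_apply, (p m).av_apply, Finset.sum_mul]
    have h2 := (p m).is.Rt (LinearMap.mk₂ ℂ (fun s t => τ t • s)
      (by intros; simp) (by intros; exact smul_comm _ _ _) (by intros; simp [add_smul])
      (by intros; simp [mul_smul])) a ha
    simp only [LinearMap.mk₂_apply] at h2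
    have h3 : ∀ k, τ (star ((p m).u k) * a) = τ (a * star ((p m).u k)) := fun k => ts.comm _ _
    simp only [tauOne, LinearMap.smulRight_apply, h3, mul_one, mul_smul_comm, smul_mul_assoc]
    exact h2.symm
  have e1 : τ (r * z) - τ z * τ r = τ (r * ((p m).ph z - τ z • 1)) := by
    rw [mul_sub, map_sub, (p m).tau_mul_ph ts hrc, mul_smul_comm, mul_one, map_smul, smul_eq_mul]
  rw [e1]
  refine (ts.cs' _ _).trans ?_
  nlinarith [n2_nonneg (τ := τ) ((p m).ph z - τ z • 1)]

lemma UC.far (h : UC ω π τ M lim) (hA : Monotone A) (hAM : ∀ m, A m ≤ M) (hD : Dn τ A M)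
    (hfd : ∀ m, FiniteDimensional ℂ (A m))
    (hcA : ∀ x ∈ M, (∀ m, ∀ a ∈ A m, a * x = x * a) → ∃ c : ℂ, x = c • 1)
    (hinf : ¬ FiniteDimensional ℂ M) (n : ℕ) :
    ∃ b ∈ M, Cm (A n) b ∧ star b * b = 1 ∧ 1 / 4 < n2 τ (b - τ b • 1) := by
  have ts := h.ts
  have pA : ∀ m, AvD (A m) := fun m => (ts.avg (A m)).some
  obtain ⟨L, -, hLA, hLn⟩ := h.I_near hA hAM hfd hcA n
  obtain ⟨d, e, he1, he2, he3⟩ := ts.onb (A n)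
  have he : IsONB τ (A n) e := ⟨he1, he2, he3⟩
  obtain ⟨p, hp⟩ := big_dim ts hA hD hfd hinf (2 * d + 1)
  obtain ⟨D, g, hg1, hg2, hg3⟩ := ts.onb (A p)
  have hg : IsONB τ (A p) g := ⟨hg1, hg2, hg3⟩
  have hdD : 2 * d + 1 ≤ D := hp.trans hg.finrank_le
  have key : ∀ {q t : ℕ} {f : Fin t → R}, IsONB τ (A q) f → ∀ᶠ m in atTop,
      |(∑ k, (pA m).w k * ∑ i, ‖τ (star (f i) * (pA m).u k)‖ ^ 2)
        - t * (τ ((pA m).av (tauOne τ) 1)).re| ≤ 1 / 8 := by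
    intro q t f hf
    have t1 := tendsto_finsetSum (Finset.univ : Finset (Fin t)) (fun i _ =>
      h.avg_asy hA hAM pA hcA (mul_mem (star_mem (hAM q (hf.mem i))) (hAM q (hf.mem i))))
    simp only [Finset.sum_const_zero] at t1
    have t2 := t1.norm
    rw [norm_zero] at t2
    filter_upwards [t2.eventually (gt_mem_nhds (show (0 : ℝ) < 1 / 8 by norm_num)),
      eventually_ge_atTop q] with m hm hqm
    refine le_trans ?_ hm.le
    have e1 : ∑ i, (τ ((pA m).av (tauOne τ) 1 * (star (f i) * f i))
          - τ (star (f i) * f i) * τ ((pA m).av (tauOne τ) 1))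
        = ((∑ k, (pA m).w k * ∑ i, ‖τ (star (f i) * (pA m).u k)‖ ^ 2 : ℝ) : ℂ)
          - t * τ ((pA m).av (tauOne τ) 1) := by
      rw [Finset.sum_sub_distrib]
      congr 1
      · simp only [← avg_tau ts (pA m) (hA hqm (hf.mem _))]
        rw [← Complex.ofReal_sum, Finset.sum_comm]
        simp only [Finset.mul_sum]
      · simp [hf.orth]
    rw [e1]
    refine le_trans (le_of_eq ?_) (Complex.abs_re_le_norm _)
    rw [Complex.sub_re, Complex.ofReal_re, ← Complex.ofReal_natCast, Complex.re_ofReal_mul]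
  obtain ⟨m, hm1, hm2⟩ := ((key he).and (key hg)).exists
  have hbes : ∑ k, (pA m).w k * ∑ i, ‖τ (star (g i) * (pA m).u k)‖ ^ 2 ≤ 1 := by
    rw [← (pA m).is.w1]
    refine Finset.sum_le_sum fun k _ => ?_
    refine mul_le_of_le_one_right ((pA m).is.w0 k) ?_
    have h1 := (hg.pyth ts (u := (pA m).u k) (zero_mem _)).1
    have h2 := (ts.n2_le_norm ((pA m).u k)).trans ((pA m).norm_u k)
    nlinarith [n2_nonneg (τ := τ) ((pA m).u k),
      sq_nonneg (n2 τ ((pA m).u k - ∑ i, τ (star (g i) * (pA m).u k) • g i))]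
  obtain ⟨ρ, hρ⟩ : ∃ ρ, ρ = (τ ((pA m).av (tauOne τ) 1)).re := ⟨_, rfl⟩
  rw [← hρ] at hm1 hm2
  have hsm : ∑ k, (pA m).w k * ∑ i, ‖τ (star (e i) * (pA m).u k)‖ ^ 2 < 3 / 4 := by
    have h1 := (abs_le.mp hm1).2
    have h2 := (abs_le.mp hm2).1
    have h3 : (2 * d + 1 : ℝ) ≤ D := by exact_mod_cast hdD
    have h4 : (0 : ℝ) ≤ d := Nat.cast_nonneg _
    rcases le_total ρ 0 with h5 | h5
    · nlinarith
    · nlinarith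
  obtain ⟨k, hk⟩ : ∃ k, ∑ i, ‖τ (star (e i) * (pA m).u k)‖ ^ 2 < 3 / 4 := by
    by_contra hcon
    push Not at hcon
    have : (3 / 4 : ℝ) ≤ ∑ k, (pA m).w k * ∑ i, ‖τ (star (e i) * (pA m).u k)‖ ^ 2 := by
      calc (3 / 4 : ℝ) = ∑ k, (pA m).w k * (3 / 4) := by
            rw [← Finset.sum_mul, (pA m).is.w1, one_mul]
        _ ≤ _ := Finset.sum_le_sum fun k _ =>
            mul_le_mul_of_nonneg_left (hcon k) ((pA m).is.w0 k)
    linarith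
  obtain ⟨u, hu⟩ : ∃ u, u = (pA m).u k := ⟨_, rfl⟩
  have hul : star u * u = 1 := hu ▸ (pA m).is.l k
  have hur : u * star u = 1 := hu ▸ (pA m).is.r k
  have huM : u ∈ M := hu ▸ hAM m ((pA m).is.mem k)
  rw [← hu] at hk
  by_contra hcon
  push Not at hcon
  have h1 := hLn u huM (1 / 2) (fun b hb hbc hbu => by
    have h2 := hcon b hb hbc hbu
    have e1 : b * u - u * b = (b - τ b • 1) * u - u * (b - τ b • 1) := by
      simp only [sub_mul, mul_sub, smul_mul_assoc, mul_smul_comm, one_mul, mul_one]; abel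
    rw [e1]
    refine (ts.n2_sub _ _).trans ?_
    rw [ts.n2_mul_un _ _ hur, n2_un_mul _ _ hul]
    linarith)
  obtain ⟨h3, h4⟩ := he.pyth ts (u := u) (hLA u)
  have h5 : n2 τ u = 1 := by
    have := n2_un_mul (τ := τ) u 1 hul
    rwa [mul_one, ts.n2_one] at this
  rw [h5] at h3
  nlinarith [n2_nonneg (τ := τ) (u - ∑ i, τ (star (e i) * u) • e i)]

theorem UC.infdim (h : UC ω π τ M lim) (hA : Monotone A) (hAM : ∀ m, A m ≤ M) (hD : Dn τ A M)
    (hfd : ∀ m, FiniteDimensional ℂ (A m))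
    (hcA : ∀ x ∈ M, (∀ m, ∀ a ∈ A m, a * x = x * a) → ∃ c : ℂ, x = c • 1)
    (hinf : ¬ FiniteDimensional ℂ M) :
    ¬ FiniteDimensional ℂ (StarSubalgebra.centralizer ℂ (M : Set R)) := by
  intro hfin
  have ts := h.ts
  have pA : ∀ m, AvD (A m) := fun m => (ts.avg (A m)).some
  choose b hbM hbc hbu hbf using h.far hA hAM hD hfd hcA hinf
  obtain ⟨x, hx⟩ : ∃ x : ℕ → R, x = fun n => b n - τ (b n) • 1 := ⟨_, rfl⟩
  have hxM : ∀ n, x n ∈ M := fun n => by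
    rw [hx]; exact sub_mem (hbM n) (M.smul_mem (one_mem _) _)
  have hn1 : ‖(1 : R)‖ ≤ 1 := norm_le_one_of_un (by simp)
  have hxn : ∀ n, ‖x n‖ ≤ 2 := fun n => by
    rw [hx]
    have h1 := norm_le_one_of_un (hbu n)
    have h2 := (ts.norm_tau_le (b n)).trans (ts.n2_le_norm _)
    have h3 := norm_smul_le (τ (b n)) (1 : R)
    have h4 := norm_sub_le (b n) (τ (b n) • 1)
    have h5 : ‖τ (b n)‖ * ‖(1 : R)‖ ≤ 1 * 1 :=
      mul_le_mul (h2.trans h1) hn1 (norm_nonneg _) zero_le_one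
    linarith
  have hxc : ∀ n, Cm (A n) (x n) := fun n a ha => by
    have := hbc n a ha
    rw [hx]; simp only [mul_sub, sub_mul, this, mul_smul_comm, smul_mul_assoc, mul_one, one_mul]
  have hxt : ∀ n, τ (x n) = 0 := fun n => by
    rw [hx]; simp [ts.one]
  have hxa : ∀ a ∈ M, Tendsto (fun n => τ (a * x n)) atTop (𝓝 0) := by
    intro a ha
    have t1 := (h.ph_tendsto hA hAM pA hcA ha).const_mul 2
    rw [mul_zero] at t1
    refine squeeze_zero_norm (fun n => ?_) t1
    have e1 : τ (a * x n) = τ (x n * ((pA n).ph a - τ a • 1)) := by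
      rw [mul_sub, map_sub, (pA n).tau_mul_ph ts (hxc n), mul_smul_comm, mul_one, map_smul, hxt,
        smul_zero, sub_zero, ts.comm]
    rw [e1]
    refine (ts.cs' _ _).trans (mul_le_mul_of_nonneg_right ?_ (n2_nonneg _))
    exact (ts.n2_le_norm _).trans (hxn n)
  obtain ⟨d, z, hz1, hz2, hz3⟩ := ts.onb (StarSubalgebra.centralizer ℂ (M : Set R))
  choose zs hzs hzl using fun i => h.surj (z i)
  have hk : ∀ n : ℕ, ∃ k, n ≤ k ∧ ∀ i, ‖τ (star (zs i n) * x k)‖ ≤ 1 / ((n : ℝ) + 1) := by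
    intro n
    have h1 : ∀ᶠ k in atTop, ∀ i, ‖τ (star (zs i n) * x k)‖ ≤ 1 / ((n : ℝ) + 1) := by
      rw [eventually_all]
      intro i
      have := (hxa _ (star_mem ((hzs i).1 n))).norm
      rw [norm_zero] at this
      filter_upwards [this.eventually (gt_mem_nhds (show (0 : ℝ) < 1 / ((n : ℝ) + 1) by positivity))]
        with k hk using hk.le
    exact ((eventually_ge_atTop n).and h1).exists
  choose k hkn hkz using hk
  have hy : BS M (fun n => x (k n)) := ⟨fun n => hxM _, 2, fun n => hxn _⟩
  have hyc : lim (fun n => x (k n)) ∈ StarSubalgebra.centralizer ℂ (M : Set R) := by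
    have hc : ∀ y ∈ M, y * lim (fun n => x (k n)) = lim (fun n => x (k n)) * y := fun y hyM =>
      h.central hA hAM hD hy (fun m => by
        filter_upwards [h.ev m] with n hn
        exact fun a ha => hxc _ a (hA (hn.trans (hkn n)) ha)) hyM
    rw [StarSubalgebra.mem_centralizer_iff]
    exact fun y hyM => ⟨hc y hyM, hc _ (star_mem hyM)⟩
  have hy0 : lim (fun n => x (k n)) = 0 := by
    rw [hz3 _ hyc]
    refine Finset.sum_eq_zero fun i _ => ?_
    have t1 := h.tr _ ((hzs i).st.mul hy)
    rw [h.mul _ _ (hzs i).st hy, h.lstar _ (hzs i), hzl] at t1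
    have t2 : Tendsto (fun n => τ (star (zs i n) * x (k n))) ω (𝓝 0) := by
      refine squeeze_zero_norm (fun n => hkz n i) ?_
      exact tendsto_one_div_add_atTop_nhds_zero_nat.mono_left h.le_cofinite
    rw [tendsto_nhds_unique t1 t2, zero_smul]
  rw [h.eq_zero _ hy] at hy0
  obtain ⟨n, hn⟩ := (hy0.eventually (gt_mem_nhds (show (0 : ℝ) < 1 / 4 by norm_num))).exists
  have := hbf (k n)
  rw [hx] at hn
  exact absurd hn (not_lt.mpr this.le)

end StepJ
end PopaQ

open scoped ComplexOrder
open Filter Topology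
namespace PopaQ

section Fin
variable {H : Type*} [NormedAddCommGroup H] [InnerProductSpace ℂ H] [CompleteSpace H]

lemma vn_cc (M : VonNeumannAlgebra H) :
    Set.centralizer (Set.centralizer (M : Set (Op H))) = (M : Set (Op H)) :=
  M.centralizer_centralizer

instance closedVN (M : VonNeumannAlgebra H) : IsClosed (M.toStarSubalgebra : Set (Op H)) := by
  have : (M.toStarSubalgebra : Set (Op H)) = (M : Set (Op H)) := rfl
  rw [this, ← vn_cc M]
  exact Set.isClosed_centralizer _

/-- the ambient algebra -/
abbrev RR (Mω : VonNeumannAlgebra H) := ↥(Mω.toStarSubalgebra)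

/-- pull back -/
noncomputable def pb (Mω : VonNeumannAlgebra H) (B : StarSubalgebra ℂ (Op H)) :
    StarSubalgebra ℂ (RR Mω) := B.comap Mω.toStarSubalgebra.subtype

lemma mem_pb {Mω : VonNeumannAlgebra H} {B : StarSubalgebra ℂ (Op H)} {x : RR Mω} :
    x ∈ pb Mω B ↔ (x : Op H) ∈ B := Iff.rfl

lemma fd_of_FinDim {Mω : VonNeumannAlgebra H} {B : StarSubalgebra ℂ (RR Mω)} {S : Set (Op H)}
    (hS : FinDim S) (hB : ∀ x ∈ B, (x : Op H) ∈ S) : FiniteDimensional ℂ B := by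
  obtain ⟨s, hs⟩ := hS
  have : FiniteDimensional ℂ (Submodule.span ℂ (s : Set (Op H))) :=
    FiniteDimensional.span_finset ℂ s
  let f : B →ₗ[ℂ] Submodule.span ℂ (s : Set (Op H)) :=
    LinearMap.codRestrict _ (Mω.toStarSubalgebra.subtype.toAlgHom.toLinearMap.comp
      B.subtype.toAlgHom.toLinearMap) (fun x => hs (hB x x.2))
  refine FiniteDimensional.of_injective f fun x y hxy => ?_
  have := congrArg Subtype.val hxy
  exact Subtype.ext (Subtype.ext this)

lemma FinDim_of_fd {Mω : VonNeumannAlgebra H} {B : StarSubalgebra ℂ (RR Mω)}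
    (hB : FiniteDimensional ℂ B) {S : Set (Op H)}
    (hS : ∀ x ∈ S, ∃ y ∈ B, (y : Op H) = x) : FinDim S := by
  classical
  obtain ⟨s, hs⟩ := hB.fg_top
  let f : B →ₗ[ℂ] Op H := Mω.toStarSubalgebra.subtype.toAlgHom.toLinearMap.comp
      B.subtype.toAlgHom.toLinearMap
  refine ⟨s.image f, fun x hx => ?_⟩
  obtain ⟨y, hy, rfl⟩ := hS x hx
  have h1 : (⟨y, hy⟩ : B) ∈ Submodule.span ℂ (s : Set B) := hs ▸ Submodule.mem_top
  have h2 := Submodule.mem_map_of_mem (f := f) h1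
  rw [Submodule.map_span] at h2
  rw [Finset.coe_image]
  exact h2

/-- trace -/
noncomputable def tr' (Mω : VonNeumannAlgebra H) (τ : Op H →ₗ[ℂ] ℂ) : RR Mω →ₗ[ℂ] ℂ :=
  τ.comp Mω.toStarSubalgebra.subtype.toAlgHom.toLinearMap

lemma tr'_apply (Mω : VonNeumannAlgebra H) (τ : Op H →ₗ[ℂ] ℂ) (x : RR Mω) :
    tr' Mω τ x = τ (x : Op H) := rfl

open Classical in
/-- limit -/
noncomputable def lim' (Mω : VonNeumannAlgebra H) (limω : (ℕ → Op H) → Op H)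
    (x : ℕ → RR Mω) : RR Mω :=
  if h : limω (fun n => (x n : Op H)) ∈ Mω then ⟨_, h⟩ else 0

variable {ω : Ultrafilter ℕ} {M Mω : VonNeumannAlgebra H} {τ : Op H →ₗ[ℂ] ℂ}
  {limω : (ℕ → Op H) → Op H}

lemma lim'_val (hU : IsTracialUltrapower ω M Mω τ limω) {x : ℕ → RR Mω}
    (hx : BS (pb Mω M.toStarSubalgebra) x) :
    (lim' Mω limω x : Op H) = limω (fun n => (x n : Op H)) := by
  have h1 : limω (fun n => (x n : Op H)) ∈ Mω := hU.mem _ hx.1 hx.2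
  rw [lim', dif_pos h1]

lemma mkUC (hω : IsFreeUltrafilter ω) (hU : IsTracialUltrapower ω M Mω τ limω) :
    UC ω Mω.toStarSubalgebra.subtype (tr' Mω τ) (pb Mω M.toStarSubalgebra) (lim' Mω limω) := by
  have ts : TrSt (tr' Mω τ) := by
    refine ⟨hU.traceState.map_one, fun x y => hU.traceState.tracial _ x.2 _ y.2,
      fun x => hU.traceState.pos _ x.2, fun x hx => Subtype.ext (hU.traceState.faithful _ x.2 hx)⟩
  refine ⟨ts, hω, Subtype.val_injective, ?_, ?_, ?_, ?_, ?_, ?_, ?_, ?_, ?_, ?_, ?_⟩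
  · intro T hT
    have h1 : T ∈ (Mω : Set (Op H)) := by
      rw [← vn_cc Mω]
      intro S hS
      exact hT S fun x => (hS _ x.2).symm
    exact ⟨⟨T, h1⟩, rfl⟩
  · intro x hx
    have h1 : (x : Op H) ∈ (M : Set (Op H)) := by
      rw [← vn_cc M]
      intro S hS
      exact hx S fun y hy => (hS _ hy).symm
    exact h1
  · exact (closedVN M).preimage continuous_subtype_val
  · intro m hm
    apply Subtype.ext
    rw [lim'_val hU (BS.const hm)]
    exact hU.diag _ hm
  · intro x y hx hy
    apply Subtype.ext
    rw [lim'_val hU (hx.add hy)]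
    exact (hU.map_add _ _ hx.1 hx.2 hy.1 hy.2).trans
      (congrArg₂ (· + ·) (lim'_val hU hx).symm (lim'_val hU hy).symm)
  · intro x y hx hy
    apply Subtype.ext
    rw [lim'_val hU (hx.mul hy)]
    exact (hU.map_mul _ _ hx.1 hx.2 hy.1 hy.2).trans
      (congrArg₂ (· * ·) (lim'_val hU hx).symm (lim'_val hU hy).symm)
  · intro c x hx
    apply Subtype.ext
    rw [lim'_val hU (hx.smul c)]
    exact (hU.map_smul c _ hx.1 hx.2).trans (congrArg (c • ·) (lim'_val hU hx).symm)
  · intro x hx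
    apply Subtype.ext
    rw [lim'_val hU hx.st]
    exact (hU.map_star _ hx.1 hx.2).trans (congrArg star (lim'_val hU hx).symm)
  · intro z
    obtain ⟨x, hx1, hx2, hx3⟩ := hU.surj z z.2
    have hb : BS (pb Mω M.toStarSubalgebra) (fun n => (⟨x n, hU.subset (hx1 n)⟩ : RR Mω)) :=
      ⟨hx1, hx2⟩
    refine ⟨_, hb, Subtype.ext ?_⟩
    rw [lim'_val hU hb]; exact hx3
  · intro x hx
    rw [tr'_apply, lim'_val hU hx]
    exact hU.tr _ hx.1 hx.2
  · intro x hx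
    have h1 : limω (fun n => (x n : Op H)) = 0 ↔
        Tendsto (fun n => ‖τ (star (x n : Op H) * (x n : Op H))‖) ω (𝓝 0) :=
      hU.eq_zero _ hx.1 hx.2
    rw [← lim'_val hU hx] at h1
    have h2 : lim' Mω limω x = 0 ↔ (lim' Mω limω x : Op H) = 0 :=
      ⟨fun h => by rw [h]; rfl, fun h => Subtype.ext h⟩
    rw [h2, h1]
    have h3 : ∀ n, ‖τ (star (x n : Op H) * (x n : Op H))‖ = n2 (tr' Mω τ) (x n) ^ 2 := fun n => by
      have := ts.tau_sq (x n)
      rw [tr'_apply] at this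
      have h4 := congrArg norm this
      rw [Complex.norm_real, Real.norm_of_nonneg (sq_nonneg _)] at h4
      exact h4
    simp only [h3]
    constructor
    · intro h5
      have := h5.sqrt
      rw [Real.sqrt_zero] at this
      refine this.congr fun n => Real.sqrt_sq (n2_nonneg _)
    · intro h5
      simpa using h5.pow 2

end Fin
end PopaQ

open scoped ComplexOrder
open Filter Topology
namespace PopaQ

section Fin2
variable {H : Type u} [NormedAddCommGroup H] [InnerProductSpace ℂ H] [CompleteSpace H]
variable {ω : Ultrafilter ℕ} {M N Mω : VonNeumannAlgebra H} {τ : Op H →ₗ[ℂ] ℂ}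
  {limω : (ℕ → Op H) → Op H}

lemma jones_trivial (hH : (1 : Op H) ≠ 0) {S : Set (Op H)} (h1 : (1 : Op H) ∈ S)
    {E : Op H → Op H} (hE : ∀ q ∈ S, E q = q) :
    {c : ℝ | 0 < c ∧ IndexBound S E c} = {c : ℝ | 1 ≤ c} := by
  ext c
  constructor
  · rintro ⟨_, hc⟩
    have h2 := hc 1 h1 ContinuousLinearMap.isPositive_one
    rw [hE 1 h1] at h2
    obtain ⟨v, hv⟩ : ∃ v : H, v ≠ 0 := by
      by_contra hv
      push Not at hv
      exact hH (by ext v; simp [hv v])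
    have h3 := h2.inner_nonneg_right v
    have h4 : ((c • (1 : Op H) - 1) v) = ((c - 1 : ℝ) : ℂ) • v := by
      rw [Complex.coe_smul]
      simp [sub_smul]
    rw [h4, inner_smul_right, inner_self_eq_norm_sq_to_K] at h3
    have h5 : 0 ≤ (c - 1) * ‖v‖ ^ 2 := by
      have : (0 : ℂ) ≤ (((c - 1) * ‖v‖ ^ 2 : ℝ) : ℂ) := by
        simpa using h3
      exact_mod_cast this
    have h6 : 0 < ‖v‖ ^ 2 := by positivity
    have := nonneg_of_mul_nonneg_left h5 h6
    simp only [Set.mem_setOf_eq]; linarith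
  · intro hc
    simp only [Set.mem_setOf_eq] at hc
    refine ⟨by linarith, fun x hx hp => ?_⟩
    rw [hE x hx]
    have h2 : c • x - x = (((c - 1 : ℝ)) : ℂ) • x := by
      rw [Complex.coe_smul, sub_smul, one_smul]
    rw [h2]
    exact hp.smul_of_nonneg (by exact_mod_cast sub_nonneg.2 hc)

lemma hyp_data (hω : IsFreeUltrafilter ω) (hU : IsTracialUltrapower ω M Mω τ limω)
    {A : ℕ → StarSubalgebra ℂ (Op H)} (hA : Monotone A) (hAM : ∀ n, (A n : Set (Op H)) ⊆ M)
    (hfd : ∀ n, FinDim (A n : Set (Op H)))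
    (hcc : Set.centralizer (Set.centralizer (⋃ n, (A n : Set (Op H)))) = (M : Set (Op H))) :
    Dn (tr' Mω τ) (fun m => pb Mω (A m)) (pb Mω M.toStarSubalgebra) := by
  intro x hx
  have hfd' : ∀ m, FiniteDimensional ℂ (pb Mω (A m)) := fun m => fd_of_FinDim (hfd m) fun x hx => hx
  refine (mkUC hω hU).dense (A := fun m => pb Mω (A m)) (fun i j hij x hx => hA hij hx)
    (fun m x hx => hAM m hx) (fun m => ?_) hx ?_
  · have : FiniteDimensional ℂ (Subalgebra.toSubmodule (pb Mω (A m)).toSubalgebra) := hfd' m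
    exact Submodule.closed_of_finiteDimensional (Subalgebra.toSubmodule (pb Mω (A m)).toSubalgebra)
  · intro S hS
    have h1 : (x : Op H) ∈ (M : Set (Op H)) := hx
    rw [← hcc] at h1
    refine h1 S ?_ 
    intro a ha
    obtain ⟨m, hm⟩ := Set.mem_iUnion.1 ha
    exact (hS m ⟨a, hU.subset (hAM m hm)⟩ hm).symm

lemma hyp_scal (hMM : (M : Set (Op H)) ⊆ Mω) {P : VonNeumannAlgebra H} (hP : (P : Set (Op H)) ⊆ M)
    (hirr : relComm (P : Set (Op H)) (M : Set (Op H)) = scalars H)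
    {A : ℕ → StarSubalgebra ℂ (Op H)} (hAP : ∀ n, (A n : Set (Op H)) ⊆ P)
    (hcc : Set.centralizer (Set.centralizer (⋃ n, (A n : Set (Op H)))) = (P : Set (Op H))) :
    ∀ x ∈ pb Mω M.toStarSubalgebra, (∀ m, ∀ a ∈ pb Mω (A m), a * x = x * a) →
      ∃ c : ℂ, x = c • 1 := by
  intro x hx hc
  have h1 : (x : Op H) ∈ relComm (P : Set (Op H)) (M : Set (Op H)) := by
    refine ⟨hx, fun y hy => ?_⟩
    rw [← hcc] at hy
    refine (hy x ?_).symm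
    intro a ha
    obtain ⟨m, hm⟩ := Set.mem_iUnion.1 ha
    exact congrArg Subtype.val (hc m ⟨a, hMM (hP (hAP m hm))⟩ hm)
  rw [hirr] at h1
  obtain ⟨c, hc⟩ := h1
  exact ⟨c, Subtype.ext hc⟩

lemma mkCE (hMM : (M : Set (Op H)) ⊆ Mω) {EN : Op H → Op H}
    (hNM : (N : Set (Op H)) ⊆ (M : Set (Op H)))
    (hE : IsCondExp τ (M : Set (Op H)) (N : Set (Op H)) EN) :
    ∃ E, CE (tr' Mω τ) (pb Mω M.toStarSubalgebra) (pb Mω N.toStarSubalgebra) E := by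
  let f : Subalgebra.toSubmodule (pb Mω M.toStarSubalgebra).toSubalgebra →ₗ[ℂ] RR Mω :=
    { toFun := fun x => ⟨EN (x.1 : Op H), hMM (hNM (hE.mem _ x.2))⟩
      map_add' := fun x y => Subtype.ext (hE.map_add _ x.2 _ y.2)
      map_smul' := fun c x => Subtype.ext (hE.map_smul c _ x.2) }
  obtain ⟨E, hEf⟩ := LinearMap.exists_extend f
  have hv : ∀ x ∈ pb Mω M.toStarSubalgebra, (E x : Op H) = EN x := fun x hx => by
    have := LinearMap.congr_fun hEf ⟨x, hx⟩
    exact congrArg Subtype.val this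
  have h1N : (1 : Op H) ∈ (N : Set (Op H)) := one_mem N
  refine ⟨E, fun x hx => hNM hx, fun x hx => ?_, fun x hx => ?_, fun a ha x hx => ?_,
    fun a ha x hx => ?_, fun x hx => ?_⟩
  · rw [mem_pb, hv x hx]; exact hE.mem _ hx
  · exact Subtype.ext ((hv x (hNM hx)).trans (hE.fix _ hx))
  · apply Subtype.ext
    rw [hv _ (mul_mem (hNM ha : a ∈ pb Mω M.toStarSubalgebra) hx)]
    have := hE.bimod _ ha _ hx _ h1N
    rw [mul_one, mul_one] at this
    exact this.trans (congrArg (_ * ·) (hv x hx).symm)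
  · apply Subtype.ext
    rw [hv _ (mul_mem hx (hNM ha : a ∈ pb Mω M.toStarSubalgebra))]
    have := hE.bimod _ h1N _ hx _ ha
    rw [one_mul, one_mul] at this
    exact this.trans (congrArg (· * _) (hv x hx).symm)
  · rw [tr'_apply, tr'_apply, hv x hx]; exact hE.tr _ hx

lemma N_eq_M (hω : IsFreeUltrafilter ω) {EN : Op H → Op H}
    (hM : IsII1Factor M τ) 
    (hMhf : IsHyperfinite M) (hNhf : IsHyperfinite N)
    (hNM : (N : Set (Op H)) ⊆ (M : Set (Op H)))
    (hirr : relComm (N : Set (Op H)) (M : Set (Op H)) = scalars H)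
    (hE : IsCondExp τ (M : Set (Op H)) (N : Set (Op H)) EN)
    (hU : IsTracialUltrapower ω M Mω τ limω)
    (hcs : relComm (M : Set (Op H)) (Mω : Set (Op H)) ⊆
      ultrapowerSet limω (N : Set (Op H))) : N = M := by
  obtain ⟨A, hA, hAM, hfd, hcc⟩ := hMhf
  obtain ⟨C, hC, hCN, hfdC, hccC⟩ := hNhf
  obtain ⟨E, hCE⟩ := mkCE hU.subset hNM hE
  have h := mkUC hω hU
  let _ := CStarAlgebra.spectralOrder (RR Mω)
  let _ := CStarAlgebra.spectralOrderedRing (RR Mω)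
  have key : ∀ m, (A m : Set (Op H)) ⊆ N := fun m x hx => by
    refine h.fixA (A := fun m => pb Mω (A m)) (C := fun m => pb Mω (C m))
      (fun i j hij x hx => hA hij hx) (fun m x hx => hAM m hx)
      (hyp_data hω hU hA hAM hfd hcc) (fun m => fd_of_FinDim (hfd m) fun x hx => hx)
      (hyp_scal hU.subset le_rfl hM.factor hAM hcc) hCE (fun i j hij x hx => hC hij hx)
      (fun m x hx => hCN m hx) (fun m => fd_of_FinDim (hfdC m) fun x hx => hx)
      (hyp_scal hU.subset hNM hirr hCN hccC) ?_ (p := m) (x := ⟨x, hU.subset (hAM m hx)⟩) hx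
    intro b hb hbc
    have h1 : ((lim' Mω limω b : RR Mω) : Op H) ∈ relComm (M : Set (Op H)) (Mω : Set (Op H)) :=
      ⟨(lim' Mω limω b).2, fun y hy => congrArg Subtype.val (hbc ⟨y, hU.subset hy⟩ hy)⟩
    obtain ⟨c, hc1, hc2, hc3⟩ := hcs h1
    have hcN : BS (pb Mω N.toStarSubalgebra)
        (fun n => (⟨c n, hU.subset (hNM (hc1 n))⟩ : RR Mω)) := ⟨hc1, hc2⟩
    have hcM : BS (pb Mω M.toStarSubalgebra)
        (fun n => (⟨c n, hU.subset (hNM (hc1 n))⟩ : RR Mω)) := ⟨fun n => hNM (hc1 n), hc2⟩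
    refine ⟨_, hcN, Subtype.ext ?_⟩
    rw [lim'_val hU hcM]
    exact hc3
  apply SetLike.coe_injective
  refine Set.Subset.antisymm hNM ?_
  rw [← hcc, ← vn_cc N]
  exact Set.centralizer_subset (Set.centralizer_subset (Set.iUnion_subset key))

lemma II1_central (hω : IsFreeUltrafilter ω) (hM : IsII1Factor M τ) (hMhf : IsHyperfinite M)
    (hU : IsTracialUltrapower ω M Mω τ limω) :
    IsII1FactorSet (relComm (M : Set (Op H)) (Mω : Set (Op H))) τ := by
  obtain ⟨A, hA, hAM, hfd, hcc⟩ := hMhf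
  have h := mkUC hω hU
  let _ := CStarAlgebra.spectralOrder (RR Mω)
  let _ := CStarAlgebra.spectralOrderedRing (RR Mω)
  have hD := hyp_data hω hU hA hAM hfd hcc
  have hfd' : ∀ m, FiniteDimensional ℂ (pb Mω (A m)) := fun m => fd_of_FinDim (hfd m) fun x hx => hx
  have hcA := hyp_scal (Mω := Mω) hU.subset le_rfl hM.factor hAM hcc
  have hA' : Monotone (fun m => pb Mω (A m)) := fun i j hij x hx => hA hij hx
  have hAM' : ∀ m, pb Mω (A m) ≤ pb Mω M.toStarSubalgebra := fun m x hx => hAM m hx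
  refine ⟨?_, ?_, ?_⟩
  · apply Set.Subset.antisymm
    · rintro x ⟨⟨hx1, hx2⟩, hx3⟩
      obtain ⟨c, hc⟩ := h.factor hA' hAM' hD hfd' hcA (x := ⟨x, hx1⟩)
        (fun y hy => Subtype.ext (hx2 y hy))
        (fun z hz => Subtype.ext (hx3 z ⟨z.2, fun y hy =>
          congrArg Subtype.val (hz ⟨y, hU.subset hy⟩ hy)⟩))
      exact ⟨c, congrArg Subtype.val hc⟩
    · rintro x ⟨c, rfl⟩
      have h1 : c • (1 : Op H) ∈ (Mω : Set (Op H)) :=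
        Mω.toStarSubalgebra.smul_mem (one_mem _) c
      exact ⟨⟨h1, fun y _ => by simp⟩, fun y _ => by simp⟩
  · exact ⟨hU.traceState.map_one, fun x hx y hy => hU.traceState.tracial x hx.1 y hy.1,
      fun x hx => hU.traceState.pos x hx.1, fun x hx => hU.traceState.faithful x hx.1⟩
  · intro hF
    refine h.infdim hA' hAM' hD hfd' hcA ?_ (fd_of_FinDim hF ?_)
    · intro hfin
      exact hM.infdim (FinDim_of_fd hfin fun x hx => ⟨⟨x, hU.subset hx⟩, hx, rfl⟩)
    · intro x hx
      refine ⟨x.2, fun y hy => ?_⟩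
      rw [StarSubalgebra.mem_centralizer_iff] at hx
      exact congrArg Subtype.val (hx ⟨y, hU.subset hy⟩ hy).1

end Fin2

/-- Let `N ⊆ M` be hyperfinite II₁ factors with `N' ∩ M = ℂ1` and
finite Jones index, and `ω` a free ultrafilter on ℕ with `M' ∩ M^ω ⊆ N^ω`. Then
`M' ∩ M^ω ⊆ N' ∩ N^ω ⊆ N' ∩ M^ω` are II₁ factors, and
`[N' ∩ M^ω : M' ∩ M^ω] = [M : N] = [N' ∩ M^ω : N' ∩ N^ω]`. -/
theorem central_sequence_index_equalities
    {H : Type u} [NormedAddCommGroup H] [InnerProductSpace ℂ H] [CompleteSpace H]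
    (ω : Ultrafilter ℕ) (hω : IsFreeUltrafilter ω)
    (M N Mω : VonNeumannAlgebra H) (τ : Op H →ₗ[ℂ] ℂ) (limω : (ℕ → Op H) → Op H)
    (EN : Op H → Op H)
    (hM : IsII1Factor M τ) (hN : IsII1Factor N τ)
    (hMhf : IsHyperfinite M) (hNhf : IsHyperfinite N)
    (hNM : (N : Set (Op H)) ⊆ (M : Set (Op H)))
    (hirr : relComm (N : Set (Op H)) (M : Set (Op H)) = scalars H)
    (hE : IsCondExp τ (M : Set (Op H)) (N : Set (Op H)) EN)
    (hfin : HasFiniteIndex (M : Set (Op H)) EN)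
    (hU : IsTracialUltrapower ω M Mω τ limω)
    (hcs : relComm (M : Set (Op H)) (Mω : Set (Op H)) ⊆
      ultrapowerSet limω (N : Set (Op H))) :
    (relComm (M : Set (Op H)) (Mω : Set (Op H)) ⊆
        relComm (N : Set (Op H)) (ultrapowerSet limω (N : Set (Op H)))) ∧
    (relComm (N : Set (Op H)) (ultrapowerSet limω (N : Set (Op H))) ⊆
        relComm (N : Set (Op H)) (Mω : Set (Op H))) ∧
    IsII1FactorSet (relComm (M : Set (Op H)) (Mω : Set (Op H))) τ ∧
    IsII1FactorSet (relComm (N : Set (Op H)) (ultrapowerSet limω (N : Set (Op H)))) τ ∧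
    IsII1FactorSet (relComm (N : Set (Op H)) (Mω : Set (Op H))) τ ∧
    (∀ E1 : Op H → Op H,
      IsCondExp τ (relComm (N : Set (Op H)) (Mω : Set (Op H)))
        (relComm (M : Set (Op H)) (Mω : Set (Op H))) E1 →
      jonesIndex (relComm (N : Set (Op H)) (Mω : Set (Op H))) E1 =
        jonesIndex (M : Set (Op H)) EN) ∧
    (∀ E2 : Op H → Op H,
      IsCondExp τ (relComm (N : Set (Op H)) (Mω : Set (Op H)))
        (relComm (N : Set (Op H)) (ultrapowerSet limω (N : Set (Op H)))) E2 →
      jonesIndex (relComm (N : Set (Op H)) (Mω : Set (Op H))) E2 =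
        jonesIndex (M : Set (Op H)) EN) := by
  obtain rfl : N = M := N_eq_M hω hM hMhf hNhf hNM hirr hE hU hcs
  have hNω : ultrapowerSet limω (N : Set (Op H)) = (Mω : Set (Op H)) := by
    apply Set.Subset.antisymm
    · rintro z ⟨x, h1, h2, rfl⟩
      exact hU.mem x h1 h2
    · exact fun z hz => hU.surj z hz
  rw [hNω]
  have hII := II1_central hω hM hMhf hU
  have hH : (1 : Op H) ≠ 0 := by
    intro h0
    have := hM.trace.map_one
    rw [h0, map_zero] at this
    exact zero_ne_one this
  have h1 : (1 : Op H) ∈ relComm (N : Set (Op H)) (Mω : Set (Op H)) :=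
    ⟨one_mem Mω, fun y _ => by simp⟩
  have hJ : ∀ E1 : Op H → Op H,
      IsCondExp τ (relComm (N : Set (Op H)) (Mω : Set (Op H)))
        (relComm (N : Set (Op H)) (Mω : Set (Op H))) E1 →
      jonesIndex (relComm (N : Set (Op H)) (Mω : Set (Op H))) E1 =
        jonesIndex (N : Set (Op H)) EN := fun E1 hE1 => by
    rw [jonesIndex, jonesIndex, jones_trivial hH h1 hE1.fix,
      jones_trivial hH (one_mem N : (1 : Op H) ∈ N) hE.fix]
  exact ⟨le_rfl, le_rfl, hII, hII, hII, hJ, hJ⟩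

end PopaQ
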